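/- Let n ≥ 1 and let u be an integer with -18 ≤ u ≤ -2, and set α = u + 1/2. If the pair (n,u) is not in the set E = {(8,-5),(8,-6),(9,-5),(9,-6),(16,-9),(16,-10),(24,-13),(24,-14),(25,-13),(25,-14),(32,-17),(32,-18)}, then the generalised Laguerre polynomial L_n^{(α)}(x) is irreducible over ℚ and the Galois group of its splitting field over ℚ is isomorphic to the full symmetric group S_n on n letters (equivalently, the natural action of its Galois group on its n roots realises every permutation of the roots). -/

import Mathlib

open Polynomial Finset

/-- The generalised Laguerre polynomial `L_n^{(α)}(x)` with `α = u + 1/2`, as a polynomial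
over `ℚ`:  `L_n^{(α)}(x) = (-1)^n ∑_{j=0}^n C(n+α, n-j) (-x)^j / j!`, where
`C(n+α, n-j) = (∏_{i=j+1}^n (α+i))/(n-j)!`. -/
noncomputable def laguerre (n : ℕ) (u : ℤ) : Polynomial ℚ :=
  (-1 : ℚ) ^ n •
    ∑ j ∈ Finset.range (n + 1),
      Polynomial.C ((∏ i ∈ Finset.Icc (j + 1) n, ((u : ℚ) + 1 / 2 + (i : ℚ))) /
          ((Nat.factorial (n - j) : ℚ) * (Nat.factorial j : ℚ))) * (-Polynomial.X) ^ j

/-- The exceptional set of pairs `(n, u)`. -/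
def exceptionalSet : Set (ℤ × ℤ) :=
  {(8, -5), (8, -6), (9, -5), (9, -6), (16, -9), (16, -10), (24, -13), (24, -14),
    (25, -13), (25, -14), (32, -17), (32, -18)}

section Gauss
variable {R Γ : Type*} [CommRing R] [LinearOrderedCommGroupWithZero Γ]

/-- Weight of the `j`-th coefficient. -/
def gw (v : Valuation R Γ) (ρ : Γ) (F : R[X]) (j : ℕ) : Γ := v (F.coeff j) * ρ ^ j

/-- The power of a valuation. -/
def vpow (v : Valuation R Γ) (b : ℕ) (hb : b ≠ 0) : Valuation R Γ where
  toFun x := v x ^ b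
  map_zero' := by simp [hb]
  map_one' := by simp
  map_mul' x y := by simp [mul_pow]
  map_add_le_max' x y := by
    rcases le_max_iff.1 (v.map_add x y) with h | h
    · exact le_max_of_le_left (pow_le_pow_left₀ zero_le h b)
    · exact le_max_of_le_right (pow_le_pow_left₀ zero_le h b)

lemma vpow_apply (v : Valuation R Γ) (b : ℕ) (hb : b ≠ 0) (x : R) : vpow v b hb x = v x ^ b := rfl

lemma gw_mul_le (v : Valuation R Γ) (ρ : Γ) (F H : R[X]) (A B : Γ)
    (hF : ∀ j, gw v ρ F j ≤ A) (hH : ∀ j, gw v ρ H j ≤ B) (t : ℕ) :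
    gw v ρ (F * H) t ≤ A * B := by
  unfold gw
  rw [coeff_mul]
  by_cases hρ : ρ ^ t = 0
  · rw [hρ, mul_zero]; exact zero_le
  have : v (∑ x ∈ antidiagonal t, F.coeff x.1 * H.coeff x.2) ≤ A * B * (ρ ^ t)⁻¹ := by
    apply v.map_sum_le
    intro x hx
    rw [HasAntidiagonal.mem_antidiagonal] at hx
    rw [map_mul, le_mul_inv_iff₀ (zero_lt_iff.2 hρ), ← hx, pow_add]
    calc _ = (v (F.coeff x.1) * ρ ^ x.1) * (v (H.coeff x.2) * ρ ^ x.2) := by ac_rfl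
      _ ≤ _ := mul_le_mul' (hF _) (hH _)
  calc _ ≤ A * B * (ρ ^ t)⁻¹ * ρ ^ t := mul_le_mul_left this _
    _ = _ := by rw [mul_assoc, inv_mul_cancel₀ hρ, mul_one]

lemma gw_mul_lt (v : Valuation R Γ) (ρ : Γ) (hρ : ρ ≠ 0) (F H : R[X]) (A : Γ) (hA : A ≠ 0) (t : ℕ)
    (h : ∀ i j, i + j = t → gw v ρ F i * gw v ρ H j < A) :
    gw v ρ (F * H) t < A := by
  unfold gw
  rw [coeff_mul]
  have hρ : ρ ^ t ≠ 0 := pow_ne_zero _ hρ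
  have : v (∑ x ∈ antidiagonal t, F.coeff x.1 * H.coeff x.2) < A * (ρ ^ t)⁻¹ := by
    apply v.map_sum_lt
    · simp [hA, hρ]
    intro x hx
    rw [HasAntidiagonal.mem_antidiagonal] at hx
    rw [map_mul, lt_mul_inv_iff₀ (zero_lt_iff.2 hρ), ← hx, pow_add]
    calc _ = (v (F.coeff x.1) * ρ ^ x.1) * (v (H.coeff x.2) * ρ ^ x.2) := by ac_rfl
      _ < _ := h _ _ hx
  exact (lt_mul_inv_iff₀ (zero_lt_iff.2 hρ)).1 this

lemma gw_mul_eq (v : Valuation R Γ) (ρ : Γ) (hρ : ρ ≠ 0) (F H : R[X]) (r s : ℕ)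
    (hA : gw v ρ F r ≠ 0) (hB : gw v ρ H s ≠ 0)
    (h : ∀ i j, i + j = r + s → (i, j) ≠ (r, s) →
      gw v ρ F i * gw v ρ H j < gw v ρ F r * gw v ρ H s) :
    gw v ρ (F * H) (r + s) = gw v ρ F r * gw v ρ H s := by
  have hρ' : ρ ^ (r + s) ≠ 0 := pow_ne_zero _ hρ
  have key : v ((F * H).coeff (r + s)) = v (F.coeff r * H.coeff s) := by
    rw [coeff_mul, ← Finset.add_sum_erase _ _ (show (r, s) ∈ antidiagonal (r + s) by simp)]
    apply v.map_add_eq_of_lt_left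
    apply v.map_sum_lt
    · unfold gw at hA hB
      rw [map_mul]
      exact mul_ne_zero (left_ne_zero_of_mul hA) (left_ne_zero_of_mul hB)
    intro x hx
    rw [mem_erase, HasAntidiagonal.mem_antidiagonal] at hx
    have := h x.1 x.2 hx.2 hx.1
    unfold gw at this
    rw [map_mul, map_mul]
    have e : ∀ a b i j, v (F.coeff a) * ρ ^ i * (v (H.coeff b) * ρ ^ j)
      = v (F.coeff a) * v (H.coeff b) * ρ ^ (i + j) := by intros; rw [pow_add]; ac_rfl
    rw [e, e, hx.2] at this
    exact lt_of_mul_lt_mul_right this zero_le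
  unfold gw
  rw [key, map_mul, pow_add]; ac_rfl

/-- existence of right-most maximal weight. -/
lemma exists_right (v : Valuation R Γ) (ρ : Γ) (hρ : ρ ≠ 0) (F : R[X]) (j0 : ℕ)
    (h0 : v (F.coeff j0) ≠ 0) : ∃ r, gw v ρ F r ≠ 0 ∧ (∀ j, gw v ρ F j ≤ gw v ρ F r) ∧
      (∀ j, r < j → gw v ρ F j < gw v ρ F r) := by
  classical
  have hne : (range (F.natDegree + 1)).Nonempty := ⟨0, by simp⟩
  obtain ⟨m, hm, hmax⟩ := exists_max_image (range (F.natDegree + 1)) (gw v ρ F) hne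
  have hout : ∀ j, F.natDegree < j → gw v ρ F j = 0 := fun j hj => by
    unfold gw; rw [coeff_eq_zero_of_natDegree_lt hj]; simp
  have hall : ∀ j, gw v ρ F j ≤ gw v ρ F m := by
    intro j
    by_cases hj : j ≤ F.natDegree
    · exact hmax j (by simp; omega)
    · rw [hout j (by omega)]; exact zero_le
  have hm0 : gw v ρ F m ≠ 0 := by
    intro h
    have := hall j0
    rw [h, le_zero_iff] at this
    unfold gw at this
    exact (mul_ne_zero h0 (pow_ne_zero _ hρ)) this
  obtain ⟨r, hr, hrmax⟩ := exists_max_image ((range (F.natDegree + 1)).filter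
    (fun j => gw v ρ F j = gw v ρ F m)) id ⟨m, by simpa using hm⟩
  rw [mem_filter] at hr
  refine ⟨r, hr.2 ▸ hm0, fun j => hr.2 ▸ hall j, fun j hj => ?_⟩
  rw [hr.2]
  refine lt_of_le_of_ne (hall j) fun he => ?_
  by_cases hj' : j ≤ F.natDegree
  · have := hrmax j (by simp [he]; omega)
    simp at this; omega
  · exact hm0 (he ▸ hout j (by omega))

lemma exists_left (v : Valuation R Γ) (ρ : Γ) (hρ : ρ ≠ 0) (F : R[X]) (j0 : ℕ)
    (h0 : v (F.coeff j0) ≠ 0) : ∃ r, gw v ρ F r ≠ 0 ∧ (∀ j, gw v ρ F j ≤ gw v ρ F r) ∧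
      (∀ j, j < r → gw v ρ F j < gw v ρ F r) := by
  classical
  obtain ⟨m, h1, h2, h3⟩ := exists_right v ρ hρ F j0 h0
  have hex : ∃ j, gw v ρ F j = gw v ρ F m := ⟨m, rfl⟩
  refine ⟨Nat.find hex, ?_, ?_, ?_⟩
  · rw [Nat.find_spec hex]; exact h1
  · rw [Nat.find_spec hex]; exact h2
  · intro j hj
    rw [Nat.find_spec hex]
    exact lt_of_le_of_ne (h2 j) (Nat.find_min hex hj)

lemma right_mul (v : Valuation R Γ) (ρ : Γ) (hρ : ρ ≠ 0) (F H : R[X]) (r s : ℕ)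
    (hA : gw v ρ F r ≠ 0) (hB : gw v ρ H s ≠ 0)
    (hF : ∀ j, gw v ρ F j ≤ gw v ρ F r) (hF' : ∀ j, r < j → gw v ρ F j < gw v ρ F r)
    (hH : ∀ j, gw v ρ H j ≤ gw v ρ H s) (hH' : ∀ j, s < j → gw v ρ H j < gw v ρ H s) :
    gw v ρ (F * H) (r + s) = gw v ρ F r * gw v ρ H s := by
  apply gw_mul_eq v ρ hρ F H r s hA hB
  intro i j hij hne
  rcases lt_trichotomy i r with h | h | h
  · exact mul_lt_mul_of_le_of_lt_of_nonneg_of_pos (hF i) (hH' j (by omega)) zero_le (zero_lt_iff.2 hA)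
  · exact absurd (by ext <;> simp <;> omega) hne
  · exact mul_lt_mul_of_lt_of_le_of_nonneg_of_pos (hF' i h) (hH j) zero_le (zero_lt_iff.2 hB)

lemma left_mul (v : Valuation R Γ) (ρ : Γ) (hρ : ρ ≠ 0) (F H : R[X]) (r s : ℕ)
    (hA : gw v ρ F r ≠ 0) (hB : gw v ρ H s ≠ 0)
    (hF : ∀ j, gw v ρ F j ≤ gw v ρ F r) (hF' : ∀ j, j < r → gw v ρ F j < gw v ρ F r)
    (hH : ∀ j, gw v ρ H j ≤ gw v ρ H s) (hH' : ∀ j, j < s → gw v ρ H j < gw v ρ H s) :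
    gw v ρ (F * H) (r + s) = gw v ρ F r * gw v ρ H s := by
  apply gw_mul_eq v ρ hρ F H r s hA hB
  intro i j hij hne
  rcases lt_trichotomy r i with h | h | h
  · exact mul_lt_mul_of_le_of_lt_of_nonneg_of_pos (hF i) (hH' j (by omega)) zero_le (zero_lt_iff.2 hA)
  · exact absurd (by ext <;> simp <;> omega) hne
  · exact mul_lt_mul_of_lt_of_le_of_nonneg_of_pos (hF' i h) (hH j) zero_le (zero_lt_iff.2 hB)

/-- there is a unique dominating index. -/
def UniqDom (v : Valuation R Γ) (ρ : Γ) (F : R[X]) : Prop :=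
  ∃ r, gw v ρ F r ≠ 0 ∧ ∀ j, j ≠ r → gw v ρ F j < gw v ρ F r

lemma UniqDom.mul (v : Valuation R Γ) (ρ : Γ) (hρ : ρ ≠ 0) {F H : R[X]} (hF : UniqDom v ρ F)
    (hH : UniqDom v ρ H) : UniqDom v ρ (F * H) := by
  obtain ⟨r, hr, hF⟩ := hF
  obtain ⟨s, hs, hH⟩ := hH
  have hF2 : ∀ j, gw v ρ F j ≤ gw v ρ F r := fun j => by
    by_cases h : j = r
    · rw [h]
    · exact (hF j h).le
  have hH2 : ∀ j, gw v ρ H j ≤ gw v ρ H s := fun j => by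
    by_cases h : j = s
    · rw [h]
    · exact (hH j h).le
  have key := right_mul v ρ hρ F H r s hr hs hF2 (fun j hj => hF j (by omega)) hH2
    (fun j hj => hH j (by omega))
  refine ⟨r + s, key ▸ mul_ne_zero hr hs, fun t ht => ?_⟩
  rw [key]
  apply gw_mul_lt v ρ hρ F H _ (mul_ne_zero hr hs)
  intro i j hij
  by_cases hi : i = r
  · exact mul_lt_mul_of_le_of_lt_of_nonneg_of_pos (hF2 i) (hH j (by omega)) zero_le (zero_lt_iff.2 hr)
  · exact mul_lt_mul_of_lt_of_le_of_nonneg_of_pos (hF i hi) (hH2 j) zero_le (zero_lt_iff.2 hs)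

end Gauss

lemma ival_eq (p : ℕ) [Fact p.Prime] {x : ℤ} (hx : x ≠ 0) :
    Int.padicValuation p x = WithZero.exp (-(padicValInt p x : ℤ)) := by
  rw [← Rat.padicValuation_cast]
  simp [Rat.padicValuation, hx, padicValRat.of_int]

lemma gw_int (p : ℕ) [Fact p.Prime] (b : ℕ) (hb : b ≠ 0) (a : ℕ) (F : ℤ[X]) (j : ℕ)
    (hj : F.coeff j ≠ 0) :
    gw (vpow (Int.padicValuation p) b hb) (WithZero.exp (-(a : ℤ))) F j =
      WithZero.exp (-((b * padicValInt p (F.coeff j) + a * j : ℕ) : ℤ)) := by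
  unfold gw
  rw [vpow_apply, ival_eq p hj, ← WithZero.exp_nsmul, ← WithZero.exp_nsmul, ← WithZero.exp_add]
  congr 1
  push_cast
  simp
  ring

lemma gw_int_ne (p : ℕ) [Fact p.Prime] (b : ℕ) (hb : b ≠ 0) (ρ : WithZero (Multiplicative ℤ))
    (F : ℤ[X]) (j : ℕ) (h : gw (vpow (Int.padicValuation p) b hb) ρ F j ≠ 0) : F.coeff j ≠ 0 := by
  intro h0
  apply h
  unfold gw
  rw [h0]; simp

theorem noFactorA (p : ℕ) [Fact p.Prime] (F H : ℤ[X]) (hF : F.Monic) (hH : H.Monic)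
    (n k m : ℕ) (hFk : F.natDegree = k) (hHm : H.natDegree = m) (hn : n = k + m)
    (h0 : ∀ j ≤ n, (F * H).coeff j ≠ 0) (i r js : ℕ) (hjs : js ≤ n)
    (hp : ∀ j, j + i < n → (p : ℤ) ∣ (F * H).coeff j)
    (hr : ∀ j, r < j → j ≤ n → k * padicValInt p ((F * H).coeff js) + js <
      k * padicValInt p ((F * H).coeff j) + j) (hk : r + i < k) : False := by
  have hk0 : k ≠ 0 := by omega
  set v := Int.padicValuation p with hvdef
  set W := vpow v k hk0 with hW
  set ρ : WithZero (Multiplicative ℤ) := WithZero.exp (-((1 : ℕ) : ℤ)) with hρ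
  have hρ0 : ρ ≠ 0 := WithZero.exp_ne_zero
  have hlcF : F.coeff k = 1 := by rw [← hFk]; exact hF.coeff_natDegree
  have hlcH : H.coeff m = 1 := by rw [← hHm]; exact hH.coeff_natDegree
  obtain ⟨rF, a1, a2, a3⟩ := exists_right W ρ hρ0 F k (by rw [hlcF]; simp)
  obtain ⟨rH, b1, b2, b3⟩ := exists_right W ρ hρ0 H m (by rw [hlcH]; simp)
  have e1 := right_mul W ρ hρ0 F H rF rH a1 b1 a2 a3 b2 b3
  have hrF : rF ≤ k := by
    rw [← hFk]; exact le_natDegree_of_ne_zero (gw_int_ne p k hk0 ρ F rF a1)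
  have hrH : rH ≤ m := by
    rw [← hHm]; exact le_natDegree_of_ne_zero (gw_int_ne p k hk0 ρ H rH b1)
  have hsum : rF + rH ≤ r := by
    by_contra hc
    have h1 := hr (rF + rH) (by omega) (by omega)
    have h2 := gw_mul_le W ρ F H _ _ a2 b2 js
    rw [← e1, hW, hρ, hvdef, gw_int p k hk0 1 _ _ (h0 _ hjs), gw_int p k hk0 1 _ _ (h0 _ (by omega)),
      WithZero.exp_le_exp] at h2
    omega
  obtain ⟨lF, c1, c2, c3⟩ := exists_left v 1 one_ne_zero F k (by rw [hlcF]; simp)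
  obtain ⟨lH, d1, d2, d3⟩ := exists_left v 1 one_ne_zero H m (by rw [hlcH]; simp)
  have e2 := left_mul v 1 one_ne_zero F H lF lH c1 d1 c2 c3 d2 d3
  simp only [gw, one_pow, mul_one] at c1 c2 c3 d1 d2 d3 e2
  have f1 : v (F.coeff lF) = 1 := le_antisymm (Int.padicValuation_le_one p _) (by
    have := c2 k; rwa [hlcF, map_one] at this)
  have f2 : v (H.coeff lH) = 1 := le_antisymm (Int.padicValuation_le_one p _) (by
    have := d2 m; rwa [hlcH, map_one] at this)
  have g1 : lF ≤ k := by
    rw [← hFk]; exact le_natDegree_of_ne_zero (fun h => by rw [h] at c1; simp at c1)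
  have g2 : lH ≤ m := by
    rw [← hHm]; exact le_natDegree_of_ne_zero (fun h => by rw [h] at d1; simp at d1)
  rw [f1, f2, mul_one, hvdef, Int.padicValuation_eq_one_iff] at e2
  have hl : n ≤ lF + lH + i := by
    by_contra hc
    exact e2 (hp _ (by omega))
  have hlt := a3 lF (by omega)
  have hd := c3 rF (by omega)
  rw [f1, hvdef, Int.padicValuation_lt_one_iff] at hd
  have hF1 : F.coeff rF ≠ 0 := gw_int_ne p k hk0 ρ F rF a1
  have hF2 : F.coeff lF ≠ 0 := fun h => by rw [h] at c1; simp at c1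
  rw [hW, hρ, hvdef, gw_int p k hk0 1 _ _ hF1, gw_int p k hk0 1 _ _ hF2, WithZero.exp_lt_exp] at hlt
  rw [hvdef, Int.padicValuation_eq_one_iff] at f1
  have z1 : padicValInt p (F.coeff lF) = 0 := by
    exact padicValInt.eq_zero_of_not_dvd f1
  have z2 : 1 ≤ padicValInt p (F.coeff rF) := by
    by_contra hc
    have : padicValInt p (F.coeff rF) = 0 := by omega
    rw [padicValInt, padicValNat.eq_zero_iff] at this
    rcases this with h | h | h
    · exact (Fact.out : p.Prime).one_lt.ne' h
    · exact hF1 (Int.natAbs_eq_zero.1 h)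
    · exact h (Int.natCast_dvd.1 hd)
  rw [z1] at hlt
  have : k * 1 ≤ k * padicValInt p (F.coeff rF) := Nat.mul_le_mul_left k z2
  omega

theorem noFactorC (p : ℕ) [Fact p.Prime] (F H : ℤ[X]) (hF : F.Monic) (hH : H.Monic)
    (n k m : ℕ) (hFk : F.natDegree = k) (hHm : H.natDegree = m) (hn : n = k + m)
    (h0 : ∀ j ≤ n, (F * H).coeff j ≠ 0) (a b r : ℕ) (hrn : r ≤ n) (hab : Nat.Coprime a b)
    (hle : ∀ j ≤ n, b * padicValInt p ((F * H).coeff 0) ≤ b * padicValInt p ((F * H).coeff j) + a * j)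
    (heq : b * padicValInt p ((F * H).coeff r) + a * r = b * padicValInt p ((F * H).coeff 0))
    (hm : m < r) (hkb : k < b) : False := by
  have hb0 : b ≠ 0 := by omega
  set v := Int.padicValuation p with hvdef
  set W := vpow v b hb0 with hW
  set ρ : WithZero (Multiplicative ℤ) := WithZero.exp (-(a : ℤ)) with hρ
  have hρ0 : ρ ≠ 0 := WithZero.exp_ne_zero
  have hlcF : F.coeff k = 1 := by rw [← hFk]; exact hF.coeff_natDegree
  have hlcH : H.coeff m = 1 := by rw [← hHm]; exact hH.coeff_natDegree
  obtain ⟨rF, a1, a2, a3⟩ := exists_right W ρ hρ0 F k (by rw [hlcF]; simp)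
  obtain ⟨rH, b1, b2, b3⟩ := exists_right W ρ hρ0 H m (by rw [hlcH]; simp)
  have e1 := right_mul W ρ hρ0 F H rF rH a1 b1 a2 a3 b2 b3
  have hrF : rF ≤ k := by
    rw [← hFk]; exact le_natDegree_of_ne_zero (gw_int_ne p b hb0 ρ F rF a1)
  have hrH : rH ≤ m := by
    rw [← hHm]; exact le_natDegree_of_ne_zero (gw_int_ne p b hb0 ρ H rH b1)
  have hG0 : gw W ρ F rF * gw W ρ H rH ≤ gw W ρ (F * H) 0 := by
    rw [← e1, hW, hρ, hvdef, gw_int p b hb0 a _ _ (h0 _ (by omega)),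
      gw_int p b hb0 a _ _ (h0 _ (by omega)), WithZero.exp_le_exp]
    have := hle (rF + rH) (by omega)
    omega
  have hG0' : gw W ρ (F * H) 0 = gw W ρ F 0 * gw W ρ H 0 := by
    simp [gw, mul_coeff_zero]
  have hF0 : gw W ρ F 0 = gw W ρ F rF := by
    by_contra hc
    have h1 := lt_of_le_of_ne (a2 0) hc
    have := mul_lt_mul_of_lt_of_le_of_nonneg_of_pos h1 (b2 0) zero_le (zero_lt_iff.2 b1)
    rw [← hG0'] at this
    exact absurd hG0 (not_le.2 this)
  have hr' : r ≤ rF + rH := by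
    by_contra hc
    have h1 : gw W ρ (F * H) r < gw W ρ F rF * gw W ρ H rH := by
      apply gw_mul_lt W ρ hρ0 F H _ (mul_ne_zero a1 b1)
      intro i j hij
      by_cases hi : rF < i
      · exact mul_lt_mul_of_lt_of_le_of_nonneg_of_pos (a3 i hi) (b2 j) zero_le (zero_lt_iff.2 b1)
      · exact mul_lt_mul_of_le_of_lt_of_nonneg_of_pos (a2 i) (b3 j (by omega)) zero_le
          (zero_lt_iff.2 a1)
    have h2 := lt_of_lt_of_le h1 hG0
    rw [hW, hρ, hvdef, gw_int p b hb0 a _ _ (h0 _ (by omega)),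
      gw_int p b hb0 a _ _ (h0 _ (by omega)), WithZero.exp_lt_exp] at h2
    omega
  have n1 : F.coeff 0 ≠ 0 := gw_int_ne p b hb0 ρ F 0 (hF0 ▸ a1)
  have n2 : F.coeff rF ≠ 0 := gw_int_ne p b hb0 ρ F rF a1
  rw [hW, hρ, hvdef, gw_int p b hb0 a _ _ n1, gw_int p b hb0 a _ _ n2, WithZero.exp_inj] at hF0
  have h3 : b * padicValInt p (F.coeff 0) = b * padicValInt p (F.coeff rF) + a * rF := by omega
  have h4 : b ∣ a * rF := (Nat.dvd_add_right (Dvd.intro _ rfl)).1 (h3 ▸ Dvd.intro _ rfl)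
  have h5 : b ∣ rF := hab.symm.dvd_of_dvd_mul_left h4
  have := Nat.le_of_dvd (by omega) h5
  omega

/-- odd factors -/
def ff (u : ℤ) (i : ℕ) : ℤ := 2 * (u + i) + 1

/-- products of the odd factors -/
def aa (n : ℕ) (u : ℤ) (j : ℕ) : ℤ := ∏ i ∈ Finset.Icc (j + 1) n, ff u i

/-- integer coefficients -/
def cc (n : ℕ) (u : ℤ) (j : ℕ) : ℤ := (n.choose j : ℤ) * aa n u j

/-- integral monic model of the Laguerre polynomial -/
noncomputable def GG (n : ℕ) (u : ℤ) : ℤ[X] := ∑ j ∈ Finset.range (n + 1), C (cc n u j) * X ^ j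

lemma ff_ne (u : ℤ) (i : ℕ) : ff u i ≠ 0 := by unfold ff; omega

lemma aa_ne (n u j) : aa n u j ≠ 0 := Finset.prod_ne_zero_iff.2 fun i _ => ff_ne u i

lemma cc_ne (n : ℕ) (u : ℤ) (j : ℕ) (hj : j ≤ n) : cc n u j ≠ 0 :=
  mul_ne_zero (by exact_mod_cast (Nat.choose_pos hj).ne') (aa_ne n u j)

lemma cc_gt (n : ℕ) (u : ℤ) (j : ℕ) (hj : n < j) : cc n u j = 0 := by
  unfold cc; rw [Nat.choose_eq_zero_of_lt hj]; simp

lemma cc_self (n : ℕ) (u : ℤ) : cc n u n = 1 := by simp [cc, aa]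

lemma GG_coeff (n : ℕ) (u : ℤ) (j : ℕ) : (GG n u).coeff j = cc n u j := by
  unfold GG
  rw [finsetSum_coeff]
  simp only [coeff_C_mul, coeff_X_pow]
  by_cases hj : j ≤ n
  · rw [Finset.sum_eq_single j]
    · simp
    · intro b _ hb; simp [hb.symm]
    · intro h; simp at h; omega
  · rw [cc_gt n u j (by omega)]
    apply Finset.sum_eq_zero
    intro b hb
    simp at hb
    simp; omega

lemma GG_natDegree (n : ℕ) (u : ℤ) : (GG n u).natDegree = n := by
  apply le_antisymm
  · rw [natDegree_le_iff_coeff_eq_zero]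
    intro N hN
    rw [GG_coeff, cc_gt n u N hN]
  · apply le_natDegree_of_ne_zero
    rw [GG_coeff, cc_self]; simp

lemma GG_monic (n : ℕ) (u : ℤ) : (GG n u).Monic := by
  unfold Monic leadingCoeff
  rw [GG_natDegree, GG_coeff, cc_self]

/-- the rational model -/
noncomputable def QQ (n : ℕ) (u : ℤ) : ℚ[X] := (GG n u).map (Int.castRingHom ℚ)

lemma laguerre_eq (n : ℕ) (u : ℤ) :
    laguerre n u = C ((-1) ^ n / (n.factorial * 2 ^ n : ℚ)) * (QQ n u).comp (C (-2) * X) := by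
  have h1 : (QQ n u).comp (C (-2) * X) =
      ∑ j ∈ Finset.range (n + 1), C ((cc n u j : ℚ) * (-2) ^ j) * X ^ j := by
    unfold QQ GG
    rw [Polynomial.map_sum, Polynomial.sum_comp]
    apply Finset.sum_congr rfl
    intro j _
    simp only [Polynomial.map_mul, map_C, Polynomial.map_pow, map_X, mul_comp, C_comp, pow_comp, X_comp, mul_pow, ← mul_assoc, C_mul, C_pow]
    simp
  rw [h1, Finset.mul_sum]
  unfold laguerre
  rw [Finset.smul_sum]
  apply Finset.sum_congr rfl
  intro j hj
  have hj' : j ≤ n := by simp at hj; omega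
  rw [neg_pow (X : ℚ[X]), smul_eq_C_mul]
  have : ∏ i ∈ Finset.Icc (j + 1) n, ((u : ℚ) + 1 / 2 + (i : ℚ)) = (aa n u j : ℚ) / 2 ^ (n - j) := by
    unfold aa ff
    push_cast
    rw [show n - j = (Finset.Icc (j + 1) n).card by simp, ← Finset.prod_const, ← Finset.prod_div_distrib]
    apply Finset.prod_congr rfl
    intros; ring
  rw [this]
  have hx : (-1 : ℚ[X]) ^ j = C ((-1) ^ j) := by simp
  rw [hx]
  simp only [← mul_assoc, ← C_mul]
  congr 2
  unfold cc
  push_cast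
  rw [Nat.cast_choose ℚ hj']
  have e2 : (2 : ℚ) ^ n = 2 ^ (n - j) * 2 ^ j := by rw [← pow_add]; congr 1; omega
  have e3 : (-2 : ℚ) ^ j = (-1) ^ j * 2 ^ j := by rw [← mul_pow]; norm_num
  rw [e2, e3]
  have : (n.factorial : ℚ) ≠ 0 := by exact_mod_cast n.factorial_ne_zero
  have : (j.factorial : ℚ) ≠ 0 := by exact_mod_cast j.factorial_ne_zero
  have : ((n - j).factorial : ℚ) ≠ 0 := by exact_mod_cast (n - j).factorial_ne_zero
  field_simp

lemma QQ_monic (n u) : (QQ n u).Monic := (GG_monic n u).map _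
lemma QQ_natDegree (n u) : (QQ n u).natDegree = n := by
  rw [QQ, (GG_monic n u).natDegree_map, GG_natDegree]

lemma const_ne (n : ℕ) : ((-1) ^ n / (n.factorial * 2 ^ n : ℚ)) ≠ 0 := by
  have : (n.factorial : ℚ) ≠ 0 := by exact_mod_cast n.factorial_ne_zero
  positivity

lemma laguerre_irr (n : ℕ) (u : ℤ) (h : Irreducible (QQ n u)) : Irreducible (laguerre n u) := by
  rw [laguerre_eq]
  rw [irreducible_isUnit_mul (isUnit_C.2 (IsUnit.mk0 _ (const_ne n)))]
  let inv : Invertible (-2 : ℚ) := invertibleOfNonzero (by norm_num)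
  have := (MulEquiv.irreducible_iff (algEquivCMulXAddC (-2 : ℚ) 0).toMulEquiv (x := QQ n u)).2 h
  convert this using 1
  simp [algEquivCMulXAddC, Polynomial.aeval_def, comp]

lemma laguerre_gal (n : ℕ) (u : ℤ) : Nonempty ((laguerre n u).Gal ≃* (QQ n u).Gal) := by
  set L := (QQ n u).SplittingField
  have hs : IsSplittingField ℚ L (laguerre n u) := by
    have hsp : ((QQ n u).map (algebraMap ℚ L)).Splits := SplittingField.splits _
    have hmap : (laguerre n u).map (algebraMap ℚ L) =
        C (algebraMap ℚ L ((-1) ^ n / (n.factorial * 2 ^ n : ℚ))) *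
          ((QQ n u).map (algebraMap ℚ L)).comp (C (-2) * X) := by
      rw [laguerre_eq, Polynomial.map_mul, map_C, map_comp]
      simp
    refine ⟨?_, ?_⟩
    · rw [hmap]
      apply Splits.mul (Splits.C _)
      apply hsp.comp_of_natDegree_le_one
      exact (natDegree_C_mul_X _ (by norm_num)).le
    · have h0 : (laguerre n u).map (algebraMap ℚ L) ≠ 0 := by
        rw [hmap]
        apply mul_ne_zero
        · simp [Nat.factorial_ne_zero]
        · intro h
          have h2 : (C (-2) * X : L[X]).natDegree = 1 := natDegree_C_mul_X _ (by norm_num)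
          rw [comp_eq_zero_iff] at h
          rcases h with h | h
          · exact (((QQ_monic n u).map (algebraMap ℚ L)).ne_zero) h
          · have := h.2
            rw [this, natDegree_C] at h2
            omega
      rw [eq_top_iff]
      have htop : (⊤ : Subalgebra ℚ L) = Algebra.adjoin ℚ ((QQ n u).rootSet L) :=
        (SplittingField.adjoin_rootSet (QQ n u)).symm
      rw [htop]
      apply Algebra.adjoin_le
      intro x hx
      have hx' : (-2 : ℚ)⁻¹ • x ∈ (laguerre n u).rootSet L := by
        rw [mem_rootSet'] at hx ⊢
        refine ⟨h0, ?_⟩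
        rw [← eval_map_algebraMap, hmap]
        rw [← eval_map_algebraMap] at hx
        rw [eval_mul, eval_comp]
        have : eval ((-2 : ℚ)⁻¹ • x) (C (-2) * X) = x := by
          simp [Algebra.smul_def]
          ring
        rw [this, hx.2, mul_zero]
      have := Subalgebra.smul_mem _ (Algebra.subset_adjoin (R := ℚ) hx') (-2 : ℚ)
      rwa [smul_inv_smul₀ (by norm_num)] at this
  let e : (laguerre n u).SplittingField ≃ₐ[ℚ] L := (IsSplittingField.algEquiv L (laguerre n u)).symm
  exact ⟨AlgEquiv.autCongr e⟩

lemma irr_of_no_factor (n : ℕ) (u : ℤ) (hn : 1 ≤ n)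
    (h : ∀ F H : ℤ[X], F.Monic → H.Monic → F * H = GG n u → ∀ k, F.natDegree = k → 1 ≤ k →
      2 * k ≤ n → False) : Irreducible (QQ n u) := by
  unfold QQ
  have := ((GG_monic n u).irreducible_iff_irreducible_map_fraction_map (K := ℚ)).1 (by
    rw [(GG_monic n u).irreducible_iff_natDegree']
    refine ⟨fun h1 => by
      have := GG_natDegree n u; rw [h1] at this; simp at this; omega, ?_⟩
    intro f g hf hg hfg hmem
    rw [GG_natDegree] at hmem
    simp at hmem
    exact h g f hg hf (by rw [mul_comm, hfg]) _ rfl (by omega) (by omega))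
  simpa using this

lemma exists_ff_dvd (p : ℕ) (hp : p.Prime) (hp2 : p ≠ 2) (u : ℤ) (j : ℕ) :
    ∃ t, j < t ∧ t ≤ j + p ∧ (p : ℤ) ∣ ff u t := by
  obtain ⟨q, hq⟩ := hp.odd_of_ne_two hp2
  have hpos : (0 : ℤ) < p := by exact_mod_cast hp.pos
  set x : ℤ := ((q : ℤ) * (2 * (u + j + 1) + 1)) % p with hx
  have hx0 : 0 ≤ x := Int.emod_nonneg _ hpos.ne'
  have hx1 : x < p := Int.emod_lt_of_pos _ hpos
  refine ⟨j + 1 + x.toNat, by omega, by omega, ?_⟩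
  have hd : (p : ℤ) ∣ (q : ℤ) * (2 * (u + j + 1) + 1) - x := Int.dvd_self_sub_emod
  have : ff u (j + 1 + x.toNat) = p * (2 * (u + j + 1) + 1) -
      2 * ((q : ℤ) * (2 * (u + j + 1) + 1) - x) := by
    unfold ff
    push_cast
    rw [Int.toNat_of_nonneg hx0, hq]
    push_cast
    ring
  rw [this]
  exact dvd_sub (Dvd.intro _ rfl) (Dvd.dvd.mul_left hd 2)

lemma ff_dvd_iff (p : ℕ) (hp : p.Prime) (hp2 : p ≠ 2) (u : ℤ) (j t : ℕ) (hj : (p : ℤ) ∣ ff u j) :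
    (p : ℤ) ∣ ff u t ↔ (p : ℤ) ∣ (t : ℤ) - j := by
  have : ff u t = ff u j + 2 * ((t : ℤ) - j) := by unfold ff; ring
  rw [this, dvd_add_right hj]
  constructor
  · intro h
    have hc : IsCoprime (p : ℤ) 2 := by
      rw [Int.isCoprime_iff_gcd_eq_one]
      have := (Nat.coprime_primes hp Nat.prime_two).2 hp2
      simpa [Int.gcd] using this
    exact hc.dvd_of_dvd_mul_left h
  · intro h; exact Dvd.dvd.mul_left h 2

/-- partial sums of valuations -/
def SS (p : ℕ) (u : ℤ) (j : ℕ) : ℕ := ∑ t ∈ Finset.range j, padicValInt p (ff u (t + 1))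

lemma SS_succ (p : ℕ) (u : ℤ) (j : ℕ) : SS p u (j + 1) = SS p u j + padicValInt p (ff u (j + 1)) := by
  unfold SS; rw [Finset.sum_range_succ]

lemma padicValInt_prod (p : ℕ) [Fact p.Prime] (s : Finset ℕ) (f : ℕ → ℤ) (h : ∀ i ∈ s, f i ≠ 0) :
    padicValInt p (∏ i ∈ s, f i) = ∑ i ∈ s, padicValInt p (f i) := by
  classical
  induction s using Finset.induction_on with
  | empty => simp
  | insert a s ha ih =>
    rw [Finset.prod_insert ha, Finset.sum_insert ha, padicValInt.mul, ih]
    · exact fun i hi => h i (by simp [hi])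
    · exact h a (by simp)
    · exact Finset.prod_ne_zero_iff.2 fun i hi => h i (by simp [hi])

lemma val_cc (p : ℕ) [Fact p.Prime] (n : ℕ) (u : ℤ) (j : ℕ) (hj : j ≤ n) :
    padicValInt p (cc n u j) + SS p u j = padicValNat p (n.choose j) + SS p u n := by
  have h1 : padicValInt p (cc n u j) = padicValNat p (n.choose j) + padicValInt p (aa n u j) := by
    unfold cc
    rw [padicValInt.mul (by exact_mod_cast (Nat.choose_pos hj).ne') (aa_ne n u j), padicValInt.of_nat]
  have h2 : padicValInt p (aa n u j) + SS p u j = SS p u n := by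
    unfold aa SS
    rw [padicValInt_prod p _ _ (fun i _ => ff_ne u i)]
    rw [← Finset.sum_range_add_sum_Ico _ hj, add_comm]
    congr 1
    rw [Finset.sum_Ico_add' (fun t => padicValInt p (ff u t)) j n 1]
    rfl
  omega

lemma padicValInt_zero_of (p : ℕ) (x : ℤ) (h : ¬ (p : ℤ) ∣ x) : padicValInt p x = 0 :=
  padicValInt.eq_zero_of_not_dvd h

lemma SS_const (p : ℕ) (hp : p.Prime) (hp2 : p ≠ 2) (u : ℤ) (j e : ℕ) (hj : (p : ℤ) ∣ ff u j)
    (he : e < p) : SS p u (j + e) = SS p u j := by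
  induction e with
  | zero => rfl
  | succ e ih =>
    rw [← add_assoc, SS_succ, ih (by omega), padicValInt_zero_of, add_zero]
    rw [ff_dvd_iff p hp hp2 u j _ hj]
    push_cast
    intro h
    have : (j : ℤ) + e + 1 - j = ((e + 1 : ℕ) : ℤ) := by push_cast; ring
    rw [this, Int.natCast_dvd_natCast] at h
    have := Nat.le_of_dvd (by omega) h
    omega

lemma SS_zero (p : ℕ) (hp : p.Prime) (hp2 : p ≠ 2) (u : ℤ) (j0 e : ℕ) (hj : (p : ℤ) ∣ ff u j0)
    (hj0 : j0 ≤ p) (he : e < j0) : SS p u e = 0 := by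
  unfold SS
  apply Finset.sum_eq_zero
  intro t ht
  rw [Finset.mem_range] at ht
  apply padicValInt_zero_of
  rw [ff_dvd_iff p hp hp2 u j0 _ hj]
  intro h
  have h' : (p : ℤ) ∣ (((j0 - (t + 1)) : ℕ) : ℤ) := by
    rw [← dvd_neg] at h
    have e : (((j0 - (t + 1)) : ℕ) : ℤ) = -(((t + 1 : ℕ) : ℤ) - j0) := by
      rw [Nat.cast_sub (by omega)]; ring
    rwa [e]
  rw [Int.natCast_dvd_natCast] at h'
  have := Nat.le_of_dvd (by omega) h'
  omega

lemma odd_sum_le (p : ℕ) [hp : Fact p.Prime] (s : ℕ) :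
    ∑ w ∈ Finset.range s, padicValNat p (2 * w + 3) ≤ padicValNat p (2 * s + 1).factorial := by
  induction s with
  | zero => simp
  | succ s ih =>
    rw [Finset.sum_range_succ, show 2 * (s + 1) + 1 = (2 * s + 1) + 1 + 1 by ring,
      Nat.factorial_succ, Nat.factorial_succ, padicValNat.mul (by omega) (by positivity),
      padicValNat.mul (by omega) (by positivity)]
    have : 2 * s + 1 + 1 + 1 = 2 * s + 3 := by ring
    rw [this]
    omega

lemma odd_sum_le' (p : ℕ) [hp : Fact p.Prime] (s : ℕ) :
    (p - 1) * ∑ w ∈ Finset.range s, padicValNat p (2 * w + 3) ≤ 2 * s := by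
  have h1 := Nat.mul_le_mul_left (p - 1) (odd_sum_le p s)
  have h2 := sub_one_mul_padicValNat_factorial (p := p) (2 * s + 1)
  have h3 : 1 ≤ (p.digits (2 * s + 1)).sum := by
    by_contra h
    have h0 : (p.digits (2 * s + 1)).sum = 0 := by omega
    have := (Nat.digits_ne_nil_iff_ne_zero (b := p)).2 (show 2 * s + 1 ≠ 0 by omega)
    have hlast := Nat.getLast_digit_ne_zero p (show 2 * s + 1 ≠ 0 by omega)
    have hmem := List.getLast_mem this
    rw [List.sum_eq_zero_iff] at h0
    exact hlast (h0 _ hmem)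
  omega

/-- main growth bound -/
lemma SS_growth (p : ℕ) [hp : Fact p.Prime] (hp5 : 5 ≤ p) (u : ℤ) (j0 : ℕ) (m : ℤ)
    (hm : ff u j0 = p * m) (hm1 : -5 ≤ m) (hm2 : m ≤ 1) (s : ℕ) :
    ∃ V, (p - 1) * V ≤ 2 * s ∧ SS p u (j0 + p * s) = SS p u j0 + s + V := by
  have hpp := hp.out
  have hodd : m % 2 = 1 := by
    have : ff u j0 % 2 = 1 := by unfold ff; omega
    rw [hm, Int.mul_emod] at this
    rcases Int.emod_two_eq_zero_or_one m with h | h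
    · rw [h] at this; simp at this
    · exact h
  obtain ⟨d, hd, hd3⟩ : ∃ d : ℕ, m = 1 - 2 * d ∧ d ≤ 3 := ⟨((1 - m) / 2).toNat, by omega, by omega⟩
  have step : ∀ s : ℕ, SS p u (j0 + p * s) ≤ SS p u j0 + s + ∑ w ∈ Finset.range (s - d), padicValNat p (2 * w + 3)
      ∧ SS p u j0 + s ≤ SS p u (j0 + p * s) := by
    intro s
    induction s with
    | zero => simp
    | succ s ih =>
      have e1 : j0 + p * (s + 1) = (j0 + p * s + (p - 1)) + 1 := by
        rw [mul_add]; omega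
      have hdv : (p : ℤ) ∣ ff u (j0 + p * s) := by
        have : ff u (j0 + p * s) = p * (m + 2 * s) := by
          have : ff u (j0 + p * s) = ff u j0 + 2 * (p * s) := by unfold ff; push_cast; ring
          rw [this, hm]; ring
        rw [this]; exact Dvd.intro _ rfl
      have e2 : ff u (j0 + p * (s + 1)) = p * (1 + 2 * ((s : ℤ) + 1 - d)) := by
        have : ff u (j0 + p * (s + 1)) = ff u j0 + 2 * (p * (s + 1)) := by unfold ff; push_cast; ring
        rw [this, hm, hd]; ring
      rw [e1, SS_succ, SS_const p hpp (by omega) u _ (p - 1) hdv (by omega), ← e1, e2,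
        padicValInt.mul (by exact_mod_cast hpp.ne_zero) (by omega)]
      have e3 : padicValInt p (p : ℤ) = 1 := by
        rw [padicValInt.of_nat]; exact padicValNat_self
      rw [e3]
      refine ⟨?_, by omega⟩
      by_cases hs : d ≤ s
      · rw [show s + 1 - d = (s - d) + 1 by omega, Finset.sum_range_succ]
        have : (1 + 2 * ((s : ℤ) + 1 - d)) = ((2 * (s - d) + 3 : ℕ) : ℤ) := by
          push_cast [Nat.cast_sub hs]; ring
        rw [this, padicValInt.of_nat]
        omega
      · have hz : padicValInt p (1 + 2 * ((s : ℤ) + 1 - d)) = 0 := by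
          apply padicValInt_zero_of
          intro h
          rw [← Int.dvd_natAbs, Int.natCast_dvd_natCast] at h
          have := Nat.le_of_dvd (by omega) h
          omega
        rw [hz, show s + 1 - d = 0 by omega]
        rw [show s - d = 0 by omega] at ih
        simp at ih ⊢
        omega
  obtain ⟨h1, h2⟩ := step s
  refine ⟨SS p u (j0 + p * s) - SS p u j0 - s, ?_, by omega⟩
  have h3 := odd_sum_le' p (s - d)
  have h4 : SS p u (j0 + p * s) - SS p u j0 - s ≤ ∑ w ∈ Finset.range (s - d), padicValNat p (2 * w + 3) := by omega
  have := Nat.mul_le_mul_left (p - 1) h4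
  omega

lemma choose_dvd (p : ℕ) (hp : p.Prime) (a n i j : ℕ) (hin : i < n) (hip : i + 1 < p) (hd : p ^ a ∣ n - i)
    (hj : i < j % p) : p ^ a ∣ n.choose j := by
  by_cases hjn : j ≤ n
  swap
  · rw [Nat.choose_eq_zero_of_lt (by omega)]; exact dvd_zero _
  have hij : i + 1 ≤ j := by
    have := Nat.mod_le j p; omega
  have h1 : p ^ a ∣ n.choose (i + 1) := by
    have h2 : p ^ a ∣ n.descFactorial (i + 1) := by
      rw [Nat.descFactorial_succ]; exact Dvd.dvd.mul_right hd _
    rw [Nat.descFactorial_eq_factorial_mul_choose] at h2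
    apply Nat.Coprime.dvd_of_dvd_mul_left _ h2
    apply Nat.Coprime.pow_left
    rw [hp.coprime_iff_not_dvd, hp.dvd_factorial]; omega
  have h3 := Nat.choose_mul (n := n) hij
  have h4 : p ^ a ∣ n.choose j * j.choose (i + 1) := by rw [h3]; exact Dvd.dvd.mul_right h1 _
  apply Nat.Coprime.dvd_of_dvd_mul_right _ h4
  apply Nat.Coprime.pow_left
  rw [hp.coprime_iff_not_dvd]
  intro h5
  have h6 : p ∣ j.descFactorial (i + 1) := by
    rw [Nat.descFactorial_eq_factorial_mul_choose]; exact Dvd.dvd.mul_left h5 _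
  rw [Nat.descFactorial_eq_prod_range, hp.prime.dvd_finsetProd_iff] at h6
  obtain ⟨t, ht, h7⟩ := h6
  rw [Finset.mem_range] at ht
  have h8 := Nat.mod_add_div j p
  have h9 : j - t = (j % p - t) + p * (j / p) := by omega
  rw [h9] at h7
  have h10 := (Nat.dvd_add_left (Dvd.intro _ rfl)).1 h7
  have h11 := Nat.le_of_dvd (by omega) h10
  have := Nat.mod_lt j hp.pos
  omega

lemma choose_not_dvd (p : ℕ) (hp : p.Prime) (n i j : ℕ) (hin : i < n) (hip : i < p) (hd : p ∣ n - i)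
    (hj : j ≤ i) : ¬ p ∣ n.choose j := by
  intro h5
  have h6 : p ∣ n.descFactorial j := by
    rw [Nat.descFactorial_eq_factorial_mul_choose]; exact Dvd.dvd.mul_left h5 _
  rw [Nat.descFactorial_eq_prod_range, hp.prime.dvd_finsetProd_iff] at h6
  obtain ⟨t, ht, h7⟩ := h6
  rw [Finset.mem_range] at ht
  have h9 : n - t = (n - i) + (i - t) := by omega
  rw [h9] at h7
  have h10 := (Nat.dvd_add_right hd).1 h7
  have h11 := Nat.le_of_dvd (by omega) h10
  omega

lemma arith1 (p k s V : ℕ) (hk : k + 2 ≤ p) (hV : (p - 1) * V ≤ 2 * s) : k * (s + V) ≤ p * s := by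
  obtain ⟨q, rfl⟩ : ∃ q, p = k + 2 + q := ⟨p - (k + 2), by omega⟩
  have : k + 2 + q - 1 = k + 1 + q := by omega
  rw [this] at hV
  nlinarith

lemma arith1' (p k s V : ℕ) (hk : k + 2 ≤ p) (hV : (p - 1) * V ≤ 2 * s) (hs : 0 < s) : k * (s + V) < p * s := by
  obtain ⟨q, rfl⟩ : ∃ q, p = k + 2 + q := ⟨p - (k + 2), by omega⟩
  have : k + 2 + q - 1 = k + 1 + q := by omega
  rw [this] at hV
  rcases Nat.eq_zero_or_pos V with h | h
  · subst h; nlinarith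
  · nlinarith

lemma arith2 (p k s V : ℕ) (hk : k + 2 ≤ p) (hV : (p - 1) * V ≤ 2 * s) : k * (s + 1 + V) < p * (s + 1) := by
  apply arith1' p k (s + 1) V hk _ (by omega)
  omega

theorem noFactor_P (p : ℕ) (hp : p.Prime) (n : ℕ) (u : ℤ) (k i : ℕ) (hp5 : 5 ≤ p) (hkp : k + 2 ≤ p)
    (hu1 : -18 ≤ u) (hu2 : u ≤ -2) (hik : i < k) (hkn : 2 * k ≤ n) (hd : p ∣ n - i)
    (h75 : 7 ≤ p ∨ (p = 5 ∧ 25 ∣ n - i))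
    (F H : ℤ[X]) (hF : F.Monic) (hH : H.Monic) (hFH : F * H = GG n u) (hFk : F.natDegree = k) : False := by
  haveI : Fact p.Prime := ⟨hp⟩
  have hp2 : p ≠ 2 := by omega
  obtain ⟨j0, hj1, hj2, hj0⟩ := exists_ff_dvd p hp hp2 u 0
  rw [zero_add] at hj2
  obtain ⟨m, hm⟩ := id hj0
  have hpz : (5 : ℤ) ≤ p := by exact_mod_cast hp5
  have hff : ff u j0 = 2 * (u + j0) + 1 := rfl
  have hm2 : m ≤ 1 := by
    by_contra hc
    have : (p : ℤ) * 2 ≤ p * m := by nlinarith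
    omega
  have hm1' : -6 ≤ m := by
    by_contra hc
    have : (p : ℤ) * m ≤ p * (-7) := by nlinarith
    omega
  have hmodd : m % 2 = 1 := by
    rcases Int.emod_two_eq_zero_or_one m with h | h
    · have : m = 2 * (m / 2) := by omega
      rw [this] at hm
      have : (p : ℤ) * (2 * (m / 2)) = 2 * (p * (m / 2)) := by ring
      omega
    · exact h
  have hm1 : -5 ≤ m := by omega
  have hm3 : 7 ≤ p → -3 ≤ m := by
    intro h7
    by_contra hc
    have h7' : (7 : ℤ) ≤ p := by exact_mod_cast h7
    have hm5 : m ≤ -5 := by omega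
    have : (p : ℤ) * m ≤ p * (-5) := by nlinarith
    omega
  -- growth
  have growth : ∀ s e, e < p → ∃ V, (p - 1) * V ≤ 2 * s ∧ SS p u (j0 + p * s + e) = SS p u j0 + s + V := by
    intro s e he
    obtain ⟨V, h1, h2⟩ := SS_growth p hp5 u j0 m hm hm1 hm2 s
    refine ⟨V, h1, ?_⟩
    rw [SS_const p hp hp2 u _ e _ he, h2]
    rw [ff_dvd_iff p hp hp2 u j0 _ hj0]
    push_cast
    exact ⟨s, by ring⟩
  have hm0 : m ≠ 0 := by omega
  have hSS0 : SS p u j0 = 1 + padicValInt p m := by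
    obtain ⟨q, rfl⟩ : ∃ q, j0 = q + 1 := ⟨j0 - 1, by omega⟩
    rw [SS_succ, SS_zero p hp hp2 u (q + 1) q hj0 hj2 (by omega), hm,
      padicValInt.mul (by exact_mod_cast hp.ne_zero) hm0, padicValInt.of_nat, padicValNat_self]
    omega
  have hHm : H.natDegree = n - k := by
    have := GG_natDegree n u
    rw [← hFH, hF.natDegree_mul hH, hFk] at this
    omega
  have hne : ∀ j ≤ n, (F * H).coeff j ≠ 0 := by
    intro j hj; rw [hFH, GG_coeff]; exact cc_ne n u j hj
  have hdecomp : ∀ j, j0 ≤ j → ∃ s e, e < p ∧ j = j0 + p * s + e := by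
    intro j hj
    refine ⟨(j - j0) / p, (j - j0) % p, Nat.mod_lt _ hp.pos, ?_⟩
    have := Nat.div_add_mod (j - j0) p
    omega
  by_cases hc : j0 ≤ i
  · refine noFactorA p F H hF hH n k (n - k) hFk hHm (by omega) hne (i - j0) j0 j0 (by omega) ?_ ?_ (by omega)
    · intro j hj
      rw [hFH, GG_coeff]
      unfold cc aa
      apply Dvd.dvd.mul_left
      refine dvd_trans ?_ (Finset.dvd_prod_of_mem (fun i => ff u i) (a := n - i + j0) (by rw [Finset.mem_Icc]; omega))
      rw [ff_dvd_iff p hp hp2 u j0 _ hj0]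
      push_cast
      rw [add_sub_cancel_right]
      exact_mod_cast hd
    · intro j hj hjn
      rw [hFH, GG_coeff, GG_coeff]
      have e1 := val_cc p n u j hjn
      have e2 := val_cc p n u j0 (by omega)
      rw [padicValNat.eq_zero_of_not_dvd (choose_not_dvd p hp n i j0 (by omega) (by omega) hd hc)] at e2
      obtain ⟨s, e, he, rfl⟩ := hdecomp j hj.le
      obtain ⟨V, hV, hS⟩ := growth s e he
      have h3 : padicValInt p (cc n u j0) ≤ padicValInt p (cc n u (j0 + p * s + e)) + (s + V) := by omega
      have h4 := Nat.mul_le_mul_left k h3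
      rw [mul_add] at h4
      rcases Nat.eq_zero_or_pos s with h | h
      · subst h
        have := arith1 p k 0 V hkp hV
        omega
      · have := arith1' p k s V hkp hV h
        omega
  · push Not at hc
    refine noFactorA p F H hF hH n k (n - k) hFk hHm (by omega) hne i 0 0 (by omega) ?_ ?_ (by omega)
    · intro j hj
      rw [hFH, GG_coeff]
      unfold cc
      by_cases hnj : p ≤ n - j
      · apply Dvd.dvd.mul_left
        obtain ⟨t, t1, t2, t3⟩ := exists_ff_dvd p hp hp2 u j
        exact dvd_trans t3 (Finset.dvd_prod_of_mem (fun i => ff u i) (a := t) (by rw [Finset.mem_Icc]; omega))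
      · apply Dvd.dvd.mul_right
        rw [← Nat.choose_symm (show j ≤ n by omega)]
        have := choose_dvd p hp 1 n i (n - j) (by omega) (by omega) (by simpa using hd)
          (by rw [Nat.mod_eq_of_lt (by omega)]; omega)
        rw [pow_one] at this
        exact_mod_cast this
    · intro j hj hjn
      rw [hFH, GG_coeff, GG_coeff]
      have e1 := val_cc p n u j hjn
      have e2 := val_cc p n u 0 (by omega)
      have hS0 : SS p u 0 = 0 := rfl
      rw [hS0, Nat.choose_zero_right, padicValNat_one_right] at e2
      by_cases hjj : j < j0
      · rw [SS_zero p hp hp2 u j0 j hj0 hj2 hjj] at e1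
        have h3 : padicValInt p (cc n u 0) ≤ padicValInt p (cc n u j) := by omega
        have h4 := Nat.mul_le_mul_left k h3
        omega
      push Not at hjj
      have hC0 : n.choose j ≠ 0 := (Nat.choose_pos hjn).ne'
      obtain ⟨s, e, he, hjse⟩ := hdecomp j hjj
      obtain ⟨V, hV, hS⟩ := growth s e he
      rw [← hjse] at hS
      -- valuation of m
      have hδ : padicValInt p m = 0 ∨ (p = 5 ∧ m = -5 ∧ padicValInt p m = 1) := by
        by_cases h : p = 5 ∧ m = -5
        · right
          refine ⟨h.1, h.2, ?_⟩
          rw [h.1, h.2]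
          show padicValNat 5 5 = 1
          haveI : Fact (Nat.Prime 5) := ⟨by norm_num⟩
          exact padicValNat_self
        · left
          apply padicValInt_zero_of
          intro hdv
          rw [← Int.dvd_natAbs, Int.natCast_dvd_natCast] at hdv
          have h1 := Nat.le_of_dvd (by omega) hdv
          have h2 : m = -5 := by omega
          have h3 : p = 5 := by omega
          exact h ⟨h3, h2⟩
      -- reduce
      suffices hsuff : k * (1 + padicValInt p m + s + V) < k * padicValNat p (n.choose j) + j by
        have h3 : padicValInt p (cc n u 0) + padicValNat p (n.choose j) =
          padicValInt p (cc n u j) + (1 + padicValInt p m + s + V) := by omega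
        have h4 : k * (padicValInt p (cc n u 0) + padicValNat p (n.choose j)) =
          k * (padicValInt p (cc n u j) + (1 + padicValInt p m + s + V)) := by rw [h3]
        rw [mul_add, mul_add] at h4
        omega
      by_cases hmod : i < j % p
      · have hv : 1 + padicValInt p m ≤ padicValNat p (n.choose j) := by
          rcases hδ with h | ⟨h1, h2, h3⟩
          · rw [h]
            have := choose_dvd p hp 1 n i j (by omega) (by omega) (by simpa using hd) hmod
            exact (padicValNat_dvd_iff_le hC0).1 this
          · rw [h3]
            have h25 : p ^ 2 ∣ n - i := by
              rcases h75 with h | h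
              · omega
              · rw [h.1]; exact h.2
            have := choose_dvd p hp 2 n i j (by omega) (by omega) h25 hmod
            exact (padicValNat_dvd_iff_le hC0).1 this
        have h1 := arith1 p k s V hkp hV
        have h2 := Nat.mul_le_mul_left k hv
        have h3 : k * (1 + padicValInt p m + s + V) = k * (1 + padicValInt p m) + k * (s + V) := by ring
        omega
      · push Not at hmod
        have hj3 : p ≤ j0 + e := by
          by_contra hcon
          have : j % p = j0 + e := by
            rw [hjse, show j0 + p * s + e = j0 + e + p * s by ring, Nat.add_mul_mod_self_left,
              Nat.mod_eq_of_lt (by omega)]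
          omega
        have hj4 : p * (s + 1) ≤ j := by rw [mul_add]; omega
        have h1 := arith2 p k s V hkp hV
        rcases hδ with h | ⟨h1', h2, h3⟩
        · rw [h]
          have : k * (1 + 0 + s + V) = k * (s + 1 + V) := by ring
          omega
        · rw [h3]
          by_cases h5 : p ∣ n.choose j
          · have hv : 1 ≤ padicValNat p (n.choose j) := one_le_padicValNat_of_dvd hC0 h5
            have h2 := Nat.mul_le_mul_left k hv
            have h3 : k * (1 + 1 + s + V) = k * 1 + k * (s + 1 + V) := by ring
            omega
          · have hl := Choose.choose_modEq_choose_mod_mul_choose_div_nat (n := n) (k := j) (p := p)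
            have hl2 := Choose.choose_modEq_choose_mod_mul_choose_div_nat (n := n / p) (k := j / p) (p := p)
            subst h1'
            have h25 : 25 ∣ n - i := by
              rcases h75 with h | h
              · omega
              · exact h.2
            have hj5 : (j / 5) % 5 = 0 := by
              by_contra hcon
              apply h5
              have h6 : (n / 5) % 5 = 0 := by omega
              rw [h6, Nat.choose_eq_zero_of_lt (show 0 < (j / 5) % 5 by omega), zero_mul] at hl2
              have h7 := (hl2.mul_left ((n % 5).choose (j % 5)))
              rw [mul_zero] at h7
              exact (Nat.modEq_zero_iff_dvd).1 (hl.trans h7)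
            have hk3 : k ≤ 3 := by omega
            have hs4 : 4 ≤ s := by omega
            have : k * (1 + 1 + s + V) ≤ 3 * (1 + 1 + s + V) := Nat.mul_le_mul_right _ hk3
            omega

lemma aa_succ (n : ℕ) (u : ℤ) (j : ℕ) (hj : j ≤ n) : aa (n + 1) u j = aa n u j * ff u (n + 1) := by
  unfold aa; rw [Finset.prod_Icc_succ_top (by omega)]

lemma aa_pred (n : ℕ) (u : ℤ) (j : ℕ) (hj : j + 1 ≤ n) : aa n u j = ff u (j + 1) * aa n u (j + 1) := by
  unfold aa; rw [← Finset.mul_prod_Ioc_eq_prod_Icc (by omega), Finset.Icc_add_one_left_eq_Ioc]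

lemma aa_self (n : ℕ) (u : ℤ) : aa n u n = 1 := by simp [aa]

lemma GG_rec (n : ℕ) (u : ℤ) : GG (n + 2) u = (X + C (4 * (n + 1) + 2 * u + 3)) * GG (n + 1) u
    - C (2 * (n + 1) * ff u (n + 1)) * GG n u := by
  ext j
  rw [coeff_sub, add_mul, coeff_add, coeff_C_mul, coeff_C_mul]
  simp only [GG_coeff]
  rcases j with _ | j
  · rw [coeff_X_mul_zero]
    unfold cc
    rw [aa_succ _ _ _ (by omega), aa_succ _ _ _ (by omega)]
    simp only [Nat.choose_zero_right]
    unfold ff; push_cast; ring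
  · rw [coeff_X_mul, GG_coeff]
    rcases lt_trichotomy j n with h | h | h
    · unfold cc
      rw [aa_succ (n + 1) u (j + 1) (by omega), aa_succ n u (j + 1) (by omega),
        aa_pred (n + 1) u j (by omega), aa_succ n u (j + 1) (by omega)]
      have h1 : ((n + 2).choose (j + 1) : ℤ) = (n + 1).choose j + (n + 1).choose (j + 1) := by
        exact_mod_cast Nat.choose_succ_succ (n + 1) j
      have h2 : ((n + 1).choose (j + 1) : ℤ) * (j + 1) = (n + 1).choose j * (n + 1 - j) := by
        have := Nat.choose_succ_right_eq (n + 1) j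
        have e : ((n + 1 - j : ℕ) : ℤ) = n + 1 - j := by rw [Nat.cast_sub (by omega)]; push_cast; ring
        rw [← e]; exact_mod_cast this
      have h3 : ((n + 1).choose (j + 1) : ℤ) * (n - j) = (n + 1) * n.choose (j + 1) := by
        have := Nat.choose_mul_succ_eq n (j + 1)
        have e : ((n + 1 - (j + 1) : ℕ) : ℤ) = n - j := by rw [Nat.cast_sub (by omega)]; push_cast; ring
        rw [← e]
        have t : (n.choose (j + 1) : ℤ) * (n + 1) = (n + 1).choose (j + 1) * ((n + 1 - (j + 1) : ℕ) : ℤ) := by exact_mod_cast this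
        rw [← t]; ring
      rw [h1]
      unfold ff
      push_cast
      linear_combination (aa n u (j + 1) * (2 * (u + (n + 1)) + 1)) * (-2 * h2 - 2 * h3)
    · subst h
      unfold cc
      rw [aa_succ (j + 1) u (j + 1) (by omega), aa_self, aa_pred (j + 1) u j (by omega), aa_self]
      simp only [Nat.choose_self, Nat.choose_succ_self, Nat.choose_succ_self_right]
      unfold ff; push_cast; ring
    · rw [cc_gt n u (j + 1) (by omega)]
      rcases Nat.lt_or_ge j (n + 2) with h2 | h2
      · have : j = n + 1 := by omega
        subst this
        rw [cc_self, cc_self, cc_gt _ _ _ (by omega)]; ring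
      · rw [cc_gt, cc_gt, cc_gt] <;> first | omega | ring

/-- shifted polynomial -/
noncomputable def G1 (n : ℕ) (u : ℤ) : ℤ[X] := (GG n u).comp (X - C 1)

lemma G1_rec (n : ℕ) (u : ℤ) : G1 (n + 2) u = X * G1 (n + 1) u + C (2 * (2 * (n + 1) + u + 1)) * G1 (n + 1) u
    - C (2 * (n + 1) * ff u (n + 1)) * G1 n u := by
  unfold G1
  rw [GG_rec]
  simp only [sub_comp, mul_comp, add_comp, X_comp, C_comp]
  have : (C (4 * ((n : ℤ) + 1) + 2 * u + 3) : ℤ[X]) = C 1 + C (2 * (2 * (n + 1) + u + 1)) := by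
    rw [← C_add]; congr 1; ring
  rw [this]; ring

lemma GG_zero (u : ℤ) : GG 0 u = 1 := by simp [GG, cc, aa]
lemma GG_one (u : ℤ) : GG 1 u = X + C (2 * u + 3) := by
  simp [GG, cc, aa, Finset.sum_range_succ, ff]; rw [add_comm]; congr 1; ring

lemma G1_zero (u : ℤ) : G1 0 u = 1 := by simp [G1, GG_zero]
lemma G1_one (u : ℤ) : G1 1 u = X + C (2 * (u + 1)) := by
  rw [G1, GG_one, add_comp, X_comp, C_comp]
  have : (C (2 * u + 3) : ℤ[X]) = C 1 + C (2 * (u + 1)) := by rw [← C_add]; congr 1; ring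
  rw [this]; ring

lemma G1_dvd (n : ℕ) (u : ℤ) : ∀ j e, 2 * e ≤ n + 1 - j → (2 ^ e : ℤ) ∣ (G1 n u).coeff j := by
  induction n using Nat.strong_induction_on with
  | _ n ih =>
  rcases n with _ | _ | n
  · intro j e h
    have : e = 0 := by omega
    subst this; simp
  · intro j e h
    rcases j with _ | j
    · rw [G1_one]
      simp only [coeff_add, coeff_X_zero, coeff_C_zero, zero_add]
      rcases (show e = 0 ∨ e = 1 by omega) with h | h <;> subst h <;> simp
    · have : e = 0 := by omega
      subst this; simp
  · intro j e h
    rw [G1_rec, coeff_sub, coeff_add, coeff_C_mul, coeff_C_mul]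
    rcases Nat.eq_zero_or_pos e with he | he
    · subst he; simp
    obtain ⟨e, rfl⟩ : ∃ t, e = t + 1 := ⟨e - 1, by omega⟩
    apply dvd_sub
    · apply dvd_add
      · rcases j with _ | j
        · simp
        · rw [coeff_X_mul]; exact ih (n + 1) (by omega) j (e + 1) (by omega)
      · rw [pow_succ', mul_assoc]
        exact mul_dvd_mul_left _ (Dvd.dvd.mul_left (ih (n + 1) (by omega) j e (by omega)) _)
    · rw [pow_succ', mul_assoc, mul_assoc]
      exact mul_dvd_mul_left _ (Dvd.dvd.mul_left (Dvd.dvd.mul_left (ih n (by omega) j e (by omega)) _) _)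

lemma G1_zero_coeff (u : ℤ) (m : ℕ) : ∃ t : ℤ, (G1 (2 * m) u).coeff 0 = 2 ^ m * (2 * t + 1) := by
  induction m with
  | zero => exact ⟨0, by simp [G1_zero]⟩
  | succ m ih =>
    obtain ⟨t, ht⟩ := ih
    obtain ⟨s, hs⟩ := G1_dvd (2 * m + 1) u 0 (m + 1) (by omega)
    rw [show 2 * (m + 1) = 2 * m + 2 by ring, G1_rec]
    rw [coeff_sub, coeff_add, coeff_C_mul, coeff_C_mul, coeff_X_mul_zero, ht, hs]
    refine ⟨(2 * (2 * m + 1) + u + 1) * s - ((2 * m + 1) * (u + (2 * m + 1)) * (2 * t + 1) + m * (2 * t + 1) + t + 1), ?_⟩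
    unfold ff; push_cast; ring

theorem noFactor_parity (n : ℕ) (u : ℤ) (k : ℕ) (hn : n % 2 = 0) (hk : k % 2 = 1) 
    (F H : ℤ[X]) (hF : F.Monic) (hH : H.Monic) (hFH : F * H = GG n u) (hFk : F.natDegree = k) : False := by
  haveI : Fact (Nat.Prime 2) := ⟨Nat.prime_two⟩
  have hHm : H.natDegree = n - k := by
    have := GG_natDegree n u
    rw [← hFH, hF.natDegree_mul hH, hFk] at this
    omega
  have hkn : k ≤ n := by
    have := GG_natDegree n u
    rw [← hFH, hF.natDegree_mul hH, hFk] at this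
    omega
  set F1 := F.comp (X - C 1) with hF1
  set H1 := H.comp (X - C 1) with hH1
  have hprod : F1 * H1 = G1 n u := by rw [G1, ← hFH, mul_comp]
  have mF : F1.Monic := hF.comp_X_sub_C 1
  have mH : H1.Monic := hH.comp_X_sub_C 1
  have dF : F1.natDegree = k := by rw [hF1, natDegree_comp, natDegree_X_sub_C, mul_one, hFk]
  have dH : H1.natDegree = n - k := by rw [hH1, natDegree_comp, natDegree_X_sub_C, mul_one, hHm]
  set v := Int.padicValuation 2 with hvdef
  set W := vpow v 2 two_ne_zero with hW
  set ρ : WithZero (Multiplicative ℤ) := WithZero.exp (-((1 : ℕ) : ℤ)) with hρ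
  have hρ0 : ρ ≠ 0 := WithZero.exp_ne_zero
  have hlcF : F1.coeff k = 1 := by rw [← dF]; exact mF.coeff_natDegree
  have hlcH : H1.coeff (n - k) = 1 := by rw [← dH]; exact mH.coeff_natDegree
  obtain ⟨rF, a1, a2, a3⟩ := exists_right W ρ hρ0 F1 k (by rw [hlcF]; simp)
  obtain ⟨rH, b1, b2, b3⟩ := exists_right W ρ hρ0 H1 (n - k) (by rw [hlcH]; simp)
  have e1 := right_mul W ρ hρ0 F1 H1 rF rH a1 b1 a2 a3 b2 b3
  have gk : gw W ρ F1 k = WithZero.exp (-(k : ℤ)) := by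
    rw [hW, hρ, hvdef, gw_int 2 2 two_ne_zero 1 _ _ (by rw [hlcF]; exact one_ne_zero), hlcF]
    simp
  have gm : gw W ρ H1 (n - k) = WithZero.exp (-((n - k : ℕ) : ℤ)) := by
    rw [hW, hρ, hvdef, gw_int 2 2 two_ne_zero 1 _ _ (by rw [hlcH]; exact one_ne_zero), hlcH]
    simp
  have hbound : gw W ρ (F1 * H1) (rF + rH) ≤ WithZero.exp (-(n : ℤ)) := by
    have hc : (F1 * H1).coeff (rF + rH) ≠ 0 := by
      apply gw_int_ne 2 2 two_ne_zero ρ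
      rw [e1]
      exact mul_ne_zero a1 b1
    rw [hW, hρ, hvdef, gw_int 2 2 two_ne_zero 1 _ _ hc, WithZero.exp_le_exp]
    rw [hprod] at hc ⊢
    have h1 := G1_dvd n u (rF + rH) ((n + 1 - (rF + rH)) / 2) (by omega)
    have h2 := (padicValInt_dvd_iff ((n + 1 - (rF + rH)) / 2) ((G1 n u).coeff (rF + rH)) (p := 2)).1 (by exact_mod_cast h1)
    rcases h2 with h2 | h2
    · exact absurd h2 hc
    · omega
  obtain ⟨t, ht⟩ := G1_zero_coeff u (n / 2)
  rw [show 2 * (n / 2) = n by omega, ← hprod] at ht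
  have hval0 : gw W ρ (F1 * H1) 0 = WithZero.exp (-(n : ℤ)) := by
    have h1 : (2 * t + 1 : ℤ) ≠ 0 := by omega
    rw [hW, hρ, hvdef, gw_int 2 2 two_ne_zero 1 _ _ (by rw [ht]; exact mul_ne_zero (by positivity) h1), ht]
    congr 2
    rw [padicValInt.mul (by positivity) h1, padicValInt_zero_of 2 (2 * t + 1) (by omega)]
    have : padicValInt 2 ((2 : ℤ) ^ (n / 2)) = n / 2 := by
      have := padicValInt.of_nat (p := 2) (n := 2 ^ (n / 2))
      rw [padicValNat.prime_pow] at this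
      exact_mod_cast this
    rw [this]
    congr 1; omega
  have hG0' : gw W ρ (F1 * H1) 0 = gw W ρ F1 0 * gw W ρ H1 0 := by
    simp [gw, mul_coeff_zero]
  have key : ∀ x y : WithZero (Multiplicative ℤ), x ≤ gw W ρ F1 rF → y ≤ gw W ρ H1 rH →
      x * y = WithZero.exp (-(n : ℤ)) → x = gw W ρ F1 rF := by
    intro x y hx hy hxy
    by_contra hc
    have h1 := lt_of_le_of_ne hx hc
    have := mul_lt_mul_of_lt_of_le_of_nonneg_of_pos h1 hy zero_le (zero_lt_iff.2 b1)
    rw [hxy, ← e1] at this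
    exact absurd hbound (not_le.2 this)
  have k1 := key _ _ (a2 0) (b2 0) (by rw [← hG0', hval0])
  have k2 := key _ _ (a2 k) (b2 (n - k)) (by
    rw [gk, gm, ← WithZero.exp_add]; congr 1; push_cast [Nat.cast_sub hkn]; ring)
  have k3 := k1.trans k2.symm
  have n1 : F1.coeff 0 ≠ 0 := gw_int_ne 2 2 two_ne_zero ρ F1 0 (k1 ▸ a1)
  rw [gk, hW, hρ, hvdef, gw_int 2 2 two_ne_zero 1 _ _ n1, WithZero.exp_inj] at k3
  omega

/-- computable valuation with fuel -/
def pv (p : ℕ) : ℕ → ℕ → ℕ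
  | 0, _ => 0
  | f + 1, x => if x % p = 0 then 1 + pv p f (x / p) else 0

lemma pv_eq (p : ℕ) [hp : Fact p.Prime] (f x : ℕ) (hx : x ≠ 0) (hf : x < 2 ^ f) : pv p f x = padicValNat p x := by
  induction f generalizing x with
  | zero => simp at hf; omega
  | succ f ih =>
    unfold pv
    split_ifs with h
    · have hd : p ∣ x := Nat.dvd_of_mod_eq_zero h
      have h1 : x / p ≠ 0 := (Nat.div_pos (Nat.le_of_dvd (by omega) hd) hp.out.pos).ne'
      have h2 : x / p < 2 ^ f := by
        apply Nat.div_lt_of_lt_mul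
        calc x < 2 ^ (f + 1) := hf
          _ = 2 * 2 ^ f := by ring
          _ ≤ p * 2 ^ f := Nat.mul_le_mul_right _ hp.out.two_le
      rw [ih _ h1 h2]
      have h3 := padicValNat.div hd
      have h4 := one_le_padicValNat_of_dvd hx hd
      omega
    · rw [padicValNat.eq_zero_of_not_dvd]
      intro hd
      exact h (Nat.mod_eq_zero_of_dvd hd)

def SSc (p : ℕ) (u : ℤ) (j : ℕ) : ℕ := ((List.range j).map fun t => pv p 20 (ff u (t + 1)).natAbs).sum

lemma SSc_eq (p : ℕ) [hp : Fact p.Prime] (u : ℤ) (hu1 : -1000 ≤ u) (hu2 : u ≤ 1000) (j : ℕ) (hj : j ≤ 1000) : SSc p u j = SS p u j := by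
  unfold SSc SS
  rw [← List.sum_toFinset _ (List.nodup_range), List.toFinset_range]
  apply Finset.sum_congr rfl
  intro t ht
  rw [Finset.mem_range] at ht
  rw [padicValInt, pv_eq]
  · have := ff_ne u (t + 1); omega
  · unfold ff; push_cast; omega

lemma P3_table : ∀ a ∈ List.range 17, ∀ j ∈ List.range 19, 0 < j →
    SSc 3 (-(a + 2 : ℕ)) (a + 2) < a + 2 ∧ 
    (SSc 3 (-(a + 2 : ℕ)) j + pv 3 20 j < j + 3) := by decide +kernel

lemma SS_three (u : ℤ) (hu2 : u ≤ -2) (s : ℕ) :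
    SS 3 u ((-u).toNat + s) ≤ SS 3 u ((-u).toNat) + s := by
  haveI : Fact (Nat.Prime 3) := ⟨Nat.prime_three⟩
  have h := odd_sum_le' 3 s
  have : SS 3 u ((-u).toNat + s) = SS 3 u ((-u).toNat) + ∑ w ∈ Finset.range s, padicValNat 3 (2 * w + 3) := by
    clear h
    induction s with
    | zero => simp
    | succ s ih =>
      rw [← add_assoc, SS_succ, ih, Finset.sum_range_succ, add_assoc]
      congr 2
      rw [padicValInt]
      congr 1
      unfold ff; push_cast
      omega
  omega

theorem noFactor_P3 (n : ℕ) (u : ℤ) (hn0 : 0 < n) (hu1 : -18 ≤ u) (hu2 : u ≤ -2) (hd : 27 ∣ n)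
    (F H : ℤ[X]) (hF : F.Monic) (hH : H.Monic) (hFH : F * H = GG n u) (hFk : F.natDegree = 1) : False := by
  haveI : Fact (Nat.Prime 3) := ⟨Nat.prime_three⟩
  have hHm : H.natDegree = n - 1 := by
    have := GG_natDegree n u
    rw [← hFH, hF.natDegree_mul hH, hFk] at this
    omega
  have hne : ∀ j ≤ n, (F * H).coeff j ≠ 0 := by
    intro j hj; rw [hFH, GG_coeff]; exact cc_ne n u j hj
  refine noFactorA 3 F H hF hH n 1 (n - 1) hFk hHm (by omega) hne 0 0 0 (by omega) ?_ ?_ (by omega)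
  · intro j hj
    rw [hFH, GG_coeff]
    unfold cc
    by_cases hnj : 3 ≤ n - j
    · apply Dvd.dvd.mul_left
      obtain ⟨t, t1, t2, t3⟩ := exists_ff_dvd 3 Nat.prime_three (by norm_num) u j
      exact dvd_trans t3 (Finset.dvd_prod_of_mem (fun i => ff u i) (a := t) (by rw [Finset.mem_Icc]; omega))
    · apply Dvd.dvd.mul_right
      rw [← Nat.choose_symm (show j ≤ n by omega)]
      have := choose_dvd 3 Nat.prime_three 1 n 0 (n - j) (by omega) (by omega) (by omega)
        (by rw [Nat.mod_eq_of_lt (by omega)]; omega)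
      rw [pow_one] at this
      exact_mod_cast this
  · intro j hj hjn
    rw [hFH, GG_coeff, GG_coeff]
    have e1 := val_cc 3 n u j hjn
    have e2 := val_cc 3 n u 0 (by omega)
    have hS0 : SS 3 u 0 = 0 := rfl
    rw [hS0, Nat.choose_zero_right, padicValNat_one_right] at e2
    obtain ⟨a, ha, rfl⟩ : ∃ a : ℕ, a < 17 ∧ u = -((a + 2 : ℕ) : ℤ) := ⟨(-u - 2).toNat, by omega, by omega⟩
    suffices SS 3 (-((a + 2 : ℕ) : ℤ)) j < padicValNat 3 (n.choose j) + j by omega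
    by_cases hja : j < 19
    · have h1 := (P3_table a (List.mem_range.2 ha) j (List.mem_range.2 hja) hj).2
      rw [SSc_eq 3 _ (by omega) (by omega) _ (by omega), pv_eq 3 20 j (by omega) (by omega)] at h1
      have h2 : 3 ≤ padicValNat 3 (n.choose j) + padicValNat 3 j := by
        rw [← padicValNat.mul (Nat.choose_pos hjn).ne' (by omega)]
        apply (padicValNat_dvd_iff_le (mul_ne_zero (Nat.choose_pos hjn).ne' (by omega))).1
        obtain ⟨m, rfl⟩ : ∃ m, n = m + 1 := ⟨n - 1, by omega⟩
        obtain ⟨i, rfl⟩ : ∃ i, j = i + 1 := ⟨j - 1, by omega⟩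
        rw [← Nat.add_one_mul_choose_eq]
        exact Dvd.dvd.mul_right hd _
      omega
    · have h1 := (P3_table a (List.mem_range.2 ha) 1 (List.mem_range.2 (by omega)) one_pos).1
      rw [SSc_eq 3 _ (by omega) (by omega) _ (by omega)] at h1
      have h2 := SS_three (-((a + 2 : ℕ) : ℤ)) (by omega) (j - (a + 2))
      rw [neg_neg, Int.toNat_natCast, show a + 2 + (j - (a + 2)) = j by omega] at h2
      omega

def TTc (p j : ℕ) : ℕ := ((List.range j).map fun t => pv p 20 (t + 1)).sum

lemma TTc_eq (p : ℕ) [hp : Fact p.Prime] (j : ℕ) (hj : j ≤ 1000) : TTc p j = padicValNat p j.factorial := by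
  induction j with
  | zero => simp [TTc]
  | succ j ih =>
    have := ih (by omega)
    unfold TTc at this ⊢
    rw [List.range_succ, List.map_append, List.sum_append, this, Nat.factorial_succ, padicValNat.mul (by omega) (by positivity)]
    simp only [List.map_cons, List.map_nil, List.sum_cons, List.sum_nil, add_zero]
    rw [pv_eq p 20 (j + 1) (by omega) (by omega), add_comm]

/-- computed valuation of `cc n u j` -/
def VV (p n : ℕ) (u : ℤ) (j : ℕ) : ℕ := (TTc p n - TTc p j - TTc p (n - j)) + (SSc p u n - SSc p u j)

lemma VV_eq (p : ℕ) [hp : Fact p.Prime] (n : ℕ) (u : ℤ) (hu1 : -1000 ≤ u) (hu2 : u ≤ 1000) (hn : n ≤ 1000) (j : ℕ) (hj : j ≤ n) :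
    VV p n u j = padicValInt p (cc n u j) := by
  have h1 := val_cc p n u j hj
  unfold VV
  rw [TTc_eq p n hn, TTc_eq p j (by omega), TTc_eq p (n - j) (by omega), SSc_eq p u hu1 hu2 n hn,
    SSc_eq p u hu1 hu2 j (by omega)]
  have h2 : padicValNat p n.factorial = padicValNat p (n.choose j) + padicValNat p j.factorial + padicValNat p (n - j).factorial := by
    rw [← Nat.choose_mul_factorial_mul_factorial hj, padicValNat.mul (mul_ne_zero (Nat.choose_pos hj).ne' (by positivity)) (by positivity),
      padicValNat.mul (Nat.choose_pos hj).ne' (by positivity)]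
  have h3 : SS p u j ≤ SS p u n := by
    unfold SS; exact Finset.sum_le_sum_of_subset (Finset.range_mono hj)
  omega

def chkA (n k : ℕ) (u : ℤ) (p i r js : ℕ) : Bool :=
  decide (r + i < k) && decide (js ≤ n) && (List.range (n - i)).all (fun j => decide (0 < VV p n u j)) &&
  (let w := k * VV p n u js + js
   (List.range (n + 1)).all (fun j => decide (j ≤ r) || decide (w < k * VV p n u j + j)))

lemma chkA_sound (n k : ℕ) (u : ℤ) (p i r js : ℕ) (hp : p.Prime) (hu1 : -1000 ≤ u) (hu2 : u ≤ 1000) (hn : n ≤ 1000)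
    (h : chkA n k u p i r js = true) (F H : ℤ[X]) (hF : F.Monic) (hH : H.Monic) (hFH : F * H = GG n u) (hFk : F.natDegree = k) : False := by
  haveI : Fact p.Prime := ⟨hp⟩
  unfold chkA at h
  simp only [Bool.and_eq_true, decide_eq_true_eq, List.all_eq_true, List.mem_range, Bool.or_eq_true] at h
  obtain ⟨⟨⟨h1, h2⟩, h3⟩, h4⟩ := h
  have hd := GG_natDegree n u
  rw [← hFH, hF.natDegree_mul hH, hFk] at hd
  have hne : ∀ j ≤ n, (F * H).coeff j ≠ 0 := by
    intro j hj; rw [hFH, GG_coeff]; exact cc_ne n u j hj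
  refine noFactorA p F H hF hH n k (n - k) hFk (by omega) (by omega) hne i r js h2 ?_ ?_ h1
  · intro j hj
    have := h3 j (by omega)
    rw [VV_eq p n u hu1 hu2 hn j (by omega)] at this
    rw [hFH, GG_coeff]
    by_contra hc
    rw [padicValInt_zero_of _ _ hc] at this
    omega
  · intro j hj hjn
    rw [hFH, GG_coeff, GG_coeff, ← VV_eq p n u hu1 hu2 hn _ h2, ← VV_eq p n u hu1 hu2 hn j hjn]
    rcases h4 j (by omega) with h | h
    · omega
    · exact h

def excList : List (ℕ × ℕ) := [(3, 1), (4, 2), (5, 1), (5, 2), (6, 2), (9, 1), (9, 2), (10, 2), (15, 1), (16, 2), (45, 1), (81, 2)]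

def chkTab (n k : ℕ) (u : ℤ) : Bool :=
  [3, 5, 7, 11, 13, 17, 23, 29].any fun p => [(0, 0, 0), (1, 0, 0), (0, 1, 1)].any fun x => chkA n k u p x.1 x.2.1 x.2.2

lemma chkTab_all : excList.all (fun x => (List.range 17).all fun a => 
    chkTab x.1 x.2 (-(a + 2 : ℕ)) || decide (a = 15 ∧ (x = (3, 1) ∨ x = (4, 2)))) = true := by decide +kernel

lemma noFactor_3_1 (F H : ℤ[X]) (hF : F.Monic) (hFH : F * H = GG 3 (-17)) (hFk : F.natDegree = 1) : False := by
  have hr : (GG 3 (-17)).eval (-F.coeff 0) = 0 := by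
    rw [← hFH, eval_mul, hF.eq_X_add_C hFk]
    simp
  generalize -F.coeff 0 = a at hr
  have h2 : (GG 3 (-17)).eval a = a ^ 3 - 81 * a ^ 2 + 2349 * a - 24273 := by
    have c0 : cc 3 (-17) 0 = -24273 := by decide
    have c1 : cc 3 (-17) 1 = 2349 := by decide
    have c2 : cc 3 (-17) 2 = -81 := by decide
    have c3 : cc 3 (-17) 3 = 1 := by decide
    unfold GG
    simp only [Finset.sum_range_succ, Finset.sum_range_zero, c0, c1, c2, c3]
    simp
    ring
  rw [h2] at hr
  have h3 : ((a ^ 3 - 81 * a ^ 2 + 2349 * a - 24273 : ℤ) : ZMod 5) = 0 := by rw [hr]; simp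
  push_cast at h3
  generalize (a : ZMod 5) = b at h3
  revert b; decide

lemma noFactor_4_2 (F H : ℤ[X]) (hF : F.Monic) (hH : H.Monic) (hFH : F * H = GG 4 (-17)) (hFk : F.natDegree = 2) : False := by
  have hd := GG_natDegree 4 (-17)
  rw [← hFH, hF.natDegree_mul hH, hFk] at hd
  have f2 : F.coeff 2 = 1 := by rw [← hFk]; exact hF.coeff_natDegree
  have h2 : H.coeff 2 = 1 := by rw [← show H.natDegree = 2 by omega]; exact hH.coeff_natDegree
  have f3 : F.coeff 3 = 0 := coeff_eq_zero_of_natDegree_lt (by omega)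
  have h3 : H.coeff 3 = 0 := coeff_eq_zero_of_natDegree_lt (by omega)
  have e : ∀ j, (F * H).coeff j = cc 4 (-17) j := fun j => by rw [hFH, GG_coeff]
  have c0 : cc 4 (-17) 0 = 606825 := by decide
  have c1 : cc 4 (-17) 1 = -78300 := by decide
  have c2 : cc 4 (-17) 2 = 4050 := by decide
  have c3 : cc 4 (-17) 3 = -100 := by decide
  have e0 := e 0
  have e1 := e 1
  have e2 := e 2
  have e3 := e 3
  rw [coeff_mul, c0] at e0
  rw [coeff_mul, c1] at e1
  rw [coeff_mul, c2] at e2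
  rw [coeff_mul, c3] at e3
  simp only [Finset.Nat.antidiagonal_succ, Finset.Nat.antidiagonal_zero, Finset.map_singleton, Finset.sum_cons, Finset.sum_singleton, Finset.sum_map,
    Finset.map_cons, Function.Embedding.prodMap, Function.Embedding.coeFn_mk, Prod.map] at e0 e1 e2 e3
  simp [f2, h2, f3, h3] at e0 e1 e2 e3
  generalize F.coeff 0 = b at *
  generalize F.coeff 1 = a at *
  generalize H.coeff 0 = d at *
  generalize H.coeff 1 = c at *
  have hc : c = -100 - a := by linarith
  subst hc
  have hd : d = 4050 - b - a * (-100 - a) := by linarith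
  subst hd
  have z0 := congrArg (Int.cast : ℤ → ZMod 13) e0
  have z1 := congrArg (Int.cast : ℤ → ZMod 13) e1
  push_cast at z0 z1
  generalize (a : ZMod 13) = a' at z0 z1
  generalize (b : ZMod 13) = b' at z0 z1
  revert a' b'; decide +kernel

theorem noFactor_small (n k : ℕ) (u : ℤ) (hu1 : -18 ≤ u) (hu2 : u ≤ -2) (h : (n, k) ∈ excList)
    (F H : ℤ[X]) (hF : F.Monic) (hH : H.Monic) (hFH : F * H = GG n u) (hFk : F.natDegree = k) : False := by
  obtain ⟨a, ha, rfl⟩ : ∃ a : ℕ, a < 17 ∧ u = -((a + 2 : ℕ) : ℤ) := ⟨(-u - 2).toNat, by omega, by omega⟩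
  have h1 := chkTab_all
  rw [List.all_eq_true] at h1
  have h2 := h1 _ h
  rw [List.all_eq_true] at h2
  have h3 := h2 a (List.mem_range.2 ha)
  simp only [Bool.or_eq_true, decide_eq_true_eq] at h3
  have hn : n ≤ 1000 := by
    have : ∀ x ∈ excList, x.1 ≤ 1000 := by decide
    exact this _ h
  rcases h3 with h3 | ⟨h3, h4⟩
  · unfold chkTab at h3
    simp only [List.any_eq_true] at h3
    obtain ⟨p, hp, x, _, hx⟩ := h3
    have hpp : p.Prime := by
      have : ∀ p ∈ [3, 5, 7, 11, 13, 17, 23, 29], p.Prime := by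
        intro p hp; fin_cases hp <;> norm_num
      exact this p hp
    exact chkA_sound n k _ p _ _ _ hpp (by omega) (by omega) hn hx F H hF hH hFH hFk
  · subst h3
    rcases h4 with h4 | h4 <;> simp only [Prod.mk.injEq] at h4 <;> obtain ⟨rfl, rfl⟩ := h4
    · exact noFactor_3_1 F H hF (by simpa using hFH) hFk
    · exact noFactor_4_2 F H hF hH (by simpa using hFH) hFk

lemma log_choose_le (n k K q : ℕ) (hkn : k ≤ n) (hq : 1 ≤ q)
    (h : ∀ p, p.Prime → p ∣ n.choose k → p ≤ K ∨ p = q) :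
    Real.log (n.choose k) ≤ Chebyshev.theta K + Real.log q + (Chebyshev.psi n - Chebyshev.theta n) := by
  classical
  have hC : n.choose k ≠ 0 := (Nat.choose_pos hkn).ne'
  have e1 : Real.log (n.choose k) = ∑ p ∈ Nat.primesLE n, ((n.choose k).factorization p : ℝ) * Real.log p := by
    have h1 := Nat.prod_pow_factorization_choose n k hkn
    have h2 : ∏ p ∈ Nat.primesLE n, p ^ (n.choose k).factorization p = n.choose k := by
      refine Eq.trans (Finset.prod_subset ?_ ?_) h1
      · intro p hp; rw [Nat.mem_primesLE] at hp; exact Finset.mem_range.2 (by omega)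
      · intro p hp hp2
        rw [Nat.mem_primesLE] at hp2
        rw [Nat.factorization_eq_zero_of_not_prime, pow_zero]
        intro hpp; apply hp2
        have := Finset.mem_range.1 hp
        exact ⟨by omega, hpp⟩
    conv_lhs => rw [← h2]
    push_cast
    rw [Real.log_prod (by
      intro p hp
      have := (Nat.mem_primesLE.1 hp).2.pos
      positivity)]
    simp
  rw [e1, Chebyshev.psi_eq_sum_mul_log_prime, Chebyshev.theta_eq_sum_primesLE_log n, ← Finset.sum_sub_distrib]
  have hind : ∑ p ∈ (Nat.primesLE n).filter (fun p => p ≤ K ∨ p = q), Real.log p ≤ Chebyshev.theta K + Real.log q := by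
    rw [Chebyshev.theta_eq_sum_primesLE_log]
    have hlog : ∀ p : ℕ, 0 ≤ Real.log p := fun p => Real.log_natCast_nonneg p
    calc _ ≤ ∑ p ∈ Nat.primesLE K ∪ {q}, Real.log p := by
          apply Finset.sum_le_sum_of_subset_of_nonneg
          · intro p hp
            rw [Finset.mem_filter, Nat.mem_primesLE] at hp
            rw [Finset.mem_union, Nat.mem_primesLE, Finset.mem_singleton]
            tauto
          · intro p _ _; exact hlog p
      _ ≤ _ := by
          have := Finset.sum_union_inter (s₁ := Nat.primesLE K) (s₂ := {q}) (f := fun p : ℕ => Real.log p)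
          have h3 : 0 ≤ ∑ p ∈ Nat.primesLE K ∩ {q}, Real.log (p : ℝ) := Finset.sum_nonneg fun p _ => hlog p
          rw [Finset.sum_singleton] at this
          linarith
  refine le_trans ?_ (add_le_add_left hind _)
  rw [Finset.sum_filter, ← Finset.sum_add_distrib]
  apply Finset.sum_le_sum
  intro p hp
  rw [Nat.mem_primesLE] at hp
  have hl0 : 0 ≤ Real.log p := Real.log_natCast_nonneg p
  have hl1 : (1 : ℝ) ≤ (p.log n : ℝ) := by
    exact_mod_cast Nat.log_pos hp.2.one_lt hp.1
  by_cases hd : p ∣ n.choose k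
  · rw [if_pos (h p hp.2 hd)]
    have : ((n.choose k).factorization p : ℝ) ≤ p.log n := by exact_mod_cast Nat.factorization_choose_le_log
    nlinarith
  · rw [Nat.factorization_eq_zero_of_not_dvd hd]
    have : 0 ≤ (if p ≤ K ∨ p = q then Real.log (p : ℝ) else 0) := by split_ifs <;> simp [hl0]
    have h2 : 0 ≤ ((p.log n : ℝ) - 1) * Real.log p := mul_nonneg (by linarith) hl0
    push_cast
    linarith

lemma pow_le_choose_mul (n k : ℕ) (hkn : k ≤ n) : n ^ k ≤ k ^ k * n.choose k := by
  induction k generalizing n with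
  | zero => simp
  | succ k ih =>
    obtain ⟨m, rfl⟩ : ∃ m, n = m + 1 := ⟨n - 1, by omega⟩
    have h1 := ih m (by omega)
    have h2 := Nat.add_one_mul_choose_eq m k
    rcases Nat.eq_zero_or_pos k with h | h
    · subst h; simp
    -- (m+1)^k * k^k ≤ (k+1)^k * m^k
    have h3 : ((m + 1) * k) ^ k ≤ ((k + 1) * m) ^ k := Nat.pow_le_pow_left (by nlinarith) k
    have hk : 0 < k ^ k := by positivity
    apply Nat.le_of_mul_le_mul_left _ hk
    calc k ^ k * (m + 1) ^ (k + 1) = ((m + 1) * k) ^ k * (m + 1) := by rw [mul_pow]; ring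
      _ ≤ ((k + 1) * m) ^ k * (m + 1) := Nat.mul_le_mul_right _ h3
      _ = (k + 1) ^ k * (m + 1) * m ^ k := by rw [mul_pow]; ring
      _ ≤ (k + 1) ^ k * (m + 1) * (k ^ k * m.choose k) := Nat.mul_le_mul_left _ h1
      _ = (k + 1) ^ k * k ^ k * ((m + 1) * m.choose k) := by ring
      _ = (k + 1) ^ k * k ^ k * ((m + 1).choose (k + 1) * (k + 1)) := by rw [h2]
      _ = k ^ k * ((k + 1) ^ (k + 1) * (m + 1).choose (k + 1)) := by ring

lemma choose_le_pow_primes (n k K : ℕ) (hkn : k ≤ n) (hn : 0 < n)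
    (h : ∀ p, p.Prime → p ∣ n.choose k → p ≤ K) : n.choose k ≤ n ^ (Nat.primesLE K).card := by
  have hC : n.choose k ≠ 0 := (Nat.choose_pos hkn).ne'
  calc n.choose k = (n.choose k).factorization.prod (· ^ ·) := (Nat.prod_factorization_pow_eq_self hC).symm
    _ = ∏ p ∈ (n.choose k).primeFactors, p ^ (n.choose k).factorization p := by
        rw [Nat.prod_factorization_eq_prod_primeFactors]
    _ ≤ ∏ p ∈ (n.choose k).primeFactors, n := Finset.prod_le_prod' fun p _ => Nat.pow_factorization_choose_le hn
    _ = n ^ (n.choose k).primeFactors.card := by simp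
    _ ≤ _ := by
        apply Nat.pow_le_pow_right hn
        apply Finset.card_le_card
        intro p hp
        rw [Nat.mem_primeFactors] at hp
        rw [Nat.mem_primesLE]
        exact ⟨h p hp.1 hp.2.1, hp.1⟩

/-- counting regime -/
lemma count_regime (n k K a b : ℕ) (hk : 0 < k) (hkn : k ≤ n) 
    (h : ∀ p, p.Prime → p ∣ n.choose k → p ≤ K) (hab : a < b) (hpi : b * (Nat.primesLE K).card ≤ a * k) :
    n ^ (b - a) ≤ k ^ b := by
  have h1 := pow_le_choose_mul n k hkn
  have h2 := choose_le_pow_primes n k K hkn (by omega) h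
  have h3 : n ^ k ≤ k ^ k * n ^ (Nat.primesLE K).card := h1.trans (Nat.mul_le_mul_left _ h2)
  have h4 : n ^ (k * b) ≤ k ^ (k * b) * n ^ (a * k) := by
    calc n ^ (k * b) = (n ^ k) ^ b := by rw [pow_mul]
      _ ≤ (k ^ k * n ^ (Nat.primesLE K).card) ^ b := Nat.pow_le_pow_left h3 b
      _ = k ^ (k * b) * n ^ (b * (Nat.primesLE K).card) := by rw [mul_pow, ← pow_mul, ← pow_mul, mul_comm b]
      _ ≤ _ := Nat.mul_le_mul_left _ (Nat.pow_le_pow_right (by omega) hpi)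
  have hpos : 0 < n ^ (a * k) := by apply pow_pos; omega
  have h5 : n ^ (k * (b - a)) ≤ k ^ (k * b) := by
    apply Nat.le_of_mul_le_mul_right _ hpos
    refine le_trans (le_of_eq ?_) h4
    rw [← pow_add]; congr 1
    rw [Nat.mul_sub, mul_comm a k]
    have : k * a ≤ k * b := Nat.mul_le_mul_left _ hab.le
    omega
  rw [mul_comm k (b - a), mul_comm k b, pow_mul, pow_mul] at h5
  exact (Nat.pow_le_pow_iff_left hk.ne').1 h5

lemma psi_theta_bound (n : ℕ) (hn : 30000 ≤ n) :
    Chebyshev.psi n - Chebyshev.theta n ≤ 7.4 * Real.sqrt n := by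
  have hx : (30000 : ℝ) ≤ n := by exact_mod_cast hn
  have h := Chebyshev.psi_sub_theta_le_psi_add_psi_add_psi (n : ℝ)
  set y : ℝ := (n : ℝ) ^ ((1 : ℝ) / 6) with hy
  have hn0 : (0 : ℝ) ≤ n := by positivity
  have hy0 : 0 ≤ y := by positivity
  have y6 : y ^ 6 = n := by
    rw [hy, ← Real.rpow_natCast, ← Real.rpow_mul hn0]; norm_num
  have y5 : 5.5 ≤ y := by
    by_contra hc
    push Not at hc
    have : y ^ 6 < 5.5 ^ 6 := pow_lt_pow_left₀ hc hy0 (by norm_num)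
    rw [y6] at this
    norm_num at this
    linarith
  have hs : Real.sqrt n = y ^ 3 := by
    rw [← y6, show y ^ 6 = (y ^ 3) ^ 2 by ring, Real.sqrt_sq (by positivity)]
  have h3 : (n : ℝ) ^ (3 : ℝ)⁻¹ = y ^ 2 := by
    rw [hy, ← Real.rpow_natCast, ← Real.rpow_mul hn0]; norm_num
  have h2 : (n : ℝ) ^ (2 : ℝ)⁻¹ = y ^ 3 := by
    rw [hy, ← Real.rpow_natCast, ← Real.rpow_mul hn0]; norm_num
  have h5 : (n : ℝ) ^ (5 : ℝ)⁻¹ ≤ y ^ 2 := by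
    rw [← h3]; apply Real.rpow_le_rpow_of_exponent_le (by linarith) (by norm_num)
  have hl4 : Real.log 4 ≤ 1.4 := by
    rw [show (4 : ℝ) = 2 ^ 2 by norm_num, Real.log_pow]
    have := Real.log_two_lt_d9
    push_cast; linarith
  have P : ∀ z : ℝ, 0 ≤ z → Chebyshev.psi z ≤ 5.4 * z := fun z hz => by
    have := Chebyshev.psi_le_const_mul_self hz
    nlinarith
  rw [hs]
  have a1 := P ((n : ℝ) ^ (2 : ℝ)⁻¹) (by positivity)
  have a2 := P ((n : ℝ) ^ (3 : ℝ)⁻¹) (by positivity)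
  have a3 := P ((n : ℝ) ^ (5 : ℝ)⁻¹) (by positivity)
  rw [h2] at a1 h
  rw [h3] at a2 h
  have : y ^ 2 * 5.5 ≤ y ^ 3 := by nlinarith [sq_nonneg y]
  nlinarith

/-- no prime at least `max 7 (k+2)` divides one of `n, ..., n-k+1` -/
def NoBig (n k : ℕ) : Prop := ∀ p, p.Prime → 7 ≤ p → k + 2 ≤ p → ∀ i, i < k → ¬ p ∣ n - i

lemma NoBig.choose {n k : ℕ} (h : NoBig n k) (p : ℕ) (hp : p.Prime)
    (hd : p ∣ n.choose k) : p ≤ 5 ∨ p ≤ k + 1 := by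
  by_contra hc
  push Not at hc
  have h7 : 7 ≤ p := by
    rcases Nat.lt_or_ge p 7 with h6 | h6
    · have : p = 6 := by omega
      subst this; exact absurd hp (by norm_num)
    · exact h6
  have h1 : p ∣ n.descFactorial k := by
    rw [Nat.descFactorial_eq_factorial_mul_choose]; exact hd.mul_left _
  rw [Nat.descFactorial_eq_prod_range] at h1
  obtain ⟨i, hi, hpi⟩ := (hp.prime.dvd_finset_prod_iff _).1 h1
  exact h p hp h7 (by omega) i (Finset.mem_range.1 hi) hpi

lemma pi_le_6 (k : ℕ) (hk : 8 ≤ k) : 3 * (Nat.primesLE (k + 1)).card ≤ k + 10 := by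
  rw [Nat.primesLE_card_eq_primeCounting]
  have h := Nat.primeCounting'_add_le (a := 6) (k := 7) (by norm_num) (by norm_num) (k - 5)
  have e : Nat.primeCounting (k + 1) = Nat.primeCounting' (7 + (k - 5)) := by
    rw [Nat.primeCounting]; congr 1; omega
  have e7 : Nat.primeCounting' 7 = 3 := by decide
  have e6 : Nat.totient 6 = 2 := by decide
  rw [e]; rw [e7, e6] at h; omega

lemma pi_le_30 (k : ℕ) (hk : 540 ≤ k) : 7 * (Nat.primesLE (k + 1)).card ≤ 2 * k := by
  rw [Nat.primesLE_card_eq_primeCounting]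
  have h := Nat.primeCounting'_add_le (a := 30) (k := 31) (by norm_num) (by norm_num) (k - 29)
  have e : Nat.primeCounting (k + 1) = Nat.primeCounting' (31 + (k - 29)) := by
    rw [Nat.primeCounting]; congr 1; omega
  have e7 : Nat.primeCounting' 31 = 10 := by decide +kernel
  have e6 : Nat.totient 30 = 8 := by decide +kernel
  rw [e]; rw [e7, e6] at h; omega

lemma pi_half (k : ℕ) (hk : 8 ≤ k) : 2 * (Nat.primesLE (k + 1)).card ≤ 1 * k := by
  rcases Nat.lt_or_ge k 20 with h | h
  · have : ∀ k, k < 20 → 8 ≤ k → 2 * (Nat.primesLE (k + 1)).card ≤ 1 * k := by decide +kernel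
    exact this k h hk
  · have := pi_le_6 k hk; omega

lemma NoBig.sq {n k : ℕ} (h : NoBig n k) (hk : 8 ≤ k) (hkn : k ≤ n) : n ≤ k ^ 2 := by
  have := count_regime n k (k + 1) 1 2 (by omega) hkn
    (fun p hp hd => by have := h.choose p hp hd; omega) (by norm_num) (pi_half k hk)
  simpa using this

lemma NoBig.low {n k : ℕ} (h : NoBig n k) (hk : 4 ≤ k) (hk8 : k < 8) (hkn : k ≤ n) : n ≤ 256 := by
  have c5 : (Nat.primesLE 5).card = 3 := by decide +kernel
  have c6 : (Nat.primesLE 6).card = 3 := by decide +kernel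
  have c7 : (Nat.primesLE 7).card = 4 := by decide +kernel
  have c8 : (Nat.primesLE 8).card = 4 := by decide +kernel
  have hch := fun p hp hd => h.choose p hp hd
  interval_cases k
  · have := count_regime n 4 5 3 4 (by omega) hkn (fun p hp hd => by have := hch p hp hd; omega) (by norm_num) (by omega)
    norm_num at this; omega
  · have := count_regime n 5 6 3 5 (by omega) hkn (fun p hp hd => by have := hch p hp hd; omega) (by norm_num) (by omega)
    norm_num at this; nlinarith
  · have := count_regime n 6 7 2 3 (by omega) hkn (fun p hp hd => by have := hch p hp hd; omega) (by norm_num) (by omega)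
    norm_num at this; omega
  · have := count_regime n 7 8 4 7 (by omega) hkn (fun p hp hd => by have := hch p hp hd; omega) (by norm_num) (by omega)
    norm_num at this
    by_contra hc
    have h2 : 257 ^ 3 ≤ n ^ 3 := Nat.pow_le_pow_left (by omega) 3
    omega

lemma NoBig.k540 {n k : ℕ} (h : NoBig n k) (hk : 4 ≤ k) (hkn : k ≤ n) (hn : 30000 ≤ n) :
    540 ≤ k ∧ n ^ 5 ≤ k ^ 7 := by
  have k8 : 8 ≤ k := by
    by_contra hc
    have := h.low hk (by omega) hkn; omega
  have hch := fun p hp hd => h.choose p hp hd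
  have k170 : 170 ≤ k := by
    by_contra hc
    have h1 := h.sq k8 hkn
    have : k ^ 2 ≤ 169 ^ 2 := Nat.pow_le_pow_left (by omega) 2
    omega
  have k540 : 540 ≤ k := by
    have := count_regime n k (k + 1) 3 8 (by omega) hkn (fun p hp hd => by have := hch p hp hd; omega) (by norm_num)
      (by have := pi_le_6 k k8; omega)
    norm_num at this
    by_contra hc
    have h2 : 30000 ^ 5 ≤ n ^ 5 := Nat.pow_le_pow_left (by omega) 5
    have : k ^ 8 ≤ 539 ^ 8 := Nat.pow_le_pow_left (by omega) 8
    omega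
  refine ⟨k540, ?_⟩
  have := count_regime n k (k + 1) 2 7 (by omega) hkn (fun p hp hd => by have := hch p hp hd; omega) (by norm_num)
      (pi_le_30 k k540)
  simpa using this

lemma choose_three (k : ℕ) (hk : 30 ≤ k) : 6 ^ k ≤ (3 * k).choose k := by
  induction k, hk using Nat.le_induction with
  | base => decide +kernel
  | succ k hk ih =>
    have h1 := Nat.add_choose_mul_factorial_mul_factorial (2 * k) k
    have h2 := Nat.add_choose_mul_factorial_mul_factorial (2 * (k + 1)) (k + 1)
    have e1 : (2 * (k + 1)).factorial = (2 * k + 2) * ((2 * k + 1) * (2 * k).factorial) := by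
      rw [show 2 * (k + 1) = 2 * k + 1 + 1 by ring, Nat.factorial_succ, Nat.factorial_succ]
    have e2 : (2 * (k + 1) + (k + 1)).factorial = (3 * k + 3) * ((3 * k + 2) * ((3 * k + 1) * (2 * k + k).factorial)) := by
      rw [show 2 * (k + 1) + (k + 1) = 2 * k + k + 1 + 1 + 1 by ring, Nat.factorial_succ, Nat.factorial_succ, Nat.factorial_succ]
      ring
    rw [e1, e2, ← h1, Nat.factorial_succ k] at h2
    rw [show 2 * (k + 1) + (k + 1) = 3 * (k + 1) by ring, show 2 * k + k = 3 * k by ring] at h2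
    have hf : 0 < (2 * k).factorial * k.factorial := by positivity
    have h3 : (3 * (k + 1)).choose (k + 1) * ((2 * k + 2) * (2 * k + 1) * (k + 1)) =
        (3 * k).choose k * ((3 * k + 3) * (3 * k + 2) * (3 * k + 1)) := by
      apply Nat.eq_of_mul_eq_mul_right hf
      linarith
    have h4 : 6 * ((2 * k + 2) * (2 * k + 1) * (k + 1)) ≤ (3 * k + 3) * (3 * k + 2) * (3 * k + 1) := by
      have : 6 * ((2 * k + 2) * (2 * k + 1)) ≤ 3 * ((3 * k + 2) * (3 * k + 1)) := by nlinarith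
      nlinarith
    have hp : 0 < (2 * k + 2) * (2 * k + 1) * (k + 1) := by positivity
    apply Nat.le_of_mul_le_mul_right _ hp
    rw [h3]
    calc 6 ^ (k + 1) * ((2 * k + 2) * (2 * k + 1) * (k + 1)) = 6 ^ k * (6 * ((2 * k + 2) * (2 * k + 1) * (k + 1))) := by ring
      _ ≤ _ := Nat.mul_le_mul ih h4

lemma choose_half_mono (n a b : ℕ) (hab : a ≤ b) (hb : 2 * b ≤ n) : n.choose a ≤ n.choose b := by
  induction b, hab using Nat.le_induction with
  | base => exact le_rfl
  | succ b hab ih => exact (ih (by omega)).trans (Nat.choose_le_succ_of_lt_half_left (by omega))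

lemma pow_le_choose' (n k c : ℕ) (hk : 0 < k) (hkn : k ≤ n) (h : c * k ≤ n) : c ^ k ≤ n.choose k := by
  have h1 := pow_le_choose_mul n k hkn
  have : (c * k) ^ k ≤ n ^ k := Nat.pow_le_pow_left h k
  rw [mul_pow] at this
  apply Nat.le_of_mul_le_mul_left _ (show 0 < k ^ k by positivity)
  linarith

lemma log_small (n : ℕ) (hn : 30000 ≤ n) : Real.log n ≤ 0.1 * Real.sqrt n ∧ 173 ≤ Real.sqrt n := by
  have hx : (30000 : ℝ) ≤ n := by exact_mod_cast hn
  have hs : 173 ≤ Real.sqrt n := Real.le_sqrt_of_sq_le (by linarith)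
  refine ⟨?_, hs⟩
  set s := Real.sqrt n
  have h1 : Real.log n = 2 * Real.log s := by
    have : (n : ℝ) = s ^ 2 := (Real.sq_sqrt (by positivity)).symm
    rw [this, Real.log_pow]; norm_num
  have h2 : Real.log s ≤ s / 128 - 1 + 7 * Real.log 2 := by
    have h3 := Real.log_le_sub_one_of_pos (show 0 < s / 128 by positivity)
    rw [Real.log_div (by positivity) (by norm_num), show (128 : ℝ) = 2 ^ 7 by norm_num, Real.log_pow] at h3
    push_cast at h3
    norm_num at h3 ⊢
    linarith
  have := Real.log_two_lt_d9
  rw [h1]; linarith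

lemma log_ratio {c a b : ℕ} (hc : 0 < c) (hb : 0 < b) (h : 4 ^ b * 2 ^ a ≤ c ^ b) :
    Real.log 4 + (a : ℝ) / b * 0.693 ≤ Real.log c := by
  have h1 : ((4 : ℝ) ^ b * 2 ^ a) ≤ (c : ℝ) ^ b := by exact_mod_cast h
  have h2 := Real.log_le_log (by positivity) h1
  rw [Real.log_mul (by positivity) (by positivity), Real.log_pow, Real.log_pow, Real.log_pow] at h2
  have hl := Real.log_two_gt_d9
  have hb' : (0 : ℝ) < b := by exact_mod_cast hb
  have ha : (0 : ℝ) ≤ a := by positivity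
  have : (b : ℝ) * (Real.log 4 + (a : ℝ) / b * 0.693) ≤ b * Real.log c := by
    have e : (b : ℝ) * (Real.log 4 + (a : ℝ) / b * 0.693) = b * Real.log 4 + a * 0.693 := by field_simp
    rw [e]; nlinarith
  exact le_of_mul_le_mul_left this hb'

lemma NoBig.main {n k : ℕ} (h : NoBig n k) (hk : 4 ≤ k) (hkn : 2 * k ≤ n) (hn : 30000 ≤ n) : False := by
  obtain ⟨k540, h57⟩ := h.k540 hk (by omega) hn
  have hch := fun p hp hd => h.choose p hp hd
  obtain ⟨hlog, hs⟩ := log_small n hn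
  set s := Real.sqrt n with hsdef
  have hss : s ^ 2 = n := Real.sq_sqrt (by positivity)
  have hpt := psi_theta_bound n hn
  rw [← hsdef] at hpt
  have hlog4 : Real.log 4 ≤ 0.01 * s := by
    rw [show (4 : ℝ) = 2 ^ 2 by norm_num, Real.log_pow]
    have := Real.log_two_lt_d9
    push_cast; linarith
  have hq : Real.log ((k + 1 : ℕ) : ℝ) ≤ 0.1 * s := by
    refine le_trans (Real.log_le_log (by positivity) ?_) hlog
    exact_mod_cast (by omega : k + 1 ≤ n)
  -- generic consequence
  have key : ∀ K c m : ℕ, 0 < c → (∀ p, p.Prime → p ∣ n.choose k → p ≤ K ∨ p = k + 1) → K ≤ m + 1 → c ^ m ≤ n.choose k →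
      (m : ℝ) * (Real.log c - Real.log 4) ≤ 7.55 * s := by
    intro K c m hc hK hKm hcm
    have h1 := log_choose_le n k K (k + 1) (by omega) (by omega) hK
    have h2 := Chebyshev.theta_le_log4_mul_x (x := (K : ℝ)) (by positivity)
    have h3 : (m : ℝ) * Real.log c ≤ Real.log (n.choose k) := by
      rw [← Real.log_pow]
      apply Real.log_le_log (by positivity)
      exact_mod_cast hcm
    have hKm' : (K : ℝ) ≤ m + 1 := by exact_mod_cast hKm
    have h40 : 0 ≤ Real.log 4 := Real.log_nonneg (by norm_num)
    nlinarith
  have key1 : ∀ c : ℕ, 0 < c → c ^ k ≤ n.choose k → (k : ℝ) * (Real.log c - Real.log 4) ≤ 7.55 * s :=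
    fun c hc hcm => key (k + 1) c k hc (fun p hp hd => Or.inl (by have := hch p hp hd; omega)) le_rfl hcm
  have l6 := log_ratio (c := 6) (a := 7) (b := 12) (by norm_num) (by norm_num) (by norm_num)
  have l7 := log_ratio (c := 7) (a := 4) (b := 5) (by norm_num) (by norm_num) (by norm_num)
  have l10 := log_ratio (c := 10) (a := 5) (b := 4) (by norm_num) (by norm_num) (by norm_num)
  have l16 := log_ratio (c := 16) (a := 2) (b := 1) (by norm_num) (by norm_num) (by norm_num)
  have hs0 : 0 < s := by linarith
  have fin : ∀ d : ℝ, 0 < d → s ^ 2 * d ≤ 7.55 * s → 7.55 < 173 * d → False := by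
    intro d hd h1 h2
    have : s * d ≤ 7.55 := by
      have : s * (s * d) ≤ s * 7.55 := by nlinarith
      exact le_of_mul_le_mul_left this hs0
    nlinarith
  rcases Nat.lt_or_ge n (3 * k) with h3 | h3
  · have hc : 6 ^ (n / 3) ≤ n.choose k :=
      (choose_three (n / 3) (by omega)).trans ((Nat.choose_le_choose _ (by omega)).trans (choose_half_mono n (n / 3) k (by omega) hkn))
    have := key (n / 3) 6 (n / 3) (by norm_num) (fun p hp hd => by
      by_contra hcc
      push Not at hcc
      have hpk : p ≤ k := by have := hch p hp hd; omega
      have h0 := Nat.factorization_choose_of_lt_three_mul (p := p) (n := n) (k := k) (by omega) hpk (by omega) (by omega)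
      have hpos := hp.factorization_pos_of_dvd (Nat.choose_pos (by omega : k ≤ n)).ne' hd
      omega) (by omega) hc
    have hm : (n : ℝ) ≤ 4 * ((n / 3 : ℕ) : ℝ) := by exact_mod_cast (by omega : n ≤ 4 * (n / 3))
    rw [← hss] at hm
    push_cast at l6
    apply fin 0.1 (by norm_num) _ (by norm_num)
    push_cast at this
    nlinarith
  have gen : ∀ (c N : ℕ) (d : ℝ), 0 < c → 0 < N → c ^ k ≤ n.choose k → n ≤ N * k → 0 ≤ d → Real.log 4 + d ≤ Real.log c → 
      7.55 * N < 173 * d → False := by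
    intro c N d hc hN hck hnk hd hld hfin
    have h1 := key1 c hc hck
    have hN' : (0 : ℝ) < N := by exact_mod_cast hN
    have hnk' : s ^ 2 ≤ N * k := by rw [hss]; exact_mod_cast hnk
    have hd0 : 0 < d := by nlinarith
    apply fin (d / N) (by positivity)
    · have h4 : s ^ 2 * (d / N) ≤ k * d := by
        rw [← mul_div_assoc, div_le_iff₀ hN']; nlinarith
      have : (k : ℝ) * d ≤ k * (Real.log c - Real.log 4) := mul_le_mul_of_nonneg_left (by linarith) (by positivity)
      linarith
    · rw [← mul_div_assoc, lt_div_iff₀ hN']; exact hfin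
  rcases Nat.lt_or_ge n (7 * k) with h7 | h7
  · refine gen 6 7 _ (by norm_num) (by norm_num) ?_ (by omega) (by positivity) l6 (by norm_num)
    exact (choose_three k (by omega)).trans (Nat.choose_le_choose _ h3)
  rcases Nat.lt_or_ge n (10 * k) with h10 | h10
  · refine gen 7 10 _ (by norm_num) (by norm_num) (pow_le_choose' n k 7 (by omega) (by omega) h7) (by omega) (by positivity) l7 (by norm_num)
  rcases Nat.lt_or_ge n (16 * k) with h16 | h16
  · refine gen 10 16 _ (by norm_num) (by norm_num) (pow_le_choose' n k 10 (by omega) (by omega) h10) (by omega) (by positivity) l10 (by norm_num)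
  have h1 := key1 16 (by norm_num) (pow_le_choose' n k 16 (by omega) (by omega) h16)
  have h2 : (k : ℝ) ≤ 5.5 * s := by
    have hk0 : (0 : ℝ) ≤ k := by positivity
    push_cast at l16 h1
    norm_num at l16 h1
    nlinarith
  have h3 : (n : ℝ) ^ 5 ≤ (k : ℝ) ^ 7 := by exact_mod_cast h57
  have h4 : (k : ℝ) ^ 7 ≤ (5.5 * s) ^ 7 := pow_le_pow_left₀ (by positivity) h2 7
  rw [← hss] at h3
  have h5 : s ^ 7 * s ^ 3 ≤ s ^ 7 * 5.5 ^ 7 := by nlinarith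
  have h6 := le_of_mul_le_mul_left h5 (by positivity)
  have h8 : (173 : ℝ) ^ 3 ≤ s ^ 3 := pow_le_pow_left₀ (by norm_num) hs 3
  norm_num at h6 h8
  linarith

def tdiv : ℕ → ℕ → ℕ → Bool
  | 0, _, _ => false
  | f + 1, d, p => if p < d * d then true else if p % d = 0 then false else tdiv f (d + 2) p

def tpr (p : ℕ) : Bool := Nat.ble 3 p && (p % 2 == 1) && tdiv 1000 3 p

lemma tdiv_sound : ∀ (f d p : ℕ), tdiv f d p = true → d % 2 = 1 →
    ∀ q, d ≤ q → q % 2 = 1 → q * q ≤ p → ¬ q ∣ p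
  | 0, _, _, h, _ => by simp [tdiv] at h
  | f + 1, d, p, h, hd => by
    intro q hq hq2 hqp hdvd
    unfold tdiv at h
    split_ifs at h with h1 h2
    · nlinarith
    · rcases Nat.eq_or_lt_of_le hq with h3 | h3
      · subst h3; exact h2 (Nat.mod_eq_zero_of_dvd hdvd)
      · exact tdiv_sound f (d + 2) p h (by omega) q (by omega) hq2 hqp hdvd

lemma tpr_sound {p : ℕ} (h : tpr p = true) : p.Prime := by
  unfold tpr at h
  simp only [Bool.and_eq_true, Nat.ble_eq, beq_iff_eq] at h
  obtain ⟨⟨h3, h2⟩, ht⟩ := h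
  rw [Nat.prime_def_minFac]
  refine ⟨by omega, ?_⟩
  by_contra hne
  have hmp : p.minFac.Prime := Nat.minFac_prime (by omega)
  have hd := Nat.minFac_dvd p
  have hm2 : p.minFac % 2 = 1 := by
    rcases hmp.eq_two_or_odd with h | h
    · rw [h] at hd; omega
    · exact h
  have hsq := Nat.minFac_sq_le_self (n := p) (by omega) (by
    intro hp
    exact hne (Nat.prime_def_minFac.1 hp).2)
  have := hmp.two_le
  exact tdiv_sound 1000 3 p ht (by norm_num) p.minFac (by omega) hm2 (by nlinarith) hd

/-- find `i < f` with `a - i` prime -/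
def findP : ℕ → ℕ → ℕ
  | 0, _ => 0
  | f + 1, a => if tpr a then a else findP f (a - 1)

/-- prime chain with gaps at most 52, from prime `p`, until bigger than `N` -/
def chainP : ℕ → ℕ → ℕ → Bool
  | 0, _, _ => false
  | f + 1, p, N => if N < p then true else
      let q := findP 52 (p + 52)
      Nat.ble (p + 1) q && Nat.ble q (p + 52) && tpr q && chainP f q N

lemma chainP_sound : ∀ (f p N : ℕ), chainP f p N = true → p.Prime → 
    ∀ n, p ≤ n → n ≤ N → ∃ q, q.Prime ∧ q ≤ n ∧ n < q + 52
  | 0, _, _, h, _ => by simp [chainP] at h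
  | f + 1, p, N, h, hp => by
    intro n hpn hnN
    unfold chainP at h
    rw [if_neg (by omega)] at h
    simp only [Bool.and_eq_true, Nat.ble_eq] at h
    obtain ⟨⟨⟨h1, h2⟩, h3⟩, h4⟩ := h
    set q := findP 52 (p + 52)
    rcases Nat.lt_or_ge n q with h5 | h5
    · exact ⟨p, hp, hpn, by omega⟩
    · exact chainP_sound f q N h4 (tpr_sound h3) n h5 hnN

lemma chain30000 : chainP 1500 53 30000 = true := by decide +kernel

def sqChk (n : ℕ) : Bool := (List.range 54).any fun i => Nat.ble (i * i + 1) n && tpr (n - i)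

lemma sqChk_all' : ∀ a, a < 60 → ∀ b, b < 50 → (Nat.ble (50 * a + b) 256 || sqChk (50 * a + b)) = true := by
  decide +kernel

lemma sqChk_all (n : ℕ) (h1 : n < 2920) (h2 : 257 ≤ n) : sqChk n = true := by
  have := sqChk_all' (n / 50) (by omega) (n % 50) (by omega)
  rw [Nat.div_add_mod] at this
  rcases Bool.or_eq_true _ _ |>.mp this with h | h
  · rw [Nat.ble_eq] at h; omega
  · exact h

/-- strip: greatest prime factor candidate -/
def gpf : ℕ → ℕ → ℕ → ℕ
  | 0, _, m => m
  | f + 1, d, m => if m < d * d then m else if m % d = 0 then gpf f d (m / d) else gpf f (d + 1) m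

def bigChk (n k : ℕ) : Bool := (List.range k).any fun i =>
  let p := gpf 40 2 (n - i)
  Nat.ble 7 p && Nat.ble (k + 2) p && ((n - i) % p == 0) && tpr p

lemma bigChk_all' : ∀ n, n < 257 → ∀ k, k < 54 → 
    (Nat.ble k 3 || Nat.ble (n + 1) (2 * k) || (Nat.ble 8 k && Nat.ble (k * k + 1) n) || bigChk n k) = true := by
  decide +kernel

lemma bigChk_all (n : ℕ) (h1 : n < 257) (k : ℕ) (h2 : k < 54) (h3 : 4 ≤ k) (h4 : 2 * k ≤ n) (h5 : k < 8 ∨ n ≤ k * k) :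
    bigChk n k = true := by
  have := bigChk_all' n h1 k h2
  simp only [Bool.or_eq_true, Bool.and_eq_true, Nat.ble_eq] at this
  rcases this with ((h | h) | h) | h
  · omega
  · omega
  · omega
  · exact h

theorem sylvester_big (n k : ℕ) (hk : 4 ≤ k) (hkn : 2 * k ≤ n) (h : NoBig n k) : False := by
  rcases Nat.lt_or_ge n 30000 with hn | hn
  swap
  · exact h.main hk hkn hn
  have fin : ∀ p, p.Prime → p ≤ n → n < p + k → 7 ≤ p → k + 2 ≤ p → False := by
    intro p hp h1 h2 h3 h4
    exact h p hp h3 h4 (n - p) (by omega) (by rw [Nat.sub_sub_self h1])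
  rcases Nat.lt_or_ge k 54 with hk54 | hk54
  swap
  · obtain ⟨q, hq, h1, h2⟩ := chainP_sound _ _ _ chain30000 (by norm_num) n (by omega) (by omega)
    exact fin q hq h1 (by omega) (by omega) (by omega)
  have hsq : k < 8 ∨ n ≤ k * k := by
    rcases Nat.lt_or_ge k 8 with h8 | h8
    · exact Or.inl h8
    · right; have := h.sq h8 (by omega); rwa [sq] at this
  rcases Nat.lt_or_ge n 257 with h257 | h257
  · have := bigChk_all n h257 k hk54 hk hkn hsq
    unfold bigChk at this
    rw [List.any_eq_true] at this
    obtain ⟨i, hi, h2⟩ := this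
    simp only [Bool.and_eq_true, Nat.ble_eq, beq_iff_eq] at h2
    exact h _ (tpr_sound h2.2) h2.1.1.1 h2.1.1.2 i (List.mem_range.1 hi) (Nat.dvd_of_mod_eq_zero h2.1.2)
  · have h8 : 8 ≤ k := by
      by_contra hc
      have := h.low hk (by omega) (by omega); omega
    have hnk : n ≤ k * k := by omega
    have : k * k ≤ 53 * 53 := Nat.mul_le_mul (by omega) (by omega)
    have := sqChk_all n (by omega) h257
    unfold sqChk at this
    rw [List.any_eq_true] at this
    obtain ⟨i, hi, h2⟩ := this
    simp only [Bool.and_eq_true, Nat.ble_eq] at h2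
    have hik : i < k := by
      by_contra hc
      have := Nat.mul_le_mul (not_lt.1 hc) (not_lt.1 hc)
      omega
    exact fin _ (tpr_sound h2.2) (by omega) (by omega) (by omega) (by omega)

def Smo (m : ℕ) : Prop := (∀ p, p.Prime → 7 ≤ p → ¬ p ∣ m) ∧ ¬ 25 ∣ m

lemma Smo.dvd {m e : ℕ} (h : Smo e) (hd : m ∣ e) : Smo m :=
  ⟨fun p hp h7 hpm => h.1 p hp h7 (hpm.trans hd), fun h25 => h.2 (h25.trans hd)⟩

lemma Smo.form {m : ℕ} (h : Smo m) : ∃ a b c, c ≤ 1 ∧ m = 2 ^ a * 3 ^ b * 5 ^ c := by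
  have hm : m ≠ 0 := by
    rintro rfl; exact h.2 (dvd_zero _)
  obtain ⟨a, m1, h1, e1⟩ := Nat.exists_eq_pow_mul_and_not_dvd hm 2 (by norm_num)
  have hm1 : m1 ≠ 0 := by rintro rfl; simp at h1
  obtain ⟨b, m2, h2, e2⟩ := Nat.exists_eq_pow_mul_and_not_dvd hm1 3 (by norm_num)
  have hm2 : m2 ≠ 0 := by rintro rfl; simp at h2
  obtain ⟨c, m3, h3, e3⟩ := Nat.exists_eq_pow_mul_and_not_dvd hm2 5 (by norm_num)
  have e : m = 2 ^ a * 3 ^ b * 5 ^ c * m3 := by rw [e1, e2, e3]; ring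
  have hm3 : m3 = 1 := by
    by_contra hne
    obtain ⟨p, hp, hpd⟩ := Nat.exists_prime_and_dvd hne
    have hpm : p ∣ m := by rw [e]; exact hpd.mul_left _
    have h7 : p < 7 := by
      by_contra hc; exact h.1 p hp (by omega) hpm
    have := hp.two_le
    interval_cases p
    · exact h1 (by rw [e2, e3]; exact (hpd.mul_left _).mul_left _)
    · exact h2 (by rw [e3]; exact (hpd.mul_left _))
    · exact absurd hp (by norm_num)
    · exact h3 hpd
    · exact absurd hp (by norm_num)
  refine ⟨a, b, c, ?_, by rw [e, hm3, mul_one]⟩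
  by_contra hc
  apply h.2
  have : 25 ∣ 5 ^ c := by
    rw [show 25 = 5 ^ 2 by norm_num]; exact pow_dvd_pow _ (by omega)
  rw [e]; exact (this.mul_left _).mul_right _

lemma Smo.odd {m : ℕ} (h : Smo m) (h2 : m % 2 = 1) : ∃ b c, c ≤ 1 ∧ m = 3 ^ b * 5 ^ c := by
  obtain ⟨a, b, c, hc, e⟩ := h.form
  rcases a with _ | a
  · exact ⟨b, c, hc, by simpa using e⟩
  · rw [pow_succ] at e
    have : m = 2 * (2 ^ a * 3 ^ b * 5 ^ c) := by rw [e]; ring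
    omega

lemma pow3_mod8 (b : ℕ) : 3 ^ b % 8 = 1 ∨ 3 ^ b % 8 = 3 := by
  induction b with
  | zero => simp
  | succ b ih => rw [pow_succ]; omega

lemma three_pow_add (d : ℕ) (h : Smo (3 ^ d + 1)) : d ≤ 2 := by
  by_contra hc
  have h27 : 3 ^ 3 ≤ 3 ^ d := Nat.pow_le_pow_right (by norm_num) (by omega)
  obtain ⟨a, b, c, hc1, e⟩ := h.form
  have hb : b = 0 := by
    by_contra hb
    have h1 : 3 ∣ 3 ^ b := dvd_pow_self _ hb
    have h2 : 3 ∣ 3 ^ d := dvd_pow_self _ (by omega)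
    have h3 : 3 ∣ 3 ^ d + 1 := by rw [e]; exact (h1.mul_left _).mul_right _
    omega
  subst hb
  have ha : a ≤ 2 := by
    by_contra ha
    have h1 : 8 ∣ 2 ^ a := by
      rw [show 8 = 2 ^ 3 by norm_num]; exact pow_dvd_pow _ (by omega)
    have h3 : 8 ∣ 3 ^ d + 1 := by rw [e]; exact (h1.mul_right _).mul_right _
    have := pow3_mod8 d
    omega
  have h4 : 2 ^ a ≤ 2 ^ 2 := Nat.pow_le_pow_right (by norm_num) ha
  have h5 : 5 ^ c ≤ 5 ^ 1 := Nat.pow_le_pow_right (by norm_num) hc1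
  have : 2 ^ a * 5 ^ c ≤ 2 ^ 2 * 5 ^ 1 := Nat.mul_le_mul h4 h5
  simp at e
  omega

lemma three_pow_sub (b e : ℕ) (he : e + 1 = 3 ^ b) (h : Smo e) : b = 1 ∨ b = 2 ∨ b = 4 := by
  obtain ⟨d, hd⟩ := Nat.even_or_odd' b
  rcases hd with hd | hd
  · have h1 : 3 ^ d + 1 ∣ e := by
      refine ⟨3 ^ d - 1, ?_⟩
      have hp : 1 ≤ 3 ^ d := Nat.one_le_pow _ _ (by norm_num)
      obtain ⟨t, ht⟩ : ∃ t, 3 ^ d = t + 1 := ⟨3 ^ d - 1, by omega⟩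
      rw [hd, mul_comm, pow_mul, ht] at he
      rw [ht]
      simp only [Nat.add_sub_cancel]
      nlinarith
    have h2 := three_pow_add d (h.dvd h1)
    have hb0 : d ≠ 0 := by
      rintro rfl
      simp at hd; subst hd
      have : e = 0 := by simpa using he
      subst this; exact h.2 (dvd_zero _)
    omega
  · left
    obtain ⟨a, b', c, hc1, e1⟩ := h.form
    have hm : 3 ^ b % 8 = 3 := by
      rw [hd, pow_succ, pow_mul, Nat.mul_mod, Nat.pow_mod]; norm_num
    have hb : b' = 0 := by
      by_contra hb
      have h1 : 3 ∣ 3 ^ b' := dvd_pow_self _ hb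
      have h2 : 3 ∣ 3 ^ b := dvd_pow_self _ (by omega)
      have h3 : 3 ∣ e := by rw [e1]; exact (h1.mul_left _).mul_right _
      omega
    subst hb
    have ha : a ≤ 1 := by
      by_contra ha
      have h1 : 4 ∣ 2 ^ a := by
        rw [show 4 = 2 ^ 2 by norm_num]; exact pow_dvd_pow _ (by omega)
      have h3 : 4 ∣ e := by rw [e1]; exact (h1.mul_right _).mul_right _
      omega
    have h4 : 2 ^ a ≤ 2 ^ 1 := Nat.pow_le_pow_right (by norm_num) ha
    have h5 : 5 ^ c ≤ 5 ^ 1 := Nat.pow_le_pow_right (by norm_num) hc1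
    have : 2 ^ a * 5 ^ c ≤ 2 ^ 1 * 5 ^ 1 := Nat.mul_le_mul h4 h5
    simp at e1
    by_contra hb1
    have h27 : 3 ^ 3 ≤ 3 ^ b := Nat.pow_le_pow_right (by norm_num) (by omega)
    omega

lemma five_three_sub (b e a : ℕ) (he : e + 1 = 5 * 3 ^ b) (ha : e = 2 ^ a) : b = 0 := by
  have : a ≤ 2 := by
    by_contra ha'
    have h1 : 8 ∣ e := by
      rw [ha, show 8 = 2 ^ 3 by norm_num]; exact pow_dvd_pow _ (by omega)
    have := pow3_mod8 b
    omega
  have h4 : 2 ^ a ≤ 2 ^ 2 := Nat.pow_le_pow_right (by norm_num) this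
  by_contra hb
  have h27 : 3 ^ 1 ≤ 3 ^ b := Nat.pow_le_pow_right (by norm_num) (by omega)
  omega

lemma pow_mod_period (g m t b : ℕ) (h : g ^ t % m = 1 % m) : g ^ b % m = g ^ (b % t) % m := by
  have h1 : g ^ t ≡ 1 [MOD m] := h
  have h2 : g ^ (t * (b / t) + b % t) ≡ 1 ^ (b / t) * g ^ (b % t) [MOD m] := by
    rw [pow_add, pow_mul]; exact (h1.pow _).mul_right _
  rw [Nat.div_add_mod, one_pow, one_mul] at h2
  exact h2

lemma five_three_add (b e a : ℕ) (he : e = 5 * 3 ^ b + 1) (ha : e = 2 ^ a) : b ≤ 1 := by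
  by_contra hb
  have a5 : 5 ≤ a := by
    by_contra ha'
    have h4 : 2 ^ a ≤ 2 ^ 4 := Nat.pow_le_pow_right (by norm_num) (by omega)
    have h27 : 3 ^ 2 ≤ 3 ^ b := Nat.pow_le_pow_right (by norm_num) (by omega)
    omega
  have h32 : 32 ∣ e := by
    rw [ha, show 32 = 2 ^ 5 by norm_num]; exact pow_dvd_pow _ a5
  have hb8 : 3 ^ b % 32 = 3 ^ (b % 8) % 32 :=
    pow_mod_period 3 32 8 b (by norm_num)
  have hb41 : 3 ^ b % 41 = 3 ^ (b % 8) % 41 :=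
    pow_mod_period 3 41 8 b (by norm_num)
  have ha41 : 2 ^ a % 41 = 2 ^ (a % 20) % 41 :=
    pow_mod_period 2 41 20 a (by norm_num)
  have h8 : b % 8 = 5 := by
    have d8 : ∀ r, r < 8 → r ≠ 5 → (5 * (3 ^ r % 32) + 1) % 32 ≠ 0 := by decide
    by_contra hne
    apply d8 (b % 8) (Nat.mod_lt _ (by norm_num)) hne
    rw [← hb8]
    clear hb8 hb41 ha41 d8
    generalize 3 ^ b = x at *
    clear ha hne
    omega
  rw [h8] at hb41
  have d20 : ∀ r, r < 20 → 2 ^ r % 41 ≠ 27 := by decide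
  apply d20 (a % 20) (Nat.mod_lt _ (by norm_num))
  rw [← ha41, ← ha, he]
  clear d20 ha41 hb8 ha h32 he
  have hb42 : 3 ^ b % 41 = 38 := hb41
  generalize 3 ^ b = x at *
  omega

lemma k2_case (n : ℕ) (hn : 4 ≤ n) (h0 : Smo n) (h1 : Smo (n - 1)) : (n, 2) ∈ excList := by
  -- odd member m, even member e
  have main : ∀ m e : ℕ, m % 2 = 1 → Smo m → Smo e → (e = m + 1 ∨ e + 1 = m) → 
      m = 1 ∨ m = 5 ∨ (e = 16 ∧ m = 15) ∨ (m = 3) ∨ (m = 9) ∨ (m = 81 ∧ e = 80) := by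
    intro m e hm2 hm he hme
    obtain ⟨b, c, hc, em⟩ := hm.odd hm2
    obtain ⟨a, b', c', hc', ee⟩ := he.form
    rcases Nat.eq_zero_or_pos b with hb | hb
    · subst hb
      interval_cases c <;> simp at em <;> omega
    have h3m : 3 ∣ m := by rw [em]; exact (dvd_pow_self _ (by omega)).mul_right _
    have hb' : b' = 0 := by
      by_contra hb'
      have h1 : 3 ∣ 3 ^ b' := dvd_pow_self _ hb'
      have h3 : 3 ∣ e := by rw [ee]; exact (h1.mul_left _).mul_right _
      omega
    subst hb'
    interval_cases c
    · simp at em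
      rcases hme with h | h
      · rw [em] at h
        have := three_pow_add b (h ▸ he)
        interval_cases b <;> omega
      · have := three_pow_sub b e (by omega) he
        rcases this with rfl | rfl | rfl <;> omega
    · have hc0 : c' = 0 := by
        by_contra hc0
        have h5 : 5 ∣ 5 ^ c' := dvd_pow_self _ hc0
        have h51 : 5 ∣ e := by rw [ee]; exact h5.mul_left _
        omega
      subst hc0
      simp at ee em
      rcases hme with h | h
      · have hb1 := five_three_add b e a (by omega) ee
        have : b = 1 := by omega
        subst this; omega
      · have hb1 := five_three_sub b e a (by omega) ee
        omega
  have hex : n = 4 ∨ n = 5 ∨ n = 6 ∨ n = 9 ∨ n = 10 ∨ n = 16 ∨ n = 81 ∨ n = 8 ∨ n = 2 → (n, 2) ∈ excList := by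
    rintro (h | h | h | h | h | h | h | h | h)
    all_goals first
      | omega
      | (subst h; decide)
      | (exfalso; subst h; exact h1.1 7 (by norm_num) le_rfl (by norm_num))
  rcases Nat.mod_two_eq_zero_or_one n with h2 | h2
  · have := main (n - 1) n (by omega) h1 h0 (Or.inl (by omega))
    apply hex; omega
  · have := main n (n - 1) h2 h0 h1 (Or.inr (by omega))
    apply hex; omega

theorem sylvester (n k : ℕ) (hk : 1 ≤ k) (hkn : 2 * k ≤ n) :
    (∃ p i, p.Prime ∧ 5 ≤ p ∧ k + 2 ≤ p ∧ i < k ∧ p ∣ n - i ∧ (7 ≤ p ∨ (p = 5 ∧ 25 ∣ n - i))) ∨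
    (k = 1 ∧ 27 ∣ n) ∨ (n % 2 = 0 ∧ k % 2 = 1) ∨ (n, k) ∈ excList := by
  by_contra hc
  push Not at hc
  obtain ⟨hA, hB, hC, hD⟩ := hc
  rcases Nat.lt_or_ge k 4 with hk4 | hk4
  swap
  · refine sylvester_big n k hk4 hkn ?_
    intro p hp h7 hkp i hi hd
    exact (hA p i hp (by omega) hkp hi hd).1.not_ge h7
  have hS : ∀ i, i < k → Smo (n - i) := by
    intro i hi
    refine ⟨fun p hp h7 hd => ?_, fun h25 => ?_⟩
    · exact (hA p i hp (by omega) (by omega) hi hd).1.not_ge h7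
    · exact (hA 5 i (by norm_num) le_rfl (by omega) hi (dvd_trans (by norm_num) h25)).2 rfl h25
  interval_cases k
  · have hn2 : n % 2 = 1 := by
      by_contra h; exact hC (by omega) (by norm_num)
    obtain ⟨b, c, hc, e⟩ := (hS 0 (by norm_num)).odd hn2
    have hb : b ≤ 2 := by
      by_contra hb
      apply hB rfl
      rw [← Nat.sub_zero n, e, show 27 = 3 ^ 3 by norm_num]
      exact (pow_dvd_pow _ (by omega)).mul_right _
    apply hD
    simp at e
    interval_cases b <;> interval_cases c <;> simp at e <;> first | omega | (subst e; decide)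
  · exact hD (k2_case n (by omega) (hS 0 (by norm_num)) (hS 1 (by norm_num)))
  · have hn2 : n % 2 = 1 := by
      by_contra h; exact hC (by omega) (by norm_num)
    obtain ⟨b, c, hc, e⟩ := (hS 0 (by norm_num)).odd hn2
    obtain ⟨b', c', hc', e'⟩ := (hS 2 (by norm_num)).odd (by omega)
    have h7 : ¬ 7 ∣ n - 0 := (hS 0 (by norm_num)).1 7 (by norm_num) le_rfl
    have hz : b = 0 ∨ b' = 0 := by
      by_contra hbb
      push Not at hbb
      have h1 : 3 ∣ n - 0 := by rw [e]; exact (dvd_pow_self _ hbb.1).mul_right _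
      have h2 : 3 ∣ n - 2 := by rw [e']; exact (dvd_pow_self _ hbb.2).mul_right _
      omega
    rcases hz with rfl | rfl
    · interval_cases c <;> simp at e <;> omega
    · interval_cases c' <;> simp at e' <;> omega

theorem QQ_irreducible (n : ℕ) (u : ℤ) (hn : 1 ≤ n) (hu1 : -18 ≤ u) (hu2 : u ≤ -2) : Irreducible (QQ n u) := by
  apply irr_of_no_factor n u hn
  intro F H hF hH hFH k hFk hk hkn
  rcases sylvester n k hk hkn with ⟨p, i, hp, h5, hkp, hik, hd, h75⟩ | ⟨h1, h27⟩ | ⟨h2, h3⟩ | h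
  · exact noFactor_P p hp n u k i h5 hkp hu1 hu2 hik hkn hd h75 F H hF hH hFH hFk
  · exact noFactor_P3 n u hn hu1 hu2 h27 F H hF hH hFH (h1 ▸ hFk)
  · exact noFactor_parity n u k h2 h3 F H hF hH hFH hFk
  · exact noFactor_small n k u hu1 hu2 h F H hF hH hFH hFk

section jordan
open scoped Pointwise

lemma sylow_conj_aux {K : Type*} [Group K] [Finite K] (p : ℕ) [hp : Fact p.Prime]
    (hK : ¬ p ^ 2 ∣ Nat.card K) (a b : K) (ha : orderOf a = p) (hb : orderOf b = p) :
    ∃ k : K, k * a * k⁻¹ ∈ Subgroup.zpowers b := by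
  have h1 : (Nat.card K).factorization p = 1 := by
    have hd : p ∣ Nat.card K := ha ▸ orderOf_dvd_natCard a
    have hne : Nat.card K ≠ 0 := Nat.card_pos.ne'
    have h1 : 1 ≤ (Nat.card K).factorization p := by
      rw [← hp.out.dvd_iff_one_le_factorization hne]; exact hd
    have h2 : ¬ 2 ≤ (Nat.card K).factorization p := by
      intro h
      exact hK ((hp.out.pow_dvd_iff_le_factorization hne).2 h)
    omega
  let P := Sylow.ofCard (p := p) (Subgroup.zpowers a) (by rw [Nat.card_zpowers, ha, h1, pow_one])
  let Q := Sylow.ofCard (p := p) (Subgroup.zpowers b) (by rw [Nat.card_zpowers, hb, h1, pow_one])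
  obtain ⟨k, hk⟩ := MulAction.exists_smul_eq K P Q
  refine ⟨k, ?_⟩
  have : (Q : Subgroup K) = MulAut.conj k • (P : Subgroup K) := by
    rw [← hk]; rfl
  have hQ : (Q : Subgroup K) = Subgroup.zpowers b := rfl
  have hP : (P : Subgroup K) = Subgroup.zpowers a := rfl
  rw [← hQ, this, hP]
  exact ⟨a, Subgroup.mem_zpowers a, rfl⟩

lemma orderOf_conj' {K : Type*} [Group K] (h g : K) : orderOf (h * g * h⁻¹) = orderOf g :=
  orderOf_injective (MulAut.conj h).toMonoidHom (MulAut.conj h).injective g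

lemma not_sq_dvd_fact (p n : ℕ) (hp : p.Prime) (h : n < 2 * p) : ¬ p ^ 2 ∣ n.factorial := by
  intro hd
  have h1 := (hp.pow_dvd_factorial_iff (n := n) (r := 2) (b := n+1) (Nat.lt_succ_of_le (Nat.log_le_self _ _))).1 hd
  have h2 : ∑ i ∈ Finset.Ico 1 (n+1), n / p ^ i ≤ ∑ i ∈ Finset.Ico 1 (n+1), if i = 1 then 1 else 0 := by
    apply Finset.sum_le_sum
    intro i hi
    rw [Finset.mem_Ico] at hi
    split_ifs with h3
    · subst h3
      rw [pow_one, ← Nat.lt_succ_iff, Nat.div_lt_iff_lt_mul hp.pos]; omega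
    · have : p ^ 2 ≤ p ^ i := Nat.pow_le_pow_right hp.pos (by omega)
      have h4 : n < p ^ i := by
        have := hp.two_le
        nlinarith
      simp [Nat.div_eq_of_lt h4]
  have h5 : ∑ i ∈ Finset.Ico 1 (n+1), (if i = 1 then 1 else 0) ≤ 1 := by
    rw [Finset.sum_ite_eq']; split_ifs <;> simp
  omega

open MulAction Equiv.Perm Equiv
variable {α : Type*} [Fintype α] [DecidableEq α]

lemma prim_of_cycle (G : Subgroup (Perm α)) [IsPretransitive G α] (g : Perm α) (hg : g ∈ G)
    (hc : g.IsCycle) (hp : g.support.card.Prime) (hcard : Fintype.card α < 2 * g.support.card) :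
    IsPreprimitive G α := by
  obtain ⟨a, ha, hc'⟩ := hc
  refine IsPreprimitive.of_isTrivialBlock_base a ?_
  intro B haB hB
  by_cases hs : B.Subsingleton
  · exact Or.inl hs
  right
  rw [Set.not_subsingleton_iff] at hs
  obtain ⟨b, hbB, hba⟩ := hs.exists_ne a
  let g' : G := ⟨g, hg⟩
  have hord : orderOf g = g.support.card := IsCycle.orderOf ⟨a, ha, hc'⟩
  -- g • B = B
  have key : g' • B = B := by
    by_cases hb : g b = b
    · exact hB.smul_eq_of_mem hbB (by show g b ∈ B; rwa [hb])
    · obtain ⟨i, hi⟩ := hc' hb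
      have h1 : (g' ^ i) • B = B := hB.smul_eq_of_mem haB (by
        show ((g' ^ i : G) : Perm α) a ∈ B
        simp [g', hi, hbB])
      have hst : g' ^ i ∈ stabilizer G B := h1
      have hgo : orderOf g' = g.support.card := by
        rw [← hord]; exact Subgroup.orderOf_mk g hg
      have hne : g' ^ i ≠ 1 := by
        intro h
        have : g ^ i = 1 := by
          have := congrArg (Subtype.val) h
          simpa [g'] using this
        rw [this] at hi
        exact hba hi.symm
      have hcop : IsCoprime (i : ℤ) (orderOf g' : ℤ) := by
        rw [hgo]
        rw [isCoprime_comm, Int.isCoprime_iff_gcd_eq_one]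
        rw [Int.gcd_eq_natAbs, Int.natAbs_natCast]
        apply (Nat.Prime.coprime_iff_not_dvd hp).2
        intro hd
        apply hne
        rw [← orderOf_dvd_iff_zpow_eq_one, hgo]
        exact Int.natCast_dvd.2 hd
      obtain ⟨x, y, hxy⟩ := hcop
      have : g' = (g' ^ i) ^ x := by
        rw [← zpow_mul]
        have h3 : i * x = 1 - y * orderOf g' := by linarith
        rw [h3, zpow_sub, zpow_one, mul_comm y, zpow_mul]
        simp
      have h4 : g' ∈ stabilizer G B := by
        rw [this]; exact Subgroup.zpow_mem _ hst _
      exact h4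
  apply hB.eq_univ_of_card_lt
  have hsub : (g.support : Set α) ⊆ B := by
    intro x hx
    have hx' : g x ≠ x := by simpa using hx
    obtain ⟨i, rfl⟩ := hc' hx'
    have h4 : g' ^ i ∈ stabilizer G B := Subgroup.zpow_mem _ key _
    have h5 : g' ^ i • B = B := h4
    rw [← h5]
    exact ⟨a, haB, by simp [g', Subgroup.smul_def]⟩
  have := Set.ncard_le_ncard hsub (Set.toFinite _)
  rw [Set.ncard_coe_finset] at this
  rw [Nat.card_eq_fintype_card]
  omega

theorem jordan_prime (G : Subgroup (Perm α)) (p : ℕ) [hp : Fact p.Prime]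
    (ht : IsPretransitive G α) (hd : p ∣ Nat.card G) (h2 : Fintype.card α < 2 * p)
    (h3 : p + 3 ≤ Fintype.card α) : alternatingGroup α ≤ G := by
  obtain ⟨⟨g, hg⟩, hgo⟩ := exists_prime_orderOf_dvd_card' p hd
  rw [Subgroup.orderOf_mk] at hgo
  have hcy : g.IsCycle := isCycle_of_prime_order' (by rw [hgo]; exact hp.out) (by omega)
  have hsc : g.support.card = p := by rw [← hgo]; exact hcy.orderOf.symm
  have hprim : IsPreprimitive G α := prim_of_cycle G g hg hcy (by rw [hsc]; exact hp.out) (by omega)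
  -- fixed points
  set s : Set α := (g.support : Set α)ᶜ with hsdef
  have hsn : s.ncard = Fintype.card α - p := by
    rw [hsdef, Set.ncard_compl, Set.ncard_coe_finset, hsc, Nat.card_eq_fintype_card]
  have hms : ∀ x, x ∈ s ↔ g x = x := by
    intro x; simp [hsdef]
  have hmp : IsMultiplyPretransitive G α (Fintype.card α - p) := by
    have h0 : IsPretransitive (fixingSubgroup G s) (SubMulAction.ofFixingSubgroup G s) :=
      isPretransitive_of_isCycle_mem hcy hg
    have h1 : IsPreprimitive (fixingSubgroup G s) (SubMulAction.ofFixingSubgroup G s) := by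
      apply IsPreprimitive.of_prime_card
      have : Nat.card (SubMulAction.ofFixingSubgroup G s) = p := by
        classical
        rw [← hsc, Nat.card_eq_fintype_card, Fintype.card_subtype]
        simp [SubMulAction.mem_ofFixingSubgroup_iff, hsdef]
        rfl
      rw [this]; exact hp.out
    have hp2 := hp.out.two_le
    have h4 := IsPreprimitive.isMultiplyPreprimitive (n := Fintype.card α - p - 1) hprim
      (s := s) (by omega) (by rw [Nat.card_eq_fintype_card]; omega) h1
    have h5 := h4.isMultiplyPretransitive
    exact isMultiplyPretransitive_of_le (n := Fintype.card α - p - 1 + 2) (by omega)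
      (by rw [Nat.card_eq_fintype_card]; omega)
  have hfc : sᶜ.ncard = p := by simp [hsdef, Set.ncard_coe_finset, hsc]
  let K : Subgroup (Perm α) :=
    { carrier := {k | k ∈ G ∧ ∀ x ∈ s, k x = x}
      mul_mem' := by
        rintro a b ⟨ha, ha'⟩ ⟨hb, hb'⟩
        exact ⟨G.mul_mem ha hb, fun x hx => by rw [mul_apply, hb' x hx, ha' x hx]⟩
      one_mem' := ⟨G.one_mem, fun _ _ => rfl⟩
      inv_mem' := by
        rintro a ⟨ha, ha'⟩
        exact ⟨G.inv_mem ha, fun x hx => by rw [Equiv.Perm.inv_eq_iff_eq, ha' x hx]⟩ }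
  have hKp : ¬ p ^ 2 ∣ Nat.card K := by
    intro h
    have h1 := h.trans (Subgroup.card_subgroup_dvd_card K)
    rw [Nat.card_perm, Nat.card_eq_fintype_card] at h1
    exact not_sq_dvd_fact p _ hp.out h2 h1
  have hgK : g ∈ K := ⟨hg, fun x hx => (hms x).1 hx⟩
  have lift : ∀ τ : Perm α, (∀ x ∈ s, τ x ∈ s) → ∃ h ∈ G, (∀ x ∈ s, h x = τ x) ∧
      ∃ i : ℤ, h * g * h⁻¹ = g ^ i := by
    intro τ hτ
    have hfin : Fintype s := Fintype.ofFinite _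
    let e : Fin (Fintype.card α - p) ≃ s := (Fintype.equivFinOfCardEq (by
      rw [← Nat.card_eq_fintype_card, ← hsn]; rfl)).symm
    let e' : Fin (Fintype.card α - p) ↪ α := e.toEmbedding.trans (Function.Embedding.subtype _)
    obtain ⟨⟨h, hh⟩, hhe⟩ := isMultiplyPretransitive_iff.1 hmp e' (e'.trans τ.toEmbedding)
    have hag : ∀ x ∈ s, h x = τ x := by
      intro x hx
      have := DFunLike.congr_fun hhe (e.symm ⟨x, hx⟩)
      simpa [e', Subgroup.smul_def] using this
    have hmaps : ∀ x ∈ s, h⁻¹ x ∈ s := by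
      have hinj : Set.InjOn h s := h.injective.injOn
      have himg : h '' s = s := by
        apply Set.eq_of_subset_of_ncard_le
        · rintro _ ⟨x, hx, rfl⟩; rw [hag x hx]; exact hτ x hx
        · rw [hinj.ncard_image]
        · exact Set.toFinite _
      intro x hx
      rw [← himg] at hx
      obtain ⟨y, hy, rfl⟩ := hx
      simpa using hy
    have hcK : h * g * h⁻¹ ∈ K := by
      refine ⟨G.mul_mem (G.mul_mem hh hg) (G.inv_mem hh), fun x hx => ?_⟩
      rw [mul_apply, mul_apply, (hms _).1 (hmaps x hx)]; simp
    obtain ⟨⟨k, hk⟩, hkk⟩ := sylow_conj_aux (K := K) p hKp ⟨h * g * h⁻¹, hcK⟩ ⟨g, hgK⟩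
      (by rw [Subgroup.orderOf_mk, ← hgo]; exact orderOf_conj' h g) (by rw [Subgroup.orderOf_mk, hgo])
    obtain ⟨i, hi⟩ := hkk
    refine ⟨k * h, G.mul_mem hk.1 hh, fun x hx => ?_, i, ?_⟩
    · rw [mul_apply, hag x hx, hk.2 _ (hτ x hx)]
    · have := congrArg Subtype.val hi
      simp at this
      rw [this]; group
  -- three fixed points
  have h3s : 2 < s.ncard := by omega
  obtain ⟨x, hx, y, hy, z, hz, hxy, hxz, hyz⟩ := (Set.two_lt_ncard).1 h3s
  have hsw : ∀ a ∈ s, ∀ b ∈ s, ∀ t ∈ s, swap a b t ∈ s := by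
    intro a ha b hb t ht
    rw [swap_apply_def]; split_ifs <;> assumption
  obtain ⟨h1, h1G, h1s, i1, h1i⟩ := lift (swap x y) (hsw x hx y hy)
  obtain ⟨h2, h2G, h2s, i2, h2i⟩ := lift (swap x z) (hsw x hx z hz)
  have e12 : (h1 * h2) * g * (h1 * h2)⁻¹ = (h2 * h1) * g * (h2 * h1)⁻¹ := by
    have A : (h1 * h2) * g * (h1 * h2)⁻¹ = h1 * (h2 * g * h2⁻¹) * h1⁻¹ := by group
    have B : (h2 * h1) * g * (h2 * h1)⁻¹ = h2 * (h1 * g * h1⁻¹) * h2⁻¹ := by group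
    rw [A, B, h1i, h2i, ← conj_zpow, ← conj_zpow, h1i, h2i, ← zpow_mul, ← zpow_mul, mul_comm]
  set c := (h2 * h1)⁻¹ * (h1 * h2) with hc
  have hcg : c * g = g * c := by
    have : c * g * c⁻¹ = g := by
      have A : c * g * c⁻¹ = (h2 * h1)⁻¹ * ((h1 * h2) * g * (h1 * h2)⁻¹) * (h2 * h1) := by
        rw [hc]; group
      rw [A, e12]; group
    exact mul_inv_eq_iff_eq_mul.1 this
  have hcG : c ∈ G := G.mul_mem (G.inv_mem (G.mul_mem h2G h1G)) (G.mul_mem h1G h2G)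
  have hcs : ∀ t ∈ s, c t = ((swap x y * swap x z) * (swap x y * swap x z)) t := by
    intro t ht
    rw [hc, mul_apply, Equiv.Perm.inv_eq_iff_eq]
    simp only [mul_apply]
    have m1 := hsw x hx z hz t ht
    have m2 := hsw x hx y hy _ m1
    have m3 := hsw x hx z hz _ m2
    have m4 := hsw x hx y hy _ m3
    rw [h2s t ht, h1s _ m1, h1s _ m4, swap_apply_self, h2s _ m3, swap_apply_self]
  obtain ⟨a, ha, hca⟩ := hcy
  have hca' : g (c a) ≠ c a := by
    rw [← mul_apply, ← hcg, mul_apply]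
    exact fun h => ha (c.injective h)
  obtain ⟨i, hi⟩ := hca hca'
  have hci : ∀ t, t ∉ s → c t = (g ^ i) t := by
    intro t ht
    rw [hms] at ht
    obtain ⟨j, rfl⟩ := hca ht
    have hcj : c * g ^ j = g ^ j * c := by
      have : Commute c g := hcg
      exact this.zpow_right j
    rw [← mul_apply, hcj, mul_apply, ← hi, ← mul_apply, ← mul_apply, ← zpow_add, ← zpow_add, add_comm]
  have hgs : ∀ t ∈ s, ∀ j : ℤ, (g ^ j) t = t := by
    intro t ht j
    exact zpow_apply_eq_self_of_apply_eq_self ((hms t).1 ht) j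
  have hmem : (swap x y * swap x z) * (swap x y * swap x z) ∈ G := by
    have : (swap x y * swap x z) * (swap x y * swap x z) = (g ^ i)⁻¹ * c := by
      ext t
      by_cases ht : t ∈ s
      · rw [mul_apply (g ^ i)⁻¹ c, hcs t ht, ← zpow_neg, hgs]
        simp only [mul_apply]
        exact hsw x hx y hy _ (hsw x hx z hz _ (hsw x hx y hy _ (hsw x hx z hz t ht)))
      · rw [mul_apply (g ^ i)⁻¹ c, hci t ht]
        have n1 : t ≠ x := fun h => ht (h ▸ hx)
        have n2 : t ≠ y := fun h => ht (h ▸ hy)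
        have n3 : t ≠ z := fun h => ht (h ▸ hz)
        simp [swap_apply_of_ne_of_ne, n1, n2, n3]
    rw [this]
    exact G.mul_mem (G.inv_mem (G.zpow_mem hg _)) hcG
  have h3c : IsThreeCycle (swap x y * swap x z) := isThreeCycle_swap_mul_swap_same hxy hxz hyz
  exact alternatingGroup_le_of_isPreprimitive_of_isThreeCycle_mem hprim h3c.isThreeCycle_sq hmem
end jordan

section LemB
open NumberField IsDedekindDomain

lemma uniqDom_prod {R Γ : Type*} [CommRing R] [LinearOrderedCommGroupWithZero Γ]
    (v : Valuation R Γ) (ρ : Γ) (hρ : ρ ≠ 0) (s : Multiset R)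
    (hs : ∀ a ∈ s, v a ≠ ρ) : UniqDom v ρ (s.map (fun a => X - C a)).prod := by
  induction s using Multiset.induction with
  | empty =>
    refine ⟨0, by simp [gw], ?_⟩
    intro j hj
    simp [gw, coeff_one, hj]
  | cons a s ih =>
    rw [Multiset.map_cons, Multiset.prod_cons]
    refine UniqDom.mul v ρ hρ ?_ (ih (fun b hb => hs b (Multiset.mem_cons_of_mem hb)))
    have h := hs a (Multiset.mem_cons_self a s)
    have g0 : gw v ρ (X - C a) 0 = v a := by simp [gw]
    have g1 : gw v ρ (X - C a) 1 = ρ := by simp [gw, coeff_C]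
    have g2 : ∀ j, 2 ≤ j → gw v ρ (X - C a) j = 0 := by
      intro j hj
      simp [gw, coeff_X, coeff_C, show (1 : ℕ) ≠ j by omega, show j ≠ 0 by omega]
    rcases lt_or_gt_of_ne h with h | h
    · refine ⟨1, by rwa [g1], ?_⟩
      intro j hj
      rw [g1]
      rcases Nat.lt_or_ge j 2 with h2 | h2
      · have : j = 0 := by omega
        subst this; rwa [g0]
      · rw [g2 j h2]; exact zero_lt_iff.2 hρ
    · refine ⟨0, by rw [g0]; exact (lt_of_le_of_lt zero_le h).ne', ?_⟩
      intro j hj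
      rw [g0]
      rcases Nat.lt_or_ge j 2 with h2 | h2
      · have : j = 1 := by omega
        subst this; rwa [g1]
      · rw [g2 j h2]; exact lt_of_le_of_lt zero_le h

theorem exists_ram (L : Type*) [Field L] [NumberField L] [IsGalois ℚ L] (q : ℕ) [hq : Fact q.Prime] :
    ∃ (w : Valuation L (WithZero (Multiplicative ℤ))) (e : ℕ), e ≠ 0 ∧ e ∣ Nat.card (L ≃ₐ[ℚ] L) ∧
      ∀ c : ℤ, c ≠ 0 → w (c : L) = WithZero.exp (-((e * padicValInt q c : ℕ) : ℤ)) := by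
  have hqp : Prime (q : ℤ) := Nat.prime_iff_prime_int.1 hq.out
  have hq0 : (q : ℤ) ≠ 0 := hqp.ne_zero
  let v : HeightOneSpectrum ℤ :=
    ⟨Ideal.span {(q : ℤ)}, (Ideal.span_singleton_prime hq0).2 hqp, by simp [hq.out.ne_zero]⟩
  have : v.asIdeal.IsPrime := v.isPrime
  obtain ⟨P, hP⟩ := (inferInstance : Nonempty (Ideal.primesOver v.asIdeal (𝓞 L)))
  have hPp : P.IsPrime := hP.1
  have hPl : P.LiesOver v.asIdeal := hP.2
  let w : HeightOneSpectrum (𝓞 L) := ⟨P, hPp, Ideal.ne_bot_of_liesOver_of_ne_bot v.ne_bot P⟩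
  have hwl : w.asIdeal.LiesOver v.asIdeal := hPl
  have hG := Ideal.ncard_primesOver_mul_ramificationIdxIn_mul_inertiaDegIn v.asIdeal (𝓞 L)
    (L ≃ₐ[ℚ] L)
  rw [Ideal.ramificationIdxIn_eq_ramificationIdx v.asIdeal w.asIdeal (L ≃ₐ[ℚ] L),
    ← Ideal.ramificationIdx'_eq_ramificationIdx v.asIdeal w.asIdeal v.ne_bot] at hG
  have hw := fun x => HeightOneSpectrum.intValuation_liesOver v w x
  set e := v.asIdeal.ramificationIdx' w.asIdeal with he
  have hdv : e ∣ Nat.card (L ≃ₐ[ℚ] L) := by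
    rw [← hG]
    exact Dvd.dvd.mul_left (Dvd.intro _ rfl) _
  refine ⟨w.valuation L, e, ?_, hdv, ?_⟩
  · intro h
    rw [h, zero_dvd_iff] at hdv
    exact Nat.card_pos.ne' hdv
  · intro c hc
    have h1 : w.valuation L (c : L) = w.intValuation (algebraMap ℤ (𝓞 L) c) := by
      rw [← HeightOneSpectrum.valuation_of_algebraMap (K := L)]
      simp
    rw [h1, ← hw]
    have hfm : FiniteMultiplicity (q : ℤ) c := by
      rw [Int.finiteMultiplicity_iff]
      exact ⟨by simpa using hq.out.one_lt.ne', hc⟩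
    obtain ⟨m, hm, hqm⟩ := hfm.exists_eq_pow_mul_and_not_dvd
    have hmul : multiplicity (q : ℤ) c = padicValInt q c := by
      rw [padicValInt.of_ne_one_ne_zero hq.out.ne_one hc]
    rw [hmul] at hm
    have hvm : v.intValuation m = 1 := by
      rw [HeightOneSpectrum.intValuation_eq_one_iff]
      show ¬ m ∈ Ideal.span {(q : ℤ)}
      rwa [Ideal.mem_span_singleton]
    have hvq : v.intValuation (q : ℤ) = WithZero.exp (-1 : ℤ) :=
      v.intValuation_singleton hq0 rfl
    conv_lhs => rw [hm]
    rw [map_mul, map_pow, hvm, hvq, mul_one, ← WithZero.exp_nsmul, ← WithZero.exp_nsmul]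
    congr 1
    push_cast
    simp

theorem lemmaB_aux (L : Type*) [Field L] [NumberField L] [IsGalois ℚ L] (F : ℤ[X]) (hF : F.Monic) (q p : ℕ) [hq : Fact q.Prime] [hp : Fact p.Prime]
    (a j1 j2 : ℕ) (hj : j1 ≠ j2) (h1 : F.coeff j1 ≠ 0) (h2 : F.coeff j2 ≠ 0)
    (hle : ∀ j, F.coeff j ≠ 0 → p * padicValInt q (F.coeff j1) + a * j1 ≤
      p * padicValInt q (F.coeff j) + a * j)
    (heq : p * padicValInt q (F.coeff j2) + a * j2 = p * padicValInt q (F.coeff j1) + a * j1)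
    (hsplit : ((F.map (Int.castRingHom ℚ)).map (algebraMap ℚ L)).Splits) (hpa : ¬ p ∣ a) :
    p ∣ Nat.card (L ≃ₐ[ℚ] L) := by
  set Q := F.map (Int.castRingHom ℚ) with hQ
  have hQm : Q.Monic := hF.map _
  obtain ⟨w, e, he0, hed, hw⟩ := exists_ram L q
  have hp0 : p ≠ 0 := hp.out.ne_zero
  set W := vpow w p hp0 with hW
  set ρ : WithZero (Multiplicative ℤ) := WithZero.exp (-((a * e : ℕ) : ℤ)) with hρ
  have hρ0 : ρ ≠ 0 := WithZero.exp_ne_zero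
  have hprod := hsplit.eq_prod_roots_of_monic (hQm.map _)
  have hgw : ∀ j, F.coeff j ≠ 0 → gw W ρ (Q.map (algebraMap ℚ L)) j =
      WithZero.exp (-((e * (p * padicValInt q (F.coeff j) + a * j) : ℕ) : ℤ)) := by
    intro j hj
    unfold gw
    rw [coeff_map, hQ, coeff_map]
    simp only [eq_intCast, map_intCast]
    rw [hW, vpow_apply, hw _ hj, ← WithZero.exp_nsmul, ← WithZero.exp_nsmul, ← WithZero.exp_add]
    congr 1
    push_cast
    simp
    ring
  have hnu : ¬ UniqDom W ρ (Q.map (algebraMap ℚ L)) := by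
    rintro ⟨r, hr0, hr⟩
    have hr1 : F.coeff r ≠ 0 := by
      intro h
      apply hr0
      unfold gw
      rw [coeff_map, hQ, coeff_map, h]; simp
    have key : ∀ j, F.coeff j ≠ 0 → j ≠ r → p * padicValInt q (F.coeff r) + a * r <
        p * padicValInt q (F.coeff j) + a * j := by
      intro j hj hjr
      have := hr j hjr
      rw [hgw j hj, hgw r hr1, WithZero.exp_lt_exp, neg_lt_neg_iff] at this
      exact Nat.lt_of_mul_lt_mul_left (by exact_mod_cast this)
    have := hle r hr1
    by_cases hr2 : j1 = r
    · have := key j2 h2 (by omega)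
      omega
    · have := key j1 h1 hr2
      omega
  have hroot : ∃ x : L, W x = ρ := by
    by_contra hc
    push Not at hc
    apply hnu
    rw [hprod]
    exact uniqDom_prod W ρ hρ0 _ (fun a _ => hc a)
  obtain ⟨x, hx⟩ := hroot
  rw [hW, vpow_apply] at hx
  have hwx : w x ≠ 0 := by
    intro h
    rw [h, zero_pow hp0] at hx
    exact hρ0 hx.symm
  have : p ∣ a * e := by
    rw [← WithZero.exp_log hwx, ← WithZero.exp_nsmul, hρ, WithZero.exp_inj] at hx
    rw [← Int.natCast_dvd_natCast]
    exact ⟨-WithZero.log (w x), by simp at hx ⊢; linarith⟩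
  have hpe : p ∣ e := (hp.out.dvd_mul.1 this).resolve_left hpa
  exact hpe.trans hed

lemma numberField_card_transfer (p : ℕ) (L : Type*) [Field L] [NumberField L] [alg : Algebra ℚ L]
    (Q : ℚ[X]) (h : ∀ (_ : @IsGalois ℚ _ L _ DivisionRing.toRatAlgebra)
      (_ : (Q.map (@algebraMap ℚ L _ _ DivisionRing.toRatAlgebra)).Splits),
      p ∣ Nat.card (@AlgEquiv ℚ L L _ _ _ DivisionRing.toRatAlgebra DivisionRing.toRatAlgebra))
    (hG : @IsGalois ℚ _ L _ alg) (hs : (Q.map (@algebraMap ℚ L _ _ alg)).Splits) :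
    p ∣ Nat.card (@AlgEquiv ℚ L L _ _ _ alg alg) := by
  obtain rfl : alg = DivisionRing.toRatAlgebra := Subsingleton.elim _ _
  exact h hG hs

theorem lemmaB (F : ℤ[X]) (hF : F.Monic) (q p : ℕ) [hq : Fact q.Prime] [hp : Fact p.Prime]
    (a j1 j2 : ℕ) (hj : j1 ≠ j2) (h1 : F.coeff j1 ≠ 0) (h2 : F.coeff j2 ≠ 0)
    (hle : ∀ j, F.coeff j ≠ 0 → p * padicValInt q (F.coeff j1) + a * j1 ≤
      p * padicValInt q (F.coeff j) + a * j)
    (heq : p * padicValInt q (F.coeff j2) + a * j2 = p * padicValInt q (F.coeff j1) + a * j1)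
    (Q : ℚ[X]) (hQ : Q = F.map (Int.castRingHom ℚ))
    (hsep : Q.Separable) (hpa : ¬ p ∣ a) : p ∣ Nat.card Q.Gal := by
  have : NumberField Q.SplittingField :=
    { to_charZero := inferInstance, to_finiteDimensional := inferInstance }
  refine numberField_card_transfer (alg := SplittingField.instAlgebra_1 Q) p Q.SplittingField Q
    (fun _ hs => ?_) (@IsGalois.of_separable_splitting_field ℚ _ Q.SplittingField _
      (SplittingField.instAlgebra_1 Q) Q (IsSplittingField.splittingField Q) hsep) (SplittingField.splits Q)
  exact lemmaB_aux Q.SplittingField F hF q p a j1 j2 hj h1 h2 hle heq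
    (by rw [← hQ]; exact hs) hpa
end LemB

lemma GG_deriv (n : ℕ) (u : ℤ) : X * derivative (GG (n + 1) u) =
    C (n + 1 : ℤ) * GG (n + 1) u - C ((n + 1) * ff u (n + 1)) * GG n u := by
  ext j
  rw [coeff_sub, coeff_C_mul, coeff_C_mul]
  rcases j with _ | j
  · rw [coeff_X_mul_zero]
    simp only [GG_coeff, cc, Nat.choose_zero_right]
    rw [aa_succ n u 0 (by omega)]; push_cast; ring
  · rw [coeff_X_mul, coeff_derivative]
    simp only [GG_coeff]
    rcases Nat.lt_or_ge n (j + 1) with h | h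
    · rcases Nat.eq_or_lt_of_le h with h1 | h1
      · have : j = n := by omega
        subst this
        rw [cc_gt j u (j + 1) (by omega)]; ring
      · rw [cc_gt n u (j + 1) (by omega), cc_gt (n + 1) u (j + 1) (by omega)]; ring
    · unfold cc
      rw [aa_succ n u (j + 1) h]
      have h1 := Nat.add_one_mul_choose_eq n j
      have h2 := Nat.choose_succ_succ n j
      have h3 : ((n + 1 : ℕ) : ℤ) * (n.choose j : ℤ) = ((n+1).choose (j+1) : ℤ) * ((j+1 : ℕ) : ℤ) := by
        exact_mod_cast h1
      have h4 : ((n+1).choose (j+1) : ℤ) = (n.choose j : ℤ) + (n.choose (j+1) : ℤ) := by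
        exact_mod_cast h2
      push_cast at h3
      have h5 : ((n+1).choose (j+1) : ℤ) * ((j : ℤ) + 1) =
          (n + 1) * ((n+1).choose (j+1) : ℤ) - (n + 1) * (n.choose (j+1) : ℤ) := by
        rw [← h3, h4]; ring
      linear_combination (aa n u (j + 1) * ff u (n + 1)) * h5

noncomputable def RR (n : ℕ) (u : ℤ) : ℤ := resultant (GG (n + 1) u) (GG n u) (n + 1) n

lemma RR_succ (n : ℕ) (u : ℤ) : RR (n + 1) u = (-(2 * (n + 1) * ff u (n + 1))) ^ (n + 1) * RR n u := by
  unfold RR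
  have h : GG (n + 2) u = C (-(2 * (n + 1) * ff u (n + 1))) * GG n u
      + GG (n + 1) u * (X + C (4 * (n + 1) + 2 * u + 3)) := by
    rw [GG_rec, C_neg]; ring
  rw [show n + 1 + 1 = n + 2 from rfl, h, resultant_add_mul_left, resultant_C_mul_left,
    resultant_add_left_deg (m := n) (k := 2), GG_coeff, cc_self, resultant_comm]
  · have h1 : ((-1 : ℤ)) ^ ((n + 1) * 2) = 1 := by rw [mul_comm, pow_mul]; simp
    have h2 : ((-1 : ℤ)) ^ (n * (n + 1)) = 1 := (Nat.even_mul_succ_self n).neg_one_pow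
    rw [h1, h2]; push_cast; ring
  · rw [GG_natDegree]
  · rw [natDegree_X_add_C]; omega
  · rw [GG_natDegree]

lemma RR_zero (u : ℤ) : RR 0 u = 1 := by
  unfold RR; rw [GG_zero]; simp

lemma RR_eq (n : ℕ) (u : ℤ) : RR n u = (-1) ^ (n * (n + 1) / 2) *
    ∏ j ∈ Finset.Icc 1 n, (2 * j * ff u j) ^ j := by
  induction n with
  | zero => simp [RR_zero]
  | succ n ih =>
    rw [RR_succ, ih, Finset.prod_Icc_succ_top (by omega), neg_pow]
    have : (n + 1) * (n + 1 + 1) / 2 = n * (n + 1) / 2 + (n + 1) := by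
      rw [← Nat.add_mul_div_left _ _ (by norm_num : 0 < 2)]; congr 1; ring
    rw [this, pow_add]; push_cast; ring

/-- discriminant -/
def DD (n : ℕ) (u : ℤ) : ℤ := ∏ j ∈ Finset.Icc 1 n, 2 ^ (j - 1) * j ^ j * (ff u j) ^ (j - 1)

lemma DD_rel (n : ℕ) (u : ℤ) : (-1) ^ (n * (n + 1) / 2) * DD (n + 1) u * aa (n + 1) u 0 =
    ((n + 1) * ff u (n + 1)) ^ (n + 1) * RR n u := by
  rw [RR_eq]
  have key : DD (n + 1) u * aa (n + 1) u 0 = ((n + 1) * ff u (n + 1)) ^ (n + 1) *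
      ∏ j ∈ Finset.Icc 1 n, (2 * j * ff u j) ^ j := by
    induction n with
    | zero => simp [DD, aa]
    | succ n ih =>
      have e1 : DD (n + 1 + 1) u = DD (n + 1) u * (2 ^ (n + 1) * ((n + 1 + 1 : ℕ) : ℤ) ^ (n + 1 + 1) *
          ff u (n + 1 + 1) ^ (n + 1)) := by
        unfold DD; rw [Finset.prod_Icc_succ_top (by omega)]; rfl
      rw [e1, aa_succ _ _ _ (by omega), Finset.prod_Icc_succ_top (by omega)]
      have c1 : ((n + 1 + 1 : ℕ) : ℤ) = (n : ℤ) + 1 + 1 := by push_cast; ring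
      have c2 : ((n + 1 : ℕ) : ℤ) = (n : ℤ) + 1 := by push_cast; ring
      rw [c1, c2]
      generalize (n : ℤ) + 1 + 1 = A at *
      generalize (n : ℤ) + 1 = B at *
      simp only [mul_pow] at ih ⊢
      linear_combination (2 ^ (n + 1) * A ^ (n + 1 + 1) *
          ff u (n + 1 + 1) ^ (n + 1) * ff u (n + 1 + 1)) * ih
  linear_combination (-1) ^ (n * (n + 1) / 2) * key

lemma prod_deriv (n : ℕ) (u : ℤ) (L : Type*) [Field L] [CharZero L] (φ : ℤ →+* L)
    (hs : ((GG (n + 1) u).map φ).Splits) :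
    (((GG (n + 1) u).map φ).roots.map (derivative ((GG (n + 1) u).map φ)).eval).prod =
      (-1) ^ (n * (n + 1) / 2) * ((DD (n + 1) u : ℤ) : L) := by
  set P := (GG (n + 1) u).map φ with hP
  have hPm : P.Monic := (GG_monic _ _).map _
  have hPd : P.natDegree = n + 1 := by rw [hP, (GG_monic _ _).natDegree_map, GG_natDegree]
  have hcard : Multiset.card P.roots = n + 1 := by rw [← hPd]; exact hs.natDegree_eq_card_roots.symm
  have hφ : ∀ z : ℤ, φ z = (z : L) := fun z => by simp
  have h1 : (P.roots.map ((GG n u).map φ).eval).prod = ((RR n u : ℤ) : L) := by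
    have := resultant_eq_prod_eval P ((GG n u).map φ) n
      (by rw [(GG_monic _ _).natDegree_map, GG_natDegree]) hs
    rw [hPm.leadingCoeff, one_pow, one_mul, hPd] at this
    rw [← this, hP, resultant_map_map, hφ]; rfl
  have h2 : P.roots.prod = (-1) ^ (n + 1) * ((aa (n + 1) u 0 : ℤ) : L) := by
    have := hs.coeff_zero_eq_prod_roots_of_monic hPm
    rw [hPd, hP, coeff_map, GG_coeff, hφ] at this
    simp only [cc, Nat.choose_zero_right, Nat.cast_one, one_mul] at this
    rw [this, ← mul_assoc, ← pow_add, ← two_mul, pow_mul]; simp [hP]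
  have h3 : P.roots.map (fun x => x * (derivative P).eval x) =
      P.roots.map (fun x => (-(((n + 1) * ff u (n + 1) : ℤ) : L)) * ((GG n u).map φ).eval x) := by
    apply Multiset.map_congr rfl
    intro x hx
    have hx0 : P.eval x = 0 := (mem_roots'.1 hx).2
    have := congrArg (fun q => (q.map φ).eval x) (GG_deriv n u)
    simp only [Polynomial.map_mul, map_X, Polynomial.map_sub, map_C, eval_mul, eval_X, eval_sub, eval_C,
      ← hP, hx0, mul_zero, zero_sub] at this
    rw [hP, Polynomial.derivative_map, this, hφ]; ring
  have h4 := congrArg Multiset.prod h3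
  rw [Multiset.prod_map_mul, Multiset.prod_map_mul, Multiset.map_id', h1, h2, Multiset.map_const',
    Multiset.prod_replicate, hcard] at h4
  have h5 := congrArg (fun z : ℤ => (z : L)) (DD_rel n u)
  simp only [Int.cast_mul, Int.cast_pow] at h5
  have h6 : ((aa (n + 1) u 0 : ℤ) : L) ≠ 0 := by exact_mod_cast aa_ne _ _ _
  apply mul_left_cancel₀ (mul_ne_zero (pow_ne_zero (n + 1) (by simp : (-1 : L) ≠ 0)) h6)
  rw [h4, neg_pow, Int.cast_mul]
  push_cast at h5 ⊢
  linear_combination (-1) ^ (n + 1) * (-h5)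

section disc
open scoped Classical in
lemma disc_square (Q : ℚ[X]) (hm : Q.Monic) (hsep : Q.Separable) (n : ℕ) (hn : Q.natDegree = n)
    (E : Type*) [Field E] [Algebra ℚ E]
    [hE : IsSplittingField ℚ E Q] [Fact (Q.map (algebraMap ℚ E)).Splits]
    (h : ∀ σ : Q.Gal, Equiv.Perm.sign (Gal.galActionHom Q E σ) = 1) :
    ∃ r : ℚ, ((Q.map (algebraMap ℚ E)).roots.map (derivative (Q.map (algebraMap ℚ E))).eval).prod =
      (-1) ^ (n * (n - 1) / 2) * algebraMap ℚ E r ^ 2 := by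
  have hs : (Q.map (algebraMap ℚ E)).Splits := Fact.out
  have hcard : Fintype.card (Q.rootSet E) = n := by
    rw [← hn]; exact card_rootSet_eq_natDegree hsep hs
  have hGal : IsGalois ℚ E := IsGalois.of_separable_splitting_field hsep
  have hfin : FiniteDimensional ℚ E := IsSplittingField.finiteDimensional E Q
  let e : Q.rootSet E ≃ Fin n := Fintype.equivFinOfCardEq hcard
  let x : Fin n → E := fun i => ((e.symm i : Q.rootSet E) : E)
  have hx : Function.Injective x := fun i j hij => e.symm.injective (Subtype.ext hij)
  set P := Q.map (algebraMap ℚ E) with hP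
  have hP0 : P ≠ 0 := (hm.map _).ne_zero
  have hnd : P.roots.Nodup := nodup_roots (hsep.map)
  have hroots : P.roots = (Finset.univ : Finset (Fin n)).val.map x := by
    have h1 : P.roots.toFinset = (Finset.univ : Finset (Fin n)).map ⟨x, hx⟩ := by
      ext y
      simp only [Multiset.mem_toFinset, Finset.mem_map, Finset.mem_univ, true_and,
        Function.Embedding.coeFn_mk]
      constructor
      · intro hy
        have : y ∈ Q.rootSet E := by
          rw [mem_rootSet]; refine ⟨hm.ne_zero, ?_⟩
          rw [aeval_def, ← eval_map]; exact (mem_roots'.1 hy).2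
        exact ⟨e ⟨y, this⟩, by simp [x]⟩
      · rintro ⟨i, rfl⟩
        have := (e.symm i).2
        rw [mem_rootSet, aeval_def, ← eval_map] at this
        exact mem_roots'.2 ⟨hP0, this.2⟩
    have h2 := congrArg Finset.val h1
    rw [Multiset.toFinset_val, hnd.dedup, Finset.map_val] at h2
    exact h2
  have hnodal : P = Lagrange.nodal Finset.univ x := by
    rw [hs.eq_prod_roots_of_monic (hm.map _), hroots, Multiset.map_map]; rfl
  set δ : E := ∏ i, ∏ j ∈ Finset.Ioi i, (x i - x j) with hδ
  have hfix : ∀ ϕ : E ≃ₐ[ℚ] E, ϕ δ = δ := by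
    intro ϕ
    let σ := Gal.restrict Q E ϕ
    let τ : Equiv.Perm (Fin n) := e.permCongr (Gal.galActionHom Q E σ)
    have hτ : Equiv.Perm.sign τ = 1 := by rw [Equiv.Perm.sign_permCongr]; exact h σ
    have h1 : ∀ i, ϕ (x i) = x (τ i) := by
      intro i
      have : x (τ i) = ((σ • (e.symm i) : Q.rootSet E) : E) := by
        simp only [x, τ, Equiv.permCongr_apply, Equiv.symm_apply_apply]; rfl
      rw [this, Gal.restrict_smul]
    have h2 := Equiv.Perm.prod_Ioi_comp_eq_sign_mul_prod τ (f := fun i j => x i - x j)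
      (fun i j => by ring)
    rw [hτ] at h2
    rw [hδ, map_prod]
    simp only [map_prod, map_sub, h1]
    simpa using h2
  obtain ⟨r, hr⟩ := (IsGalois.mem_range_algebraMap_iff_fixed δ).2 hfix
  refine ⟨r, ?_⟩
  rw [hr, hroots, Multiset.map_map]
  change ∏ i, (derivative P).eval (x i) = _
  have h1 : ∀ i, (derivative P).eval (x i) = ∏ j ∈ {i}ᶜ, (x i - x j) := by
    intro i
    rw [hnodal, Lagrange.eval_nodal_derivative_eval_node_eq (Finset.mem_univ i), Lagrange.eval_nodal]
    apply Finset.prod_congr _ (fun _ _ => rfl)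
    ext; simp
  simp only [h1]
  rw [← Finset.prod_prod_Ioi_mul_eq_prod_prod_off_diag (fun j i => x i - x j)]
  have h2 : ∀ i j, (x i - x j) * (x j - x i) = (-1) * (x i - x j) ^ 2 := fun i j => by ring
  simp only [h2, Finset.prod_mul_distrib, Finset.prod_const, Finset.prod_pow, Fin.card_Ioi,
    Finset.prod_pow_eq_pow_sum]
  rw [← hδ]
  congr 2
  rw [Fin.sum_univ_eq_sum_range (fun i => n - 1 - i) n, Finset.sum_range_reflect (fun i => i) n,
    Finset.sum_range_id]

open scoped Classical in
lemma exists_odd (n : ℕ) (u : ℤ) (hn : 1 ≤ n) (hirr : Irreducible (QQ n u))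
    (E : Type*) [Field E] [CharZero E] [Algebra ℚ E]
    [hE : IsSplittingField ℚ E (QQ n u)] [Fact ((QQ n u).map (algebraMap ℚ E)).Splits]
    (hD : ¬ IsSquare (DD n u)) :
    ∃ σ : (QQ n u).Gal, Equiv.Perm.sign (Gal.galActionHom (QQ n u) E σ) ≠ 1 := by
  by_contra hc
  push Not at hc
  obtain ⟨r, hr⟩ := disc_square (QQ n u) (QQ_monic n u) hirr.separable n (QQ_natDegree n u) E hc
  obtain ⟨m, rfl⟩ : ∃ m, n = m + 1 := ⟨n - 1, by omega⟩
  apply hD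
  have hmap : (QQ (m + 1) u).map (algebraMap ℚ E) =
      (GG (m + 1) u).map ((algebraMap ℚ E).comp (Int.castRingHom ℚ)) := by
    unfold QQ; rw [Polynomial.map_map]
  have h2 := prod_deriv m u E ((algebraMap ℚ E).comp (Int.castRingHom ℚ))
    (by rw [← hmap]; exact Fact.out)
  rw [← hmap, hr, Nat.add_sub_cancel, mul_comm (m + 1) m] at h2
  have h3 := mul_left_cancel₀ (pow_ne_zero _ (by simp)) h2
  have h4 : algebraMap ℚ E (r ^ 2) = algebraMap ℚ E ((DD (m + 1) u : ℤ) : ℚ) := by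
    rw [map_pow, h3]; simp
  have h5 := (algebraMap ℚ E).injective h4
  rw [← Rat.isSquare_intCast_iff]
  exact ⟨r, by rw [← h5]; ring⟩

/-- combination -/
lemma gal_full_aux (n : ℕ) (u : ℤ) (hn : 1 ≤ n) (hirr : Irreducible (QQ n u))
    (E : Type*) [Field E] [CharZero E] [Algebra ℚ E]
    [hE : IsSplittingField ℚ E (QQ n u)] [Fact ((QQ n u).map (algebraMap ℚ E)).Splits]
    (hA : ∀ (G : Subgroup (Equiv.Perm (Fin n))), MulAction.IsPretransitive G (Fin n) →
      Nat.card G = Nat.card (QQ n u).Gal → (∃ g ∈ G, Equiv.Perm.sign g ≠ 1) → G = ⊤)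
    (hD : ¬ IsSquare (DD n u)) : Nonempty ((QQ n u).Gal ≃* Equiv.Perm (Fin n)) := by
  classical
  obtain ⟨σ, hσ⟩ := exists_odd n u hn hirr E hD
  have hcard : Fintype.card ((QQ n u).rootSet E) = n := by
    exact (card_rootSet_eq_natDegree hirr.separable Fact.out).trans (QQ_natDegree n u)
  let e : (QQ n u).rootSet E ≃ Fin n := Fintype.equivFinOfCardEq hcard
  let f : (QQ n u).Gal →* Equiv.Perm (Fin n) :=
    (e.permCongrHom : Equiv.Perm ((QQ n u).rootSet E) ≃* Equiv.Perm (Fin n)).toMonoidHom.comp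
      (Gal.galActionHom (QQ n u) E)
  have hf : Function.Injective f :=
    e.permCongrHom.injective.comp (Gal.galActionHom_injective (QQ n u) E)
  have hfa : ∀ (g : (QQ n u).Gal) x, f g x = e (g • e.symm x) := fun g x => rfl
  have htr := Gal.galAction_isPretransitive (QQ n u) E hirr
  have htop : f.range = ⊤ := by
    apply hA
    · refine ⟨fun x y => ?_⟩
      obtain ⟨g, hg⟩ := htr.exists_smul_eq (e.symm x) (e.symm y)
      refine ⟨⟨f g, g, rfl⟩, ?_⟩
      change f g x = y
      rw [hfa, hg]; simp
    · exact (Nat.card_congr (MonoidHom.ofInjective hf).toEquiv).symm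
    · refine ⟨f σ, ⟨σ, rfl⟩, ?_⟩
      have : Equiv.Perm.sign (f σ) = Equiv.Perm.sign (Gal.galActionHom (QQ n u) E σ) :=
        Equiv.Perm.sign_permCongr e _
      rw [this]; exact hσ
  exact ⟨MulEquiv.ofBijective f ⟨hf, MonoidHom.range_eq_top.1 htop⟩⟩

lemma gal_full (n : ℕ) (u : ℤ) (hn : 1 ≤ n) (hirr : Irreducible (QQ n u))
    (hA : ∀ (G : Subgroup (Equiv.Perm (Fin n))), MulAction.IsPretransitive G (Fin n) →
      Nat.card G = Nat.card (QQ n u).Gal → (∃ g ∈ G, Equiv.Perm.sign g ≠ 1) → G = ⊤)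
    (hD : ¬ IsSquare (DD n u)) : Nonempty ((QQ n u).Gal ≃* Equiv.Perm (Fin n)) :=
  @gal_full_aux n u hn hirr (QQ n u).SplittingField _ inferInstance (SplittingField.instAlgebra_1 _)
    (IsSplittingField.splittingField _) ⟨SplittingField.splits _⟩ hA hD

lemma top_of_alt {n : ℕ} (G : Subgroup (Equiv.Perm (Fin n))) (h : alternatingGroup (Fin n) ≤ G)
    (ho : ∃ g ∈ G, Equiv.Perm.sign g ≠ 1) : G = ⊤ := by
  obtain ⟨g, hg, hs⟩ := ho
  rw [eq_top_iff]
  intro x _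
  by_cases hx : Equiv.Perm.sign x = 1
  · exact h (Equiv.Perm.mem_alternatingGroup.2 hx)
  · have h1 : Equiv.Perm.sign x = -1 := (Int.units_eq_one_or _).resolve_left hx
    have h2 : Equiv.Perm.sign g = -1 := (Int.units_eq_one_or _).resolve_left hs
    have : x * g ∈ G := h (Equiv.Perm.mem_alternatingGroup.2 (by rw [Equiv.Perm.sign_mul, h1, h2]; rfl))
    exact (Subgroup.mul_mem_cancel_right G hg).1 this
end disc

lemma gal_dvd_large (n p : ℕ) (u : ℤ) (hp : p.Prime) (hu1 : -18 ≤ u) (hu2 : u ≤ -2) (hp1 : 37 ≤ p)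
    (h2 : n < 2 * p) (h3 : p + 3 ≤ n) (hirr : Irreducible (QQ n u)) : p ∣ Nat.card (QQ n u).Gal := by
  haveI : Fact p.Prime := ⟨hp⟩
  have hp2 : p ≠ 2 := by omega
  obtain ⟨w, hw⟩ := hp.odd_of_ne_two hp2
  obtain ⟨v, hv⟩ : ∃ v : ℕ, u = -(v : ℤ) := ⟨(-u).toNat, by omega⟩
  -- i0 = w + v
  have hff : ff u (w + v) = p := by unfold ff; push_cast; rw [hv, hw]; push_cast; ring
  have hff2 : ff u (w + v + p) = p * 3 := by
    unfold ff; push_cast; rw [hv, hw]; push_cast; ring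
  have hd : (p : ℤ) ∣ ff u (w + v) := by rw [hff]
  have hd2 : (p : ℤ) ∣ ff u (w + v + p) := by rw [hff2]; exact Dvd.intro _ rfl
  have hi : w + v < p := by omega
  have s1 : ∀ e, e < w + v → SS p u e = 0 := fun e he =>
    SS_zero p hp hp2 u (w + v) e hd hi.le he
  have s1' : SS p u (w + v) = 1 := by
    obtain ⟨k, hk⟩ : ∃ k, w + v = k + 1 := ⟨w + v - 1, by omega⟩
    rw [hk, SS_succ, s1 k (by omega), ← hk, hff, padicValInt.of_nat, padicValNat_self]
  have s2 : ∀ e, w + v ≤ e → e < w + v + p → SS p u e = 1 := by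
    intro e h1 h2
    have := SS_const p hp hp2 u (w + v) (e - (w + v)) hd (by omega)
    rw [show w + v + (e - (w + v)) = e by omega] at this
    rw [this, s1']
  have hp3 : padicValInt p (p * 3 : ℤ) = 1 := by
    rw [show (p * 3 : ℤ) = ((p * 3 : ℕ) : ℤ) by push_cast; ring, padicValInt.of_nat,
      padicValNat.mul hp.ne_zero (by norm_num), padicValNat_self,
      padicValNat.eq_zero_of_not_dvd (fun h => by have := Nat.le_of_dvd (by norm_num) h; omega)]
  have s3 : ∀ e, w + v + p ≤ e → e ≤ n → SS p u e = 2 := by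
    intro e h1 h2
    have := SS_const p hp hp2 u (w + v + p) (e - (w + v + p)) hd2 (by omega)
    rw [show w + v + p + (e - (w + v + p)) = e by omega] at this
    rw [this]
    obtain ⟨k, hk⟩ : ∃ k, w + v + p = k + 1 := ⟨w + v + p - 1, by omega⟩
    rw [hk, SS_succ, s2 k (by omega) (by omega), ← hk, hff2, hp3]
  have c0 : ∀ j, j ≤ n - p → padicValNat p (n.choose j) = 0 := fun j hj =>
    padicValNat.eq_zero_of_not_dvd
      (choose_not_dvd p hp n (n - p) j (by omega) (by omega) (by rw [show n - (n - p) = p by omega]) hj)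
  have c0' : ∀ j, p ≤ j → j ≤ n → padicValNat p (n.choose j) = 0 := fun j h1 h2 => by
    rw [← Nat.choose_symm h2]; exact c0 _ (by omega)
  have c1 : ∀ j, n - p < j → j < p → 1 ≤ padicValNat p (n.choose j) := fun j h1 h2 => by
    have := choose_dvd p hp 1 n (n - p) j (by omega) (by omega)
      (by rw [show n - (n - p) = p by omega, pow_one]) (by rw [Nat.mod_eq_of_lt h2]; exact h1)
    rw [pow_one] at this
    exact one_le_padicValNat_of_dvd (Nat.choose_pos (by omega)).ne' this
  have hz : ∀ j, (GG n u).coeff j ≠ 0 → j ≤ n := by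
    intro j hj; by_contra hc; rw [GG_coeff, cc_gt n u j (by omega)] at hj; exact hj rfl
  have hnz : ∀ j, j ≤ n → (GG n u).coeff j ≠ 0 := by
    intro j hj; rw [GG_coeff]; exact cc_ne n u j hj
  have hv : ∀ j, j ≤ n → padicValInt p (cc n u j) + SS p u j = padicValNat p (n.choose j) + SS p u n :=
    fun j hj => val_cc p n u j hj
  by_cases hcase : w + v + p ≤ n
  · have e1 := hv (w + v) (by omega)
    have e2 := hv (w + v + p) (by omega)
    rw [s3 n hcase le_rfl, s1', c0 _ (by omega)] at e1
    rw [s3 n hcase le_rfl, s3 _ le_rfl hcase, c0' _ (by omega) (by omega)] at e2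
    have e1' : padicValInt p (cc n u (w + v)) = 1 := by omega
    have e2' : padicValInt p (cc n u (w + v + p)) = 0 := by omega
    refine lemmaB (GG n u) (GG_monic n u) p p 1 (w + v) (w + v + p) (by omega) (hnz _ (by omega))
      (hnz _ (by omega)) ?_ ?_ (QQ n u) rfl hirr.separable (fun h => by have := Nat.le_of_dvd one_pos h; omega)
    · intro j hj
      have hjn := hz j hj
      have ej := hv j hjn
      rw [s3 n hcase le_rfl] at ej
      rw [GG_coeff, GG_coeff, e1']
      rcases Nat.lt_or_ge j (w + v) with h | h
      · rw [s1 j h] at ej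
        have : 2 ≤ padicValInt p (cc n u j) := by omega
        have := Nat.mul_le_mul_left p this
        omega
      · rcases Nat.lt_or_ge j (w + v + p) with h' | h'
        · rw [s2 j h h'] at ej
          have : 1 ≤ padicValInt p (cc n u j) := by omega
          have := Nat.mul_le_mul_left p this
          omega
        · have := Nat.zero_le (p * padicValInt p (cc n u j))
          omega
    · rw [GG_coeff, GG_coeff, e1', e2']; ring
  · have sn : SS p u n = 1 := s2 n (by omega) (by omega)
    have e1 := hv 0 (by omega)
    have e2 := hv p (by omega)
    rw [sn, s1 0 (by omega), c0 _ (by omega)] at e1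
    rw [sn, s2 p (by omega) (by omega), c0' _ (by omega) (by omega)] at e2
    have e1' : padicValInt p (cc n u 0) = 1 := by omega
    have e2' : padicValInt p (cc n u p) = 0 := by omega
    refine lemmaB (GG n u) (GG_monic n u) p p 1 0 p (by omega) (hnz _ (by omega))
      (hnz _ (by omega)) ?_ ?_ (QQ n u) rfl hirr.separable (fun h => by have := Nat.le_of_dvd one_pos h; omega)
    · intro j hj
      have hjn := hz j hj
      have ej := hv j hjn
      rw [sn] at ej
      rw [GG_coeff, GG_coeff, e1']
      rcases Nat.lt_or_ge j p with h | h
      · have : 1 ≤ padicValInt p (cc n u j) := by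
          rcases Nat.lt_or_ge j (w + v) with h' | h'
          · rw [s1 j h'] at ej; omega
          · rw [s2 j h' (by omega)] at ej
            have := c1 j (by omega) h
            omega
        have := Nat.mul_le_mul_left p this
        omega
      · have := Nat.zero_le (p * padicValInt p (cc n u j))
        omega
    · rw [GG_coeff, GG_coeff, e1', e2']; ring

lemma exists_prime_mid (n : ℕ) (hn : 16 ≤ n) : ∃ p, p.Prime ∧ n < 2 * p ∧ p + 3 ≤ n := by
  by_contra hc
  push Not at hc
  set k := (n - 3) / 2 - (if n % 2 = 0 then 1 else 0) with hk
  have hk' : k = (n - 3) / 2 - 1 ∧ n % 2 = 0 ∨ k = (n - 3) / 2 ∧ n % 2 = 1 := by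
    rw [hk]; split_ifs with h <;> omega
  clear_value k
  refine sylvester_big (n - 3) k (by omega) (by omega) ?_
  intro p hp _ hp1 i hi ⟨c, hc'⟩
  rcases c with _ | _ | c
  · omega
  · exact absurd (hc p hp (by omega)) (by omega)
  · have : p * 2 ≤ p * (c + 1 + 1) := Nat.mul_le_mul_left p (by omega)
    omega

/-- Newton polygon edge test for Lemma B -/
def edgeChk (n : ℕ) (u : ℤ) (q p a j1 j2 : ℕ) : Bool :=
  let w := p * VV q n u j1 + a * j1
  Nat.ble (j1 + 1) j2 && Nat.ble j2 n && !(a % p == 0) && (p * VV q n u j2 + a * j2 == w) &&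
    (List.range (n + 1)).all (fun j => Nat.ble w (p * VV q n u j + a * j))

lemma edgeChk_sound (n : ℕ) (u : ℤ) (q p a j1 j2 : ℕ) (hq : q.Prime) (hp : p.Prime)
    (hu1 : -1000 ≤ u) (hu2 : u ≤ 1000) (hn : n ≤ 1000)
    (h : edgeChk n u q p a j1 j2 = true) (hirr : Irreducible (QQ n u)) : p ∣ Nat.card (QQ n u).Gal := by
  haveI : Fact p.Prime := ⟨hp⟩
  haveI : Fact q.Prime := ⟨hq⟩
  unfold edgeChk at h
  simp only [Bool.and_eq_true, Nat.ble_eq, beq_iff_eq, List.all_eq_true, List.mem_range,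
    Bool.not_eq_true', beq_eq_false_iff_ne] at h
  obtain ⟨⟨⟨⟨h1, h2⟩, h3⟩, h4⟩, h5⟩ := h
  have hz : ∀ j, (GG n u).coeff j ≠ 0 → j ≤ n := by
    intro j hj; by_contra hc; rw [GG_coeff, cc_gt n u j (by omega)] at hj; exact hj rfl
  have hnz : ∀ j, j ≤ n → (GG n u).coeff j ≠ 0 := by
    intro j hj; rw [GG_coeff]; exact cc_ne n u j hj
  refine lemmaB (GG n u) (GG_monic n u) q p a j1 j2 (by omega) (hnz _ (by omega))
      (hnz _ (by omega)) ?_ ?_ (QQ n u) rfl hirr.separable (fun h => h3 (Nat.mod_eq_zero_of_dvd h))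
  · intro j hj
    have := hz j hj
    rw [GG_coeff, GG_coeff, ← VV_eq q n u hu1 hu2 hn _ this, ← VV_eq q n u hu1 hu2 hn _ (by omega)]
    exact h5 j (by omega)
  · rw [GG_coeff, GG_coeff, ← VV_eq q n u hu1 hu2 hn _ h2, ← VV_eq q n u hu1 hu2 hn _ (by omega)]
    exact h4

def edgeFind (n b : ℕ) : Bool :=
  [5, 7, 11, 13, 17, 19, 23, 29, 31].any fun p => Nat.ble (n + 1) (2 * p) && Nat.ble (p + 3) n &&
    (let u : ℤ := -(b + 2 : ℕ)
     let i0 := ((p - 1) / 2 + b + 2) % p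
     [(1, i0), (1, 0), (1, n - p), (2, 0)].any fun x => edgeChk n u p p x.1 x.2 (x.2 + p))

def excL : List (ℕ × ℕ) := [(8, 3), (8, 4), (9, 3), (9, 4), (16, 7), (16, 8), (24, 11), (24, 12),
    (25, 11), (25, 12), (32, 15), (32, 16)]

lemma edgeFind_all : ∀ n, n < 32 → ∀ b, b < 17 →
    (excL.contains (n + 8, b) || edgeFind (n + 8) b) = true := by decide +kernel

lemma exc_of (n b : ℕ) (h : excL.contains (n, b) = true) :
    ((n : ℤ), (-((b + 2 : ℕ) : ℤ))) ∈ exceptionalSet := by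
  have h' : (n, b) ∈ excL := by simpa using h
  unfold excL at h'
  unfold exceptionalSet
  simp only [List.mem_cons, Prod.mk.injEq, List.not_mem_nil, or_false] at h'
  rcases h' with h|h|h|h|h|h|h|h|h|h|h|h <;> obtain ⟨rfl, rfl⟩ := h <;> simp

lemma alt_le (n : ℕ) (u : ℤ) (hn : 8 ≤ n) (hu1 : -18 ≤ u) (hu2 : u ≤ -2)
    (hE : ((n : ℤ), u) ∉ exceptionalSet) (G : Subgroup (Equiv.Perm (Fin n)))
    (ht : MulAction.IsPretransitive G (Fin n)) (hc : Nat.card G = Nat.card (QQ n u).Gal) :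
    alternatingGroup (Fin n) ≤ G := by
  have hirr := QQ_irreducible n u (by omega) hu1 hu2
  have key : ∃ p, p.Prime ∧ n < 2 * p ∧ p + 3 ≤ n ∧ p ∣ Nat.card (QQ n u).Gal := by
    by_cases h74 : 74 ≤ n
    · obtain ⟨p, hp, h1, h2⟩ := exists_prime_mid n (by omega)
      exact ⟨p, hp, h1, h2, gal_dvd_large n p u hp hu1 hu2 (by omega) h1 h2 hirr⟩
    by_cases h40 : 40 ≤ n
    · exact ⟨37, by norm_num, by omega, by omega,
        gal_dvd_large n 37 u (by norm_num) hu1 hu2 le_rfl (by omega) (by omega) hirr⟩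
    obtain ⟨a, ha, rfl⟩ : ∃ a : ℕ, a < 17 ∧ u = -((a + 2 : ℕ) : ℤ) := ⟨(-u - 2).toNat, by omega, by omega⟩
    have h := edgeFind_all (n - 8) (by omega) a ha
    rw [Nat.sub_add_cancel hn, Bool.or_eq_true] at h
    rcases h with h | h
    · exact absurd (exc_of n a h) hE
    · unfold edgeFind at h
      rw [List.any_eq_true] at h
      obtain ⟨p, hp, h⟩ := h
      simp only [Bool.and_eq_true, Nat.ble_eq] at h
      obtain ⟨⟨h1, h2⟩, h3⟩ := h
      rw [List.any_eq_true] at h3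
      obtain ⟨x, -, hx⟩ := h3
      have hpp : p.Prime := by
        have : ∀ p ∈ [5, 7, 11, 13, 17, 19, 23, 29, 31], p.Prime := by
          intro p hp; fin_cases hp <;> norm_num
        exact this p hp
      exact ⟨p, hpp, by omega, h2, edgeChk_sound n _ p p _ _ _ hpp hpp (by omega) (by omega) (by omega) hx hirr⟩
  obtain ⟨p, hp, h1, h2, hd⟩ := key
  haveI : Fact p.Prime := ⟨hp⟩
  exact jordan_prime G p ht (by rw [hc]; exact hd) (by simpa using h1) (by simpa using h2)

lemma DD_ne (n : ℕ) (u : ℤ) : DD n u ≠ 0 := by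
  unfold DD
  refine Finset.prod_ne_zero_iff.2 fun j hj => ?_
  have : 1 ≤ j := (Finset.mem_Icc.1 hj).1
  exact mul_ne_zero (mul_ne_zero (by positivity) (by positivity)) (pow_ne_zero _ (ff_ne u j))

lemma val_DD (q : ℕ) [hq : Fact q.Prime] (n : ℕ) (u : ℤ) : padicValInt q (DD n u) =
    ∑ j ∈ Finset.Icc 1 n, ((j - 1) * padicValNat q 2 + j * padicValNat q j +
      (j - 1) * padicValInt q (ff u j)) := by
  unfold DD
  have hne : ∀ j ∈ Finset.Icc 1 n, (2 : ℤ) ^ (j - 1) ≠ 0 ∧ (j : ℤ) ^ j ≠ 0 ∧ (ff u j) ^ (j - 1) ≠ 0 := by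
    intro j hj
    have : 1 ≤ j := (Finset.mem_Icc.1 hj).1
    exact ⟨by positivity, by positivity, pow_ne_zero _ (ff_ne u j)⟩
  rw [padicValInt_prod _ _ _ (fun j hj => mul_ne_zero (mul_ne_zero (hne j hj).1 (hne j hj).2.1) (hne j hj).2.2)]
  apply Finset.sum_congr rfl
  intro j hj
  obtain ⟨h1, h2, h3⟩ := hne j hj
  rw [padicValInt.mul (mul_ne_zero h1 h2) h3, padicValInt.mul h1 h2]
  have hpow : ∀ (x : ℤ) (k : ℕ), padicValInt q (x ^ k) = k * padicValInt q x := by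
    intro x k
    unfold padicValInt; rw [Int.natAbs_pow, padicValNat.pow]
  rw [hpow, hpow, hpow, padicValInt.of_nat, show padicValInt q 2 = padicValNat q 2 from rfl]

lemma val_even_of_square (q : ℕ) [hq : Fact q.Prime] (x : ℤ) (hx : x ≠ 0) (h : IsSquare x) :
    2 ∣ padicValInt q x := by
  obtain ⟨r, rfl⟩ := h
  have : r ≠ 0 := by rintro rfl; simp at hx
  rw [padicValInt.mul this this]; omega

/-- a prime in the middle range gives an odd valuation -/
lemma nonsq_prime (n q : ℕ) (u : ℤ) (hq : q.Prime) (hu1 : -18 ≤ u) (hu2 : u ≤ -2) (h34 : 34 ≤ n)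
    (h1 : n < q) (h2 : (q : ℤ) ≤ 2 * n + 2 * u + 1) (h4 : ((q : ℤ) - (2 * u + 1)) % 4 = 0) :
    ¬ IsSquare (DD n u) := by
  intro hs
  haveI : Fact q.Prime := ⟨hq⟩
  have h := val_even_of_square q _ (DD_ne n u) hs
  obtain ⟨k, hk⟩ : ∃ k : ℕ, (q : ℤ) = 2 * (u + 2 * k) + 1 ∧ 1 ≤ k :=
    ⟨(((q : ℤ) - (2 * u + 1)) / 4).toNat, by omega, by omega⟩
  rw [val_DD] at h
  have h0 : ∑ j ∈ Finset.Icc 1 n, ((j - 1) * padicValNat q 2 + j * padicValNat q j +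
      (j - 1) * padicValInt q (ff u j)) = ∑ j ∈ Finset.Icc 1 n, if j = 2 * k then (j - 1) else 0 := by
    apply Finset.sum_congr rfl
    intro j hj
    rw [Finset.mem_Icc] at hj
    have e1 : padicValNat q 2 = 0 := padicValNat.eq_zero_of_not_dvd
      (fun h => by have := Nat.le_of_dvd (by norm_num) h; omega)
    have e2 : padicValNat q j = 0 := padicValNat.eq_zero_of_not_dvd
      (fun h => by have := Nat.le_of_dvd (by omega) h; omega)
    rw [e1, e2]
    split_ifs with hjk
    · have : ff u j = (q : ℤ) := by rw [hk.1, hjk]; unfold ff; push_cast; ring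
      rw [this, padicValInt.of_nat, padicValNat_self]; ring
    · rw [padicValInt_zero_of]
      · simp
      rintro ⟨c, hc⟩
      have hlo : -(q : ℤ) < ff u j := by unfold ff; omega
      have hhi : ff u j < 2 * (q : ℤ) := by unfold ff; omega
      have hn0 := ff_ne u j
      have hq0 : (0 : ℤ) < q := by omega
      rw [hc] at hlo hhi hn0
      have c1 : -1 < c := by by_contra h; nlinarith
      have c2 : c < 2 := by by_contra h; nlinarith
      have c3 : c ≠ 0 := by rintro rfl; simp at hn0
      have : c = 1 := by omega
      rw [this] at hc
      unfold ff at hc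
      omega
  rw [h0, Finset.sum_ite_eq' , if_pos (Finset.mem_Icc.2 (by omega))] at h
  omega

lemma count_res (N m : ℕ) (c : ℤ) (hm : Odd m) :
    ((Finset.range N).filter fun s : ℕ => (m : ℤ) ∣ 4 * s + c).card ≤ N / m + 1 := by
  have := Finset.card_le_card_of_injOn (s := (Finset.range N).filter fun s : ℕ => (m : ℤ) ∣ 4 * s + c)
    (t := Finset.range (N / m + 1)) (fun s => s / m) ?_ ?_
  · simpa using this
  · intro s hs
    have hs := (Finset.mem_filter.1 hs).1
    rw [Finset.mem_range] at hs
    simp only [Finset.coe_range, Set.mem_Iio]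
    exact Nat.lt_succ_of_le (Nat.div_le_div_right hs.le)
  · intro s hs t ht hst
    have hs := (Finset.mem_filter.1 hs).2
    have ht := (Finset.mem_filter.1 ht).2
    have h1 : (m : ℤ) ∣ 4 * ((s : ℤ) - t) := by
      have := dvd_sub hs ht; ring_nf at this ⊢; exact this
    have hco : IsCoprime (m : ℤ) 4 := by
      rw [Int.isCoprime_iff_nat_coprime]
      exact (Nat.Coprime.pow_right 2 (Nat.coprime_two_right.2 hm) : Nat.Coprime m (2 ^ 2))
    have h2 := hco.dvd_of_dvd_mul_left h1
    have h3 : s ≡ t [MOD m] := ((Nat.modEq_iff_dvd).2 h2).symm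
    have hst' : s / m = t / m := hst
    rw [← Nat.div_add_mod s m, ← Nat.div_add_mod t m, hst', h3]

lemma val_eq_count (q L x : ℕ) (hq : q.Prime) (hx : x ≠ 0) (hL : Nat.log q x ≤ L) :
    padicValNat q x = ((Finset.Icc 1 L).filter fun i => q ^ i ∣ x).card := by
  haveI : Fact q.Prime := ⟨hq⟩
  have hv : padicValNat q x ≤ L := (padicValNat_le_nat_log x).trans hL
  have : ((Finset.Icc 1 L).filter fun i => q ^ i ∣ x) = Finset.Icc 1 (padicValNat q x) := by
    ext i
    simp only [Finset.mem_filter, Finset.mem_Icc, padicValNat_dvd_iff_le hx]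
    omega
  rw [this]; simp

lemma val_Pc (q N B : ℕ) (hq : q.Prime) (hq2 : q ≠ 2) (c : ℤ) (hNB : N ≤ B) 
    (h0 : ∀ s : ℕ, s < N → 4 * (s : ℤ) + c ≠ 0 ∧ (4 * (s : ℤ) + c).natAbs ≤ B) :
    ∑ s ∈ Finset.range N, padicValNat q (4 * (s : ℤ) + c).natAbs ≤
      padicValNat q N.factorial + Nat.log q B := by
  haveI : Fact q.Prime := ⟨hq⟩
  set L := Nat.log q B with hL
  have h1 : ∀ s ∈ Finset.range N, padicValNat q (4 * (s : ℤ) + c).natAbs =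
      ∑ i ∈ Finset.Icc 1 L, if ((q ^ i : ℕ) : ℤ) ∣ 4 * s + c then 1 else 0 := by
    intro s hs
    obtain ⟨h2, h3⟩ := h0 s (Finset.mem_range.1 hs)
    rw [val_eq_count q L _ hq (by simpa using h2) (Nat.log_mono_right h3), Finset.card_filter]
    apply Finset.sum_congr rfl
    intro i _
    simp only [Int.natCast_dvd]
  rw [Finset.sum_congr rfl h1, Finset.sum_comm,
    padicValNat_factorial (b := L + 1) (Nat.lt_succ_of_le (Nat.log_mono_right hNB))]
  have h4 : ∀ i ∈ Finset.Icc 1 L, (∑ s ∈ Finset.range N, if ((q ^ i : ℕ) : ℤ) ∣ 4 * s + c then 1 else 0) ≤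
      N / q ^ i + 1 := by
    intro i _
    rw [← Finset.card_filter]
    exact count_res N (q ^ i) c ((hq.odd_of_ne_two hq2).pow)
  refine (Finset.sum_le_sum h4).trans ?_
  rw [Finset.sum_add_distrib]
  simp only [Finset.sum_const, Nat.card_Icc, smul_eq_mul, mul_one]
  have : Finset.Ico 1 (L + 1) = Finset.Icc 1 L := by ext; simp [Nat.lt_succ_iff]
  rw [this]; omega

lemma oddprod_fact (N : ℕ) : (∏ s ∈ Finset.range N, (2 * s + 1)) * (2 ^ N * N.factorial) = (2 * N).factorial := by
  induction N with
  | zero => simp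
  | succ N ih =>
    rw [Finset.prod_range_succ, show 2 * (N + 1) = 2 * N + 1 + 1 by ring, Nat.factorial_succ (2 * N + 1),
      Nat.factorial_succ (2 * N), ← ih, Nat.factorial_succ, pow_succ]
    ring

lemma val_P1 (q N : ℕ) (hq : q.Prime) (hq2 : q ≠ 2) :
    padicValNat q N.factorial ≤ padicValNat q (∏ s ∈ Finset.range N, (2 * s + 1)) := by
  haveI : Fact q.Prime := ⟨hq⟩
  have h1 := oddprod_fact N
  have h2 : (∏ s ∈ Finset.range N, (2 * s + 1)) * 2 ^ N = (2 * N).choose N * N.factorial := by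
    have h3 := Nat.choose_mul_factorial_mul_factorial (show N ≤ 2 * N by omega)
    rw [show 2 * N - N = N by omega, ← h1] at h3
    have : N.factorial ≠ 0 := by positivity
    apply Nat.eq_of_mul_eq_mul_right (Nat.pos_of_ne_zero this)
    linarith
  have h5 : (∏ s ∈ Finset.range N, (2 * s + 1)) ≠ 0 := Finset.prod_ne_zero_iff.2 (fun s _ => by omega)
  have h4 := congrArg (padicValNat q) h2
  rw [padicValNat.mul h5 (by positivity), padicValNat.mul (Nat.choose_pos (by omega)).ne' (by positivity),
    padicValNat.pow] at h4
  have e1 : padicValNat q 2 = 0 := padicValNat.eq_zero_of_not_dvd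
    (fun h => by have := Nat.le_of_dvd (by norm_num) h; have := hq.two_le; omega)
  rw [e1] at h4
  omega

lemma val_DD_parity (q : ℕ) [hq : Fact q.Prime] (hq2 : q ≠ 2) (N : ℕ) (u : ℤ) :
    padicValInt q (DD (2 * N) u) % 2 = (∑ s ∈ Finset.range N, padicValNat q (4 * (s : ℤ) + (2 * u + 5)).natAbs +
      padicValNat q (∏ s ∈ Finset.range N, (2 * s + 1))) % 2 := by
  have e1 : padicValNat q 2 = 0 := padicValNat.eq_zero_of_not_dvd
    (fun h => by have := Nat.le_of_dvd (by norm_num) h; have := hq.out.two_le; omega)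
  rw [val_DD, e1]
  induction N with
  | zero => simp
  | succ N ih =>
    rw [show 2 * (N + 1) = 2 * N + 1 + 1 by ring, Finset.sum_Icc_succ_top (by omega),
      Finset.sum_Icc_succ_top (by omega), Finset.sum_range_succ, Finset.prod_range_succ,
      padicValNat.mul (Finset.prod_ne_zero_iff.2 (fun s _ => by omega)) (by omega)]
    have h1 : padicValInt q (ff u (2 * N + 1 + 1)) = padicValNat q (4 * (N : ℤ) + (2 * u + 5)).natAbs := by
      unfold padicValInt ff; congr 2; push_cast; ring
    rw [h1]
    have h2 : ∀ x : ℕ, (2 * N + 1 - 1) * x = 2 * (N * x) := fun x => by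
      rw [Nat.add_sub_cancel]; ring
    have h3 : ∀ x : ℕ, (2 * N + 1) * x = 2 * (N * x) + x := fun x => by ring
    have h4 : ∀ x : ℕ, (2 * N + 1 + 1) * x = 2 * ((N + 1) * x) := fun x => by ring
    have h5 : ∀ x : ℕ, (2 * N + 1 + 1 - 1) * x = 2 * (N * x) + x := fun x => by
      rw [Nat.add_sub_cancel]; ring
    rw [h2, h2, h3, h4, h5, h5]
    omega

lemma val_DD_parity_odd (q : ℕ) [hq : Fact q.Prime] (hq2 : q ≠ 2) (N : ℕ) (u : ℤ) :
    padicValInt q (DD (2 * N + 1) u) % 2 = (padicValInt q (DD (2 * N) u) + padicValNat q (2 * N + 1)) % 2 := by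
  have e1 : padicValNat q 2 = 0 := padicValNat.eq_zero_of_not_dvd
    (fun h => by have := Nat.le_of_dvd (by norm_num) h; have := hq.out.two_le; omega)
  rw [val_DD, val_DD, e1, Finset.sum_Icc_succ_top (by omega)]
  have h2 : ∀ x : ℕ, (2 * N + 1 - 1) * x = 2 * (N * x) := fun x => by
    rw [Nat.add_sub_cancel]; ring
  have h3 : ∀ x : ℕ, (2 * N + 1) * x = 2 * (N * x) + x := fun x => by ring
  rw [h2, h2, h3]
  omega

/-- main divisibility bound -/
lemma Pc_le (N r b : ℕ) (c : ℤ) (hr : 4 * N < (r + 1) ^ 2) (hN : 1 ≤ N) (hb : b ≠ 0)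
    (h0 : ∀ s : ℕ, s < N → 4 * (s : ℤ) + c ≠ 0 ∧ (4 * (s : ℤ) + c).natAbs ≤ 4 * N)
    (hc : c % 2 = 1)
    (hval : ∀ q, q.Prime → q ≠ 2 → padicValNat q N.factorial ≤ padicValNat q b)
    (hpar : ∀ q, q.Prime → q ≠ 2 →
      (∑ s ∈ Finset.range N, padicValNat q (4 * (s : ℤ) + c).natAbs + padicValNat q b) % 2 = 0) :
    ∏ s ∈ Finset.range N, (4 * (s : ℤ) + c).natAbs ≤ b * (4 * N) ^ r := by
  classical
  set a := ∏ s ∈ Finset.range N, (4 * (s : ℤ) + c).natAbs with ha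
  have hane : ∀ s ∈ Finset.range N, (4 * (s : ℤ) + c).natAbs ≠ 0 := fun s hs => by
    simpa using (h0 s (Finset.mem_range.1 hs)).1
  have ha0 : a ≠ 0 := Finset.prod_ne_zero_iff.2 hane
  set S := (Finset.Icc 1 r).filter Nat.Prime with hS
  set d := ∏ q ∈ S, q ^ Nat.log q (4 * N) with hd
  have hd0 : d ≠ 0 := Finset.prod_ne_zero_iff.2 fun q hq =>
    pow_ne_zero _ (Finset.mem_filter.1 hq).2.ne_zero
  have hdle : d ≤ (4 * N) ^ r := by
    calc d ≤ ∏ _q ∈ S, (4 * N) := Finset.prod_le_prod' fun q _ => Nat.pow_log_le_self q (by omega)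
      _ = (4 * N) ^ S.card := by rw [Finset.prod_const]
      _ ≤ (4 * N) ^ r := Nat.pow_le_pow_right (by omega) (by
          have := Finset.card_filter_le (Finset.Icc 1 r) Nat.Prime
          simpa using this)
  have hdvd : a ∣ b * d := by
    rw [← Nat.factorization_prime_le_iff_dvd ha0 (mul_ne_zero hb hd0)]
    intro q hq
    haveI : Fact q.Prime := ⟨hq⟩
    rw [Nat.factorization_def _ hq, Nat.factorization_def _ hq, padicValNat.mul hb hd0]
    have hva : padicValNat q a = ∑ s ∈ Finset.range N, padicValNat q (4 * (s : ℤ) + c).natAbs := by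
      have := Nat.factorization_prod hane
      have := congrArg (fun f => f q) this
      rw [Nat.factorization_def _ hq, Finsupp.finsetSum_apply] at this
      rw [ha, this]
      exact Finset.sum_congr rfl fun s _ => Nat.factorization_def _ hq
    by_cases hq2 : q = 2
    · subst hq2
      rw [hva, Finset.sum_eq_zero]
      · omega
      · intro s _
        exact padicValNat.eq_zero_of_not_dvd (by omega)
    have h1 := val_Pc q N (4 * N) hq hq2 c (by omega) h0
    have h2 := hval q hq hq2
    have h3 := hpar q hq hq2
    rw [← hva] at h1 h3
    by_cases hqr : q ≤ r
    · have : Nat.log q (4 * N) ≤ padicValNat q d := by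
        rw [← padicValNat_dvd_iff_le hd0]
        exact Finset.dvd_prod_of_mem (fun q => q ^ Nat.log q (4 * N))
          (Finset.mem_filter.2 ⟨Finset.mem_Icc.2 ⟨hq.one_lt.le, hqr⟩, hq⟩)
      omega
    · have : Nat.log q (4 * N) ≤ 1 := by
        have : Nat.log q (4 * N) < 2 := Nat.log_lt_of_lt_pow (by omega)
          (hr.trans_le (Nat.pow_le_pow_left (by omega) 2))
        omega
      omega
  exact (Nat.le_of_dvd (Nat.pos_of_ne_zero (mul_ne_zero hb hd0)) hdvd).trans (Nat.mul_le_mul_left b hdle)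

/-- lower bound of the product of the odd factors -/
lemma Pc_lower (M : ℕ) (u : ℤ) (hu1 : -18 ≤ u) :
    2 ^ M * ∏ s ∈ Finset.range M, (2 * s + 1) ≤
      ∏ s ∈ Finset.range (M + 9), (4 * (s : ℤ) + (2 * u + 5)).natAbs := by
  induction M with
  | zero =>
    have : ∀ s ∈ Finset.range (0 + 9), 1 ≤ (4 * (s : ℤ) + (2 * u + 5)).natAbs := fun s _ => by omega
    simpa using Finset.one_le_prod'' (f := fun s : ℕ => (4 * (s : ℤ) + (2 * u + 5)).natAbs) (s := Finset.range (0 + 9)) (fun s => by omega)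
  | succ M ih =>
    rw [Finset.prod_range_succ, show M + 1 + 9 = M + 9 + 1 by ring, Finset.prod_range_succ _ (M + 9), pow_succ]
    have : 2 * (2 * M + 1) ≤ (4 * ((M + 9 : ℕ) : ℤ) + (2 * u + 5)).natAbs := by omega
    calc _ = (2 ^ M * ∏ s ∈ Finset.range M, (2 * s + 1)) * (2 * (2 * M + 1)) := by ring
      _ ≤ _ := Nat.mul_le_mul ih this

lemma P1_upper (M e B : ℕ) (hB : 2 * (M + e) ≤ B) :
    ∏ s ∈ Finset.range (M + e), (2 * s + 1) ≤ (∏ s ∈ Finset.range M, (2 * s + 1)) * B ^ e := by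
  induction e with
  | zero => simp
  | succ e ih =>
    rw [← add_assoc, Finset.prod_range_succ, pow_succ, ← mul_assoc]
    exact Nat.mul_le_mul (ih (by omega)) (by omega)

lemma numeric (N r : ℕ) (hr1 : r ^ 2 ≤ 4 * N) (hr : 4 * N < (r + 1) ^ 2) (hr100 : 100 ≤ r) :
    (4 * N) ^ (r + 10) < 2 ^ (N - 9) := by
  have h1 : ∀ t, 10 ≤ t → 10 * t + 10 ≤ 2 ^ t := by
    intro t ht
    induction t, ht using Nat.le_induction with
    | base => norm_num
    | succ t ht ih => rw [pow_succ]; omega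
  set t := r / 10 with ht
  have h2 := h1 t (by omega)
  have h3 : r + 1 ≤ 2 ^ t := by omega
  calc (4 * N) ^ (r + 10) ≤ ((r + 1) ^ 2) ^ (r + 10) := Nat.pow_le_pow_left hr.le _
    _ ≤ ((2 ^ t) ^ 2) ^ (r + 10) := Nat.pow_le_pow_left (Nat.pow_le_pow_left h3 2) _
    _ = 2 ^ (t * 2 * (r + 10)) := by rw [← pow_mul, ← pow_mul, mul_assoc]
    _ < 2 ^ (N - 9) := by
      apply Nat.pow_lt_pow_right (by norm_num)
      have h4 : 10 * t ≤ r := by omega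
      have h5 : 10 * t * (2 * (r + 10)) ≤ r * (2 * (r + 10)) := Nat.mul_le_mul_right _ h4
      have h6 : 10 * (t * 2 * (r + 10) + 9) < 10 * N := by nlinarith
      omega

theorem nonsq_large (n : ℕ) (u : ℤ) (hu1 : -18 ≤ u) (hu2 : u ≤ -2) (hn : 5002 ≤ n) :
    ¬ IsSquare (DD n u) := by
  intro hs
  set N := n / 2 with hN
  have hNn : n = 2 * N ∨ n = 2 * N + 1 := by omega
  have hN5 : 2501 ≤ N := by omega
  clear_value N
  set r := Nat.sqrt (4 * N) with hr
  have hr1 : r ^ 2 ≤ 4 * N := Nat.sqrt_le' _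
  have hr2 : 4 * N < (r + 1) ^ 2 := Nat.lt_succ_sqrt' _
  have hr3 : 100 ≤ r := Nat.le_sqrt.2 (by omega)
  clear_value r
  set P := ∏ s ∈ Finset.range N, (2 * s + 1) with hP
  have hP0 : P ≠ 0 := Finset.prod_ne_zero_iff.2 (fun s _ => by omega)
  obtain ⟨b, hb0, hb1, hval, hpar⟩ : ∃ b, b ≠ 0 ∧ b ≤ P * (4 * N) ∧
      (∀ q, q.Prime → q ≠ 2 → padicValNat q N.factorial ≤ padicValNat q b) ∧
      (∀ q, q.Prime → q ≠ 2 → (∑ s ∈ Finset.range N, padicValNat q (4 * (s : ℤ) + (2 * u + 5)).natAbs +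
        padicValNat q b) % 2 = 0) := by
    rcases hNn with h | h
    · refine ⟨P, hP0, Nat.le_mul_of_pos_right _ (by omega), fun q hq hq2 => val_P1 q N hq hq2, ?_⟩
      intro q hq hq2
      haveI : Fact q.Prime := ⟨hq⟩
      have h1 := val_even_of_square q _ (DD_ne n u) hs
      have h2 := val_DD_parity q hq2 N u
      rw [h] at h1
      rw [← h2]; omega
    · refine ⟨P * (2 * N + 1), mul_ne_zero hP0 (by omega), Nat.mul_le_mul_left _ (by omega), ?_, ?_⟩
      · intro q hq hq2
        haveI : Fact q.Prime := ⟨hq⟩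
        rw [padicValNat.mul hP0 (by omega)]
        have := val_P1 q N hq hq2
        rw [← hP] at this
        omega
      · intro q hq hq2
        haveI : Fact q.Prime := ⟨hq⟩
        have h1 := val_even_of_square q _ (DD_ne n u) hs
        have h2 := val_DD_parity q hq2 N u
        have h3 := val_DD_parity_odd q hq2 N u
        rw [h] at h1
        rw [← hP] at h2
        rw [padicValNat.mul hP0 (by omega)]
        omega
  have h1 := Pc_le N r b (2 * u + 5) hr2 (by omega) hb0 (fun s hs => ⟨by omega, by omega⟩) (by omega) hval hpar
  obtain ⟨M, rfl⟩ : ∃ M, N = M + 9 := ⟨N - 9, by omega⟩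
  have h2 := Pc_lower M u hu1
  have h3 := P1_upper M 9 (4 * (M + 9)) (by omega)
  have h4 := numeric (M + 9) r hr1 hr2 hr3
  rw [Nat.add_sub_cancel] at h4
  rw [← hP] at h3
  set R := ∏ s ∈ Finset.range M, (2 * s + 1) with hR
  have hR0 : 0 < R := Finset.prod_pos (fun s _ => by omega)
  set B := 4 * (M + 9) with hB
  have h5 : 2 ^ M * R ≤ R * B ^ (r + 10) := by
    calc 2 ^ M * R ≤ b * B ^ r := h2.trans h1
      _ ≤ (P * B) * B ^ r := Nat.mul_le_mul_right _ hb1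
      _ ≤ (R * B ^ 9 * B) * B ^ r := Nat.mul_le_mul_right _ (Nat.mul_le_mul_right _ h3)
      _ = R * B ^ (r + 10) := by ring
  have h6 : 2 ^ M ≤ B ^ (r + 10) := Nat.le_of_mul_le_mul_left (by linarith) hR0
  omega

lemma nonsq_mid (n : ℕ) (u : ℤ) (hu1 : -18 ≤ u) (hu2 : u ≤ -2) (hn : 74 ≤ n) (hn2 : n ≤ 5001) :
    ¬ IsSquare (DD n u) := by
  have key : ∀ q : ℕ, q.Prime → n < q → (q : ℤ) ≤ 2 * n - 35 → ((q : ℤ) - (2 * u + 1)) % 4 = 0 →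
      ¬ IsSquare (DD n u) := fun q hq h1 h2 h3 =>
    nonsq_prime n q u hq hu1 hu2 (by omega) h1 (by omega) h3
  rcases Int.even_or_odd u with ⟨t, ht⟩ | ⟨t, ht⟩
  · by_cases h1 : n < 113
    · exact key 113 (by norm_num) (by omega) (by omega) (by omega)
    by_cases h2 : n < 181
    · exact key 181 (by norm_num) (by omega) (by omega) (by omega)
    by_cases h3 : n < 317
    · exact key 317 (by norm_num) (by omega) (by omega) (by omega)
    by_cases h4 : n < 593
    · exact key 593 (by norm_num) (by omega) (by omega) (by omega)
    by_cases h5 : n < 1129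
    · exact key 1129 (by norm_num) (by omega) (by omega) (by omega)
    by_cases h6 : n < 2221
    · exact key 2221 (by norm_num) (by omega) (by omega) (by omega)
    by_cases h7 : n < 4397
    · exact key 4397 (by norm_num) (by omega) (by omega) (by omega)
    exact key 8753 (by norm_num) (by omega) (by omega) (by omega)
  · by_cases h1 : n < 107
    · exact key 107 (by norm_num) (by omega) (by omega) (by omega)
    by_cases h2 : n < 179
    · exact key 179 (by norm_num) (by omega) (by omega) (by omega)
    by_cases h3 : n < 311
    · exact key 311 (by norm_num) (by omega) (by omega) (by omega)
    by_cases h4 : n < 587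
    · exact key 587 (by norm_num) (by omega) (by omega) (by omega)
    by_cases h5 : n < 1123
    · exact key 1123 (by norm_num) (by omega) (by omega) (by omega)
    by_cases h6 : n < 2207
    · exact key 2207 (by norm_num) (by omega) (by omega) (by omega)
    by_cases h7 : n < 4363
    · exact key 4363 (by norm_num) (by omega) (by omega) (by omega)
    exact key 8663 (by norm_num) (by omega) (by omega) (by omega)

def vDD (q n : ℕ) (u : ℤ) : ℕ := ((List.range n).map fun j =>
  j * pv q 20 2 + (j + 1) * pv q 20 (j + 1) + j * pv q 20 (ff u (j + 1)).natAbs).sum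

lemma vDD_eq (q : ℕ) [hq : Fact q.Prime] (n : ℕ) (u : ℤ) (hu1 : -1000 ≤ u) (hu2 : u ≤ 1000) (hn : n ≤ 1000) :
    vDD q n u = padicValInt q (DD n u) := by
  rw [val_DD]
  unfold vDD
  induction n with
  | zero => simp
  | succ n ih =>
    rw [List.range_succ, List.map_append, List.sum_append, ih (by omega), Finset.sum_Icc_succ_top (by omega)]
    have h1 : pv q 20 2 = padicValNat q 2 := pv_eq q 20 2 (by norm_num) (by norm_num)
    have h2 : pv q 20 (n + 1) = padicValNat q (n + 1) := pv_eq q 20 (n + 1) (by omega) (by norm_num; omega)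
    have h3 : pv q 20 (ff u (n + 1)).natAbs = padicValInt q (ff u (n + 1)) :=
      pv_eq q 20 _ (by simpa using ff_ne u (n + 1)) (by unfold ff; norm_num; omega)
    simp [h1, h2, h3]

def negL : List (ℕ × ℕ) := [(4, 2), (4, 1), (12, 6), (12, 5), (20, 10), (20, 9), (28, 14), (28, 13)]

def oddFind (n b : ℕ) : Bool :=
  [2, 3, 5, 7, 11, 13, 17, 19, 23, 29, 31, 43].any fun q =>
    Nat.beq (vDD q n (-(b + 2 : ℕ)) % 2) 1

lemma oddFind_all : ∀ n, n < 72 → ∀ b, b < 17 →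
    (excL.contains (n + 2, b) || negL.contains (n + 2, b) || oddFind (n + 2) b) = true := by decide +kernel

lemma DD_neg : ∀ x ∈ negL, DD x.1 (-(x.2 + 2 : ℕ)) < 0 := by
  unfold DD ff negL
  decide +kernel

theorem nonsq_all (n : ℕ) (u : ℤ) (hn : 2 ≤ n) (hu1 : -18 ≤ u) (hu2 : u ≤ -2)
    (hE : ((n : ℤ), u) ∉ exceptionalSet) : ¬ IsSquare (DD n u) := by
  by_cases h1 : 5002 ≤ n
  · exact nonsq_large n u hu1 hu2 h1
  by_cases h2 : 74 ≤ n
  · exact nonsq_mid n u hu1 hu2 h2 (by omega)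
  obtain ⟨a, ha, rfl⟩ : ∃ a : ℕ, a < 17 ∧ u = -((a + 2 : ℕ) : ℤ) := ⟨(-u - 2).toNat, by omega, by omega⟩
  have h := oddFind_all (n - 2) (by omega) a ha
  rw [Nat.sub_add_cancel hn, Bool.or_eq_true, Bool.or_eq_true] at h
  rcases h with (h | h) | h
  · exact absurd (exc_of n a h) hE
  · have := DD_neg (n, a) (by simpa using h)
    intro hs
    exact absurd hs.nonneg (by simpa using this)
  · unfold oddFind at h
    rw [List.any_eq_true] at h
    obtain ⟨q, hq, h⟩ := h
    have hqq : q.Prime := by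
      have : ∀ q ∈ [2, 3, 5, 7, 11, 13, 17, 19, 23, 29, 31, 43], q.Prime := by
        intro q hq; fin_cases hq <;> norm_num
      exact this q hq
    haveI : Fact q.Prime := ⟨hqq⟩
    intro hs
    have h3 := val_even_of_square q _ (DD_ne n _) hs
    rw [← vDD_eq q n _ (by omega) (by omega) (by omega)] at h3
    have h4 : vDD q n (-((a + 2 : ℕ) : ℤ)) % 2 = 1 := by simpa using h
    omega

section Frob
open NumberField IsDedekindDomain

theorem exists_frob (L : Type*) [Field L] [NumberField L] [IsGalois ℚ L] (q : ℕ) [hq : Fact q.Prime] :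
    ∃ (P : Ideal (𝓞 L)) (σ : L ≃ₐ[ℚ] L), P.IsPrime ∧ (∀ c : ℤ, (c : 𝓞 L) ∈ P ↔ (q : ℤ) ∣ c) ∧
      (∀ x : 𝓞 L, σ • x - x ^ q ∈ P) ∧
      (∀ x : 𝓞 L, x ^ q - x ∈ P → ∃ r : ℕ, r < q ∧ x - (r : 𝓞 L) ∈ P) := by
  have hqp : Prime (q : ℤ) := Nat.prime_iff_prime_int.1 hq.out
  have hq0 : (q : ℤ) ≠ 0 := hqp.ne_zero
  let v : Ideal ℤ := Ideal.span {(q : ℤ)}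
  have hv : v.IsPrime := (Ideal.span_singleton_prime hq0).2 hqp
  have hvb : v ≠ ⊥ := by simp [v, hq.out.ne_zero]
  obtain ⟨P, hP⟩ := (inferInstance : Nonempty (Ideal.primesOver v (𝓞 L)))
  have hPp : P.IsPrime := hP.1
  have hPl : P.LiesOver v := hP.2
  have hPb : P ≠ ⊥ := Ideal.ne_bot_of_liesOver_of_ne_bot hvb P
  have hPm : P.IsMaximal := hPp.isMaximal hPb
  have hund : P.under ℤ = v := hPl.over.symm
  have hmem : ∀ c : ℤ, (c : 𝓞 L) ∈ P ↔ (q : ℤ) ∣ c := by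
    intro c
    have : c ∈ P.under ℤ ↔ (q : ℤ) ∣ c := by rw [hund]; exact Ideal.mem_span_singleton
    rw [← this, Ideal.mem_comap]; simp
  have hfin : Finite (𝓞 L ⧸ P) := Ideal.finiteQuotientOfFreeOfNeBot P hPb
  obtain ⟨σ, hσ⟩ := IsArithFrobAt.exists_of_isInvariant ℤ (L ≃ₐ[ℚ] L) P
  have hcard : Nat.card (ℤ ⧸ P.under ℤ) = q := by
    rw [hund, Nat.card_congr (Int.quotientSpanNatEquivZMod q).toEquiv, Nat.card_zmod]
  refine ⟨P, σ, hPp, hmem, ?_, ?_⟩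
  · intro x
    have := hσ x
    rw [hcard] at this
    exact this
  · intro x hx
    letI := Ideal.Quotient.field P
    haveI : CharP (𝓞 L ⧸ P) q := by
      refine ⟨fun c => ?_⟩
      have := hmem c
      rw [Int.cast_natCast, Int.natCast_dvd_natCast] at this
      rw [← this, ← Ideal.Quotient.eq_zero_iff_mem]; simp
    have h1 : (Ideal.Quotient.mk P x) ^ q = Ideal.Quotient.mk P x := by
      rw [← map_pow]; exact Ideal.Quotient.eq.2 hx
    rw [← Subfield.mem_bot_iff_pow_eq_self (𝓞 L ⧸ P) q, ← ZMod.fieldRange_castHom_eq_bot q] at h1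
    obtain ⟨z, hz⟩ := h1
    refine ⟨z.val, z.val_lt, ?_⟩
    rw [← Ideal.Quotient.eq, ← hz, map_natCast]
    simp [ZMod.castHom_apply, ZMod.natCast_val]

open scoped Classical in
theorem frob_count (L : Type*) [Field L] [NumberField L] [IsGalois ℚ L] (F : ℤ[X]) (hF : F.Monic)
    (q : ℕ) [hq : Fact q.Prime] (S : Finset ℕ) (hS0 : ∀ r ∈ S, r < q)
    (hS : ∀ r < q, (q : ℤ) ∣ F.eval (r : ℤ) ↔ r ∈ S)
    (hS2 : ∀ r ∈ S, ¬ (q : ℤ) ∣ (derivative F).eval (r : ℤ))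
    (hsplit : (F.map (Int.castRingHom L)).Splits) :
    ∃ σ : L ≃ₐ[ℚ] L, ((F.map (Int.castRingHom L)).roots.toFinset.filter (fun x => σ x = x)).card = S.card := by
  obtain ⟨P, σ, hP, hmem, hσ, hfp⟩ := exists_frob L q
  refine ⟨σ, ?_⟩
  set FL := F.map (Int.castRingHom L) with hFL
  set FO := F.map (Int.castRingHom (𝓞 L)) with hFO
  have hFLm : FL.Monic := hF.map _
  have hroot : ∀ x ∈ FL.roots, ∃ y : 𝓞 L, (y : L) = x := by
    intro x hx
    have : IsIntegral ℤ x := ⟨F, hF, by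
      have := (mem_roots hFLm.ne_zero).1 hx
      rw [IsRoot, hFL, eval_map] at this
      simpa using this⟩
    exact ⟨⟨x, this⟩, rfl⟩
  have hcomp : (Int.castRingHom L) = (algebraMap (𝓞 L) L).comp (Int.castRingHom (𝓞 L)) := by
    ext; simp
  have hev : ∀ y : 𝓞 L, (y : L) ∈ FL.roots ↔ FO.eval y = 0 := by
    intro y
    rw [mem_roots hFLm.ne_zero, IsRoot, hFL, hcomp, ← Polynomial.map_map, ← hFO]
    rw [show (y : L) = algebraMap (𝓞 L) L y from rfl, eval_map_apply]
    simp
  -- evaluation congruence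
  have hcong : ∀ (H : ℤ[X]) (y : 𝓞 L) (r : ℕ), y - (r : 𝓞 L) ∈ P →
      ((H.map (Int.castRingHom (𝓞 L))).eval y ∈ P ↔ (q : ℤ) ∣ H.eval (r : ℤ)) := by
    intro H y r hy
    rw [← hmem]
    have h1 : ((H.eval (r : ℤ) : ℤ) : 𝓞 L) = (H.map (Int.castRingHom (𝓞 L))).eval (r : 𝓞 L) := by
      rw [eval_natCast_map]; rfl
    have h2 := P.mem_of_dvd (sub_dvd_eval_sub y (r : 𝓞 L) (H.map (Int.castRingHom (𝓞 L)))) hy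
    rw [h1]
    constructor
    · intro h; have := P.sub_mem h h2; simpa using this
    · intro h; have := P.add_mem h2 h; simpa using this
  -- uniqueness
  have huniq : ∀ (y y' : 𝓞 L) (r : ℕ), r ∈ S → FO.eval y = 0 → FO.eval y' = 0 → y - (r : 𝓞 L) ∈ P →
      y' - (r : 𝓞 L) ∈ P → y = y' := by
    intro y y' r hr h1 h2 h3 h4
    by_contra hne
    obtain ⟨A, hA⟩ := dvd_iff_isRoot.2 h1
    have hA2 : A.eval y' = 0 := by
      rw [hA] at h2
      simp only [eval_mul, eval_sub, eval_X, eval_C] at h2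
      exact (mul_eq_zero.1 h2).resolve_left (sub_ne_zero.2 (Ne.symm hne))
    have hd : (derivative FO).eval y = A.eval y := by
      rw [hA]; simp
    have h5 : A.eval y ∈ P := by
      have h6 : y - y' ∈ P := by have := P.sub_mem h3 h4; simpa using this
      have := P.mem_of_dvd (sub_dvd_eval_sub y y' A) h6
      rwa [hA2, sub_zero] at this
    rw [← hd, hFO, derivative_map, hcong _ y r h3] at h5
    exact hS2 r hr h5
  -- existence
  have hex : ∀ r ∈ S, ∃ y : 𝓞 L, FO.eval y = 0 ∧ y - (r : 𝓞 L) ∈ P := by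
    intro r hr
    have h1 : (q : ℤ) ∣ F.eval (r : ℤ) := (hS r (hS0 r hr)).2 hr
    have h2 : FO.eval (r : 𝓞 L) ∈ P := (hcong F (r : 𝓞 L) r (by simp)).2 h1
    by_contra hc
    push Not at hc
    choose! g hg using hroot
    have h3 : FO = ((FL.roots.map g).map (fun a => X - C a)).prod := by
      apply map_injective (algebraMap (𝓞 L) L) (FaithfulSMul.algebraMap_injective _ _)
      rw [hFO, Polynomial.map_map, ← hcomp, ← hFL, Polynomial.map_multiset_prod, Multiset.map_map, Multiset.map_map]
      conv_lhs => rw [hsplit.eq_prod_roots_of_monic hFLm]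
      congr 1
      apply Multiset.map_congr rfl
      intro x hx
      have := hg x hx
      simp [this]
    rw [h3, eval_multiset_prod, Multiset.map_map, Multiset.map_map, hP.multiset_prod_mem_iff_exists_mem] at h2
    obtain ⟨w, hw, h4⟩ := h2
    obtain ⟨x, hx, rfl⟩ := Multiset.mem_map.1 hw
    simp only [Function.comp_apply, eval_sub, eval_X, eval_C] at h4
    refine hc (g x) ?_ (by have := P.neg_mem h4; simpa using this)
    rw [← hev, hg x hx]; exact hx
  choose! y hy using hex
  have hσroot : ∀ z : 𝓞 L, FO.eval z = 0 → FO.eval (σ • z) = 0 := by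
    intro z hz
    rw [← hev] at hz ⊢
    rw [mem_roots hFLm.ne_zero, IsRoot, hFL, eval_map] at hz ⊢
    have : ((σ • z : 𝓞 L) : L) = σ (z : L) := rfl
    rw [this]
    have h2 := congrArg σ hz
    rw [map_zero, ← RingHom.coe_coe, hom_eval₂] at h2
    rwa [show (σ : L →+* L).comp (Int.castRingHom L) = Int.castRingHom L from RingHom.ext_int _ _] at h2
  symm
  refine Finset.card_bij (fun r _ => (y r : L)) ?_ ?_ ?_
  · intro r hr
    obtain ⟨h1, h2⟩ := hy r hr
    rw [Finset.mem_filter, Multiset.mem_toFinset]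
    refine ⟨(hev _).2 h1, ?_⟩
    have h3 : σ • y r = y r := by
      refine huniq _ _ r hr (hσroot _ h1) h1 ?_ h2
      have h4 := hσ (y r)
      have h5 : y r ^ q - (r : 𝓞 L) ^ q ∈ P := P.mem_of_dvd (sub_dvd_pow_sub_pow _ _ _) h2
      have h6 : (r : 𝓞 L) ^ q - (r : 𝓞 L) ∈ P := by
        have : (((r : ℤ) ^ q - r : ℤ) : 𝓞 L) ∈ P := by
          rw [hmem, ← ZMod.intCast_eq_intCast_iff_dvd_sub]
          simp
        simpa using this
      have := P.add_mem (P.add_mem h4 h5) h6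
      simpa using this
    have : ((σ • y r : 𝓞 L) : L) = σ (y r : L) := rfl
    rw [← this, h3]
  · intro r hr r' hr' h
    have h1 : y r = y r' := by exact_mod_cast h
    have h2 := (hy r hr).2
    rw [h1] at h2
    have h3 := P.sub_mem (hy r' hr').2 h2
    have h4 : ((r - r' : ℤ) : 𝓞 L) ∈ P := by simpa using h3
    rw [hmem] at h4
    have := hS0 r hr
    have := hS0 r' hr'
    have := Int.eq_zero_of_abs_lt_dvd h4 (by rw [abs_lt]; constructor <;> omega)
    omega
  · intro x hx
    rw [Finset.mem_filter, Multiset.mem_toFinset] at hx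
    obtain ⟨z, rfl⟩ := hroot x hx.1
    have hz := (hev z).1 hx.1
    have h3 : σ • z = z := by
      apply RingOfIntegers.ext
      exact hx.2
    have h4 := hσ z
    rw [h3] at h4
    obtain ⟨r, hr, h5⟩ := hfp z (by have := P.neg_mem h4; simpa using this)
    have h6 : r ∈ S := by
      rw [← hS r hr, ← hcong F z r h5, ← hFO, hz]; exact P.zero_mem
    refine ⟨r, h6, ?_⟩
    rw [huniq z (y r) r h6 hz (hy r h6).1 h5 (hy r h6).2]
end Frob

section Frob2
open scoped Classical

lemma numberField_frob_transfer (k : ℕ) (L : Type*) [Field L] [NumberField L] [alg : Algebra ℚ L]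
    (Q : ℚ[X]) (T : Finset L) (h : ∀ (_ : @IsGalois ℚ _ L _ DivisionRing.toRatAlgebra)
      (_ : (Q.map (@algebraMap ℚ L _ _ DivisionRing.toRatAlgebra)).Splits),
      ∃ σ : (@AlgEquiv ℚ L L _ _ _ DivisionRing.toRatAlgebra DivisionRing.toRatAlgebra),
        (T.filter (fun x => σ x = x)).card = k)
    (hG : @IsGalois ℚ _ L _ alg) (hs : (Q.map (@algebraMap ℚ L _ _ alg)).Splits) :
    ∃ σ : (@AlgEquiv ℚ L L _ _ _ alg alg), (T.filter (fun x => σ x = x)).card = k := by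
  obtain rfl : alg = DivisionRing.toRatAlgebra := Subsingleton.elim _ _
  exact h hG hs

theorem frob_gal (F : ℤ[X]) (hF : F.Monic)
    (q : ℕ) [hq : Fact q.Prime] (S : Finset ℕ) (hS0 : ∀ r ∈ S, r < q)
    (hS : ∀ r < q, (q : ℤ) ∣ F.eval (r : ℤ) ↔ r ∈ S)
    (hS2 : ∀ r ∈ S, ¬ (q : ℤ) ∣ (derivative F).eval (r : ℤ))
    (Q : ℚ[X]) (hQ : Q = F.map (Int.castRingHom ℚ)) (hsep : Q.Separable) :
    ∃ σ : Q.Gal, ((Q.map (algebraMap ℚ Q.SplittingField)).roots.toFinset.filter (fun x => σ x = x)).card = S.card := by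
  have : NumberField Q.SplittingField :=
    { to_charZero := inferInstance, to_finiteDimensional := inferInstance }
  refine numberField_frob_transfer (alg := SplittingField.instAlgebra_1 Q) S.card Q.SplittingField Q _
    (fun _ hs => ?_) (@IsGalois.of_separable_splitting_field ℚ _ Q.SplittingField _
      (SplittingField.instAlgebra_1 Q) Q (IsSplittingField.splittingField Q) hsep) (SplittingField.splits Q)
  have e1 : ∀ f : ℚ →+* Q.SplittingField, Q.map f = F.map (Int.castRingHom _) := by
    intro f
    have h0 := congrArg (Polynomial.map f) hQ
    rw [Polynomial.map_map] at h0
    rw [h0]; congr 1; exact RingHom.ext_int _ _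
  obtain ⟨σ, hσ⟩ := frob_count Q.SplittingField F hF q S hS0 hS hS2 (by rw [e1] at hs; exact hs)
  refine ⟨σ, ?_⟩
  rw [e1]
  convert hσ

lemma gal_full2_aux (n : ℕ) (u : ℤ) (hn : 1 ≤ n) (k : ℕ) (hirr : Irreducible (QQ n u))
    (E : Type*) [Field E] [CharZero E] [Algebra ℚ E]
    [hE : IsSplittingField ℚ E (QQ n u)] [Fact ((QQ n u).map (algebraMap ℚ E)).Splits]
    (hσ : ∃ σ : (QQ n u).Gal, (((QQ n u).map (algebraMap ℚ (QQ n u).SplittingField)).roots.toFinset.filter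
      (fun x => σ x = x)).card = k)
    (hA : ∀ (G : Subgroup (Equiv.Perm (Fin n))), MulAction.IsPretransitive G (Fin n) →
      Nat.card G = Nat.card (QQ n u).Gal → (∃ g ∈ G, Equiv.Perm.sign g ≠ 1) →
      (∃ g ∈ G, g.support.card + k = n) → G = ⊤)
    (hD : ¬ IsSquare (DD n u)) : Nonempty ((QQ n u).Gal ≃* Equiv.Perm (Fin n)) := by
  obtain ⟨σ, hσ1⟩ := exists_odd n u hn hirr E hD
  obtain ⟨τ, hτ⟩ := hσ
  have hcard : Fintype.card ((QQ n u).rootSet E) = n := by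
    exact (card_rootSet_eq_natDegree hirr.separable Fact.out).trans (QQ_natDegree n u)
  let e : (QQ n u).rootSet E ≃ Fin n := Fintype.equivFinOfCardEq hcard
  let f : (QQ n u).Gal →* Equiv.Perm (Fin n) :=
    (e.permCongrHom : Equiv.Perm ((QQ n u).rootSet E) ≃* Equiv.Perm (Fin n)).toMonoidHom.comp
      (Gal.galActionHom (QQ n u) E)
  have hf : Function.Injective f :=
    e.permCongrHom.injective.comp (Gal.galActionHom_injective (QQ n u) E)
  have hfa : ∀ (g : (QQ n u).Gal) x, f g x = e (g • e.symm x) := fun g x => rfl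
  have htr := Gal.galAction_isPretransitive (QQ n u) E hirr
  have htop : f.range = ⊤ := by
    apply hA
    · refine ⟨fun x y => ?_⟩
      obtain ⟨g, hg⟩ := htr.exists_smul_eq (e.symm x) (e.symm y)
      refine ⟨⟨f g, g, rfl⟩, ?_⟩
      change f g x = y
      rw [hfa, hg]; simp
    · exact (Nat.card_congr (MonoidHom.ofInjective hf).toEquiv).symm
    · refine ⟨f σ, ⟨σ, rfl⟩, ?_⟩
      have : Equiv.Perm.sign (f σ) = Equiv.Perm.sign (Gal.galActionHom (QQ n u) E σ) :=
        Equiv.Perm.sign_permCongr e _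
      rw [this]; exact hσ1
    · refine ⟨f τ, ⟨τ, rfl⟩, ?_⟩
      let e0 : (QQ n u).rootSet (QQ n u).SplittingField ≃ Fin n :=
        (Gal.rootsEquivRoots (QQ n u) E).trans e
      have hf0 : ∀ i, f τ i = i ↔ τ ((e0.symm i : (QQ n u).rootSet (QQ n u).SplittingField) : (QQ n u).SplittingField) =
          (e0.symm i : (QQ n u).rootSet (QQ n u).SplittingField) := by
        intro i
        have h1 : f τ i = e0 (τ • e0.symm i) := rfl
        rw [h1, ← Equiv.eq_symm_apply, Subtype.ext_iff]
        rfl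
      have hfix : (Finset.univ.filter (fun i => f τ i = i)).card = k := by
        rw [← hτ]
        refine Finset.card_bij (fun i _ => ((e0.symm i : (QQ n u).rootSet (QQ n u).SplittingField) : (QQ n u).SplittingField)) ?_ ?_ ?_
        · intro i hi
          rw [Finset.mem_filter] at hi ⊢
          refine ⟨?_, (hf0 i).1 hi.2⟩
          have := (e0.symm i).2
          simpa [rootSet, aroots] using this
        · intro i _ j _ h
          exact e0.symm.injective (Subtype.ext h)
        · intro x hx
          rw [Finset.mem_filter] at hx
          have hx1 : x ∈ (QQ n u).rootSet (QQ n u).SplittingField := by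
            simpa [rootSet, aroots] using hx.1
          refine ⟨e0 ⟨x, hx1⟩, ?_, by simp⟩
          rw [Finset.mem_filter, hf0]
          simpa using hx.2
      have h3 : (f τ).support = Finset.univ.filter (fun i => ¬ f τ i = i) := by
        ext i; simp
      have h4 := Finset.card_filter_add_card_filter_not (s := (Finset.univ : Finset (Fin n))) (fun i => f τ i = i)
      rw [Finset.card_univ, Fintype.card_fin] at h4
      rw [h3, ← hfix, add_comm]
      convert h4
  exact ⟨MulEquiv.ofBijective f ⟨hf, MonoidHom.range_eq_top.1 htop⟩⟩

lemma gal_full2 (n : ℕ) (u : ℤ) (hn : 1 ≤ n) (k : ℕ) (hirr : Irreducible (QQ n u))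
    (hσ : ∃ σ : (QQ n u).Gal, (((QQ n u).map (algebraMap ℚ (QQ n u).SplittingField)).roots.toFinset.filter
      (fun x => σ x = x)).card = k)
    (hA : ∀ (G : Subgroup (Equiv.Perm (Fin n))), MulAction.IsPretransitive G (Fin n) →
      Nat.card G = Nat.card (QQ n u).Gal → (∃ g ∈ G, Equiv.Perm.sign g ≠ 1) →
      (∃ g ∈ G, g.support.card + k = n) → G = ⊤)
    (hD : ¬ IsSquare (DD n u)) : Nonempty ((QQ n u).Gal ≃* Equiv.Perm (Fin n)) :=
  @gal_full2_aux n u hn k hirr (QQ n u).SplittingField _ inferInstance (SplittingField.instAlgebra_1 _)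
    (IsSplittingField.splittingField _) ⟨SplittingField.splits _⟩ hσ hA hD
end Frob2

def evG (n : ℕ) (u : ℤ) (r : ℕ) : ℤ := ((List.range (n + 1)).map fun j => cc n u j * (r : ℤ) ^ j).sum
def evD (n : ℕ) (u : ℤ) (r : ℕ) : ℤ := ((List.range (n + 1)).map fun j => cc n u j * ((j : ℤ) * (r : ℤ) ^ (j - 1))).sum

def frobS (n : ℕ) (u : ℤ) (q : ℕ) : List ℕ := (List.range q).filter fun r => decide (evG n u r % q = 0)

def frobChk (n : ℕ) (u : ℤ) (q k : ℕ) : Bool :=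
  Nat.beq (frobS n u q).length k && (frobS n u q).all fun r => decide (evD n u r % q ≠ 0)

def frobTab : List (List ℕ) := [
  [5, 5, 11, 11, 13, 5, 5, 29, 7, 23, 5, 5, 11, 7, 11, 5, 5],
  [7, 5, 5, 7, 19, 11, 5, 5, 19, 11, 7, 5, 5, 29, 7, 13, 5],
  [13, 29, 29, 13, 17, 11, 17, 17, 19, 19, 73, 13, 41, 13, 29, 19, 11],
  [101, 37, 83, 79, 53, 199, 31, 79, 17, 157, 41, 23, 29, 41, 43, 31, 131],
  [643, 379, 233, 617, 79, 257, 31, 97, 97, 317, 43, 53, 547, 109, 29, 373, 379]]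

def frobP (m b : ℕ) : ℕ := (frobTab.getD m []).getD b 0

lemma frob_all : ∀ m, m < 5 → ∀ b, b < 17 →
    (frobChk (m + 3) (-(b + 2 : ℕ)) (frobP m b) m ||
      (Nat.beq m 4 && frobChk (m + 3) (-(b + 2 : ℕ)) (frobP m b) (m + 1))) = true := by
  decide +kernel

lemma frobP_prime : ∀ m, m < 5 → ∀ b, b < 17 → (frobP m b).Prime := by
  have : ∀ m, m < 5 → ∀ b, b < 17 → (Nat.ble 2 (frobP m b) &&
      (List.range (frobP m b)).all fun d => Nat.ble d 1 || !Nat.beq (frobP m b % d) 0) = true := by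
    decide +kernel
  intro m hm b hb
  have h := this m hm b hb
  rw [Bool.and_eq_true, List.all_eq_true] at h
  rw [Nat.prime_def_lt]
  refine ⟨Nat.le_of_ble_eq_true h.1, fun d hd hdv => ?_⟩
  have h2 := h.2 d (List.mem_range.2 hd)
  have h1 := Nat.le_of_ble_eq_true h.1
  have h0 : d ≠ 0 := by rintro rfl; rw [zero_dvd_iff] at hdv; omega
  rw [Nat.mod_eq_zero_of_dvd hdv] at h2
  simp only [Nat.beq_refl, Bool.not_true, Bool.or_false, Nat.ble_eq] at h2
  omega

lemma sum_list_range_aux (f : ℕ → ℤ) (n : ℕ) : ((List.range n).map f).sum = ∑ j ∈ Finset.range n, f j := by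
  induction n with
  | zero => simp
  | succ k ih => rw [List.range_succ, List.map_append, List.sum_append, ih, Finset.sum_range_succ]; simp

lemma evG_eq (n : ℕ) (u : ℤ) (r : ℕ) : evG n u r = (GG n u).eval (r : ℤ) := by
  unfold evG GG
  rw [sum_list_range_aux, eval_finset_sum]
  simp

lemma evD_eq (n : ℕ) (u : ℤ) (r : ℕ) : evD n u r = (derivative (GG n u)).eval (r : ℤ) := by
  unfold evD GG
  rw [sum_list_range_aux, derivative_sum, eval_finset_sum]
  refine Finset.sum_congr rfl fun j _ => ?_
  rw [derivative_C_mul_X_pow]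
  simp [mul_assoc]

lemma perm2_even : ∀ x : Equiv.Perm (Fin 2), Equiv.Perm.sign x = 1 → x = 1 := by decide

section Frob3
open scoped Classical

lemma frobChk_sound (n : ℕ) (u : ℤ) (q k : ℕ) (hq : q.Prime) (h : frobChk n u q k = true)
    (hirr : Irreducible (QQ n u)) :
    ∃ σ : (QQ n u).Gal, (((QQ n u).map (algebraMap ℚ (QQ n u).SplittingField)).roots.toFinset.filter
      (fun x => σ x = x)).card = k := by
  haveI : Fact q.Prime := ⟨hq⟩
  unfold frobChk at h
  rw [Bool.and_eq_true, List.all_eq_true] at h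
  obtain ⟨h1, h2⟩ := h
  have h1 := Nat.eq_of_beq_eq_true h1
  have hmem : ∀ r, r ∈ frobS n u q ↔ r < q ∧ (q : ℤ) ∣ (GG n u).eval (r : ℤ) := by
    intro r
    unfold frobS
    rw [List.mem_filter, List.mem_range, decide_eq_true_eq, evG_eq, Int.dvd_iff_emod_eq_zero]
  have hnd : (frobS n u q).Nodup := List.Nodup.filter _ List.nodup_range
  obtain ⟨σ, hσ⟩ := frob_gal (GG n u) (GG_monic n u) q (frobS n u q).toFinset
    (fun r hr => ((hmem r).1 (List.mem_toFinset.1 hr)).1)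
    (fun r hr => by rw [List.mem_toFinset, hmem]; exact ⟨fun h => ⟨hr, h⟩, fun h => h.2⟩)
    (fun r hr => by
      have := h2 r (List.mem_toFinset.1 hr)
      rw [decide_eq_true_eq, evD_eq] at this
      rwa [Int.dvd_iff_emod_eq_zero])
    (QQ n u) rfl hirr.separable
  refine ⟨σ, hσ.trans ?_⟩
  rw [List.toFinset_card_of_nodup hnd, h1]

lemma edge5_all : ∀ m, m < 2 → ∀ b, b < 17 →
    ([(5, 2, 0), (5, 1, 0), (5, 1, 1), (5, 1, 2), (19, 1, 0)].any fun x : ℕ × ℕ × ℕ =>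
      edgeChk (m + 6) (-(b + 2 : ℕ)) x.1 5 x.2.1 x.2.2 (x.2.2 + 5)) = true := by
  decide +kernel

lemma gal5 (m : ℕ) (hm : m < 2) (b : ℕ) (hb : b < 17) (hirr : Irreducible (QQ (m + 6) (-(b + 2 : ℕ)))) :
    5 ∣ Nat.card (QQ (m + 6) (-(b + 2 : ℕ))).Gal := by
  have h := edge5_all m hm b hb
  rw [List.any_eq_true] at h
  obtain ⟨x, hx, h⟩ := h
  refine edgeChk_sound _ _ x.1 5 _ _ _ ?_ (by norm_num) (by omega) (by omega) (by omega) h hirr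
  simp only [List.mem_cons, List.not_mem_nil, or_false] at hx
  rcases hx with rfl | rfl | rfl | rfl | rfl <;> norm_num

open Equiv.Perm MulAction in
lemma gal_small (m : ℕ) (hm : m < 5) (u : ℤ) (hu1 : -18 ≤ u) (hu2 : u ≤ -2)
    (hE : (((m + 3 : ℕ) : ℤ), u) ∉ exceptionalSet) :
    Nonempty ((QQ (m + 3) u).Gal ≃* Equiv.Perm (Fin (m + 3))) := by
  have hirr := QQ_irreducible (m + 3) u (by omega) hu1 hu2
  have hD := nonsq_all (m + 3) u (by omega) hu1 hu2 hE
  obtain ⟨b, hb, rfl⟩ : ∃ b : ℕ, b < 17 ∧ u = -((b + 2 : ℕ) : ℤ) := ⟨(-u - 2).toNat, by omega, by omega⟩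
  have hp := frobP_prime m hm b hb
  have hprim : ∀ (G : Subgroup (Equiv.Perm (Fin (m + 3)))), IsPretransitive G (Fin (m + 3)) →
      Nat.card G = Nat.card (QQ (m + 3) (-((b + 2 : ℕ) : ℤ))).Gal → 3 ≤ m → IsPreprimitive G (Fin (m + 3)) := by
    intro G ht hc h3
    obtain ⟨k, rfl⟩ : ∃ k, m = k + 3 := ⟨m - 3, by omega⟩
    have hd := gal5 k (by omega) b hb hirr
    haveI : Fact (Nat.Prime 5) := ⟨by norm_num⟩
    have hd' : 5 ∣ Nat.card G := by rw [hc]; exact hd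
    obtain ⟨⟨g, hg⟩, hgo⟩ := exists_prime_orderOf_dvd_card' 5 hd'
    rw [Subgroup.orderOf_mk] at hgo
    have hcy : g.IsCycle := isCycle_of_prime_order' (by rw [hgo]; norm_num)
      (by rw [hgo, Fintype.card_fin]; omega)
    have hsc : g.support.card = 5 := by rw [← hgo]; exact hcy.orderOf.symm
    exact prim_of_cycle G g hg hcy (by rw [hsc]; norm_num) (by rw [hsc, Fintype.card_fin]; omega)
  have h := frob_all m hm b hb
  rw [Bool.or_eq_true] at h
  rcases h with h | h
  · refine gal_full2 (m + 3) _ (by omega) m hirr (frobChk_sound _ _ _ _ hp h hirr) ?_ hD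
    rintro G ht hc ho ⟨g, hg, hgs⟩
    have h3 : g.IsThreeCycle := card_support_eq_three_iff.1 (by omega)
    have hP : IsPreprimitive G (Fin (m + 3)) := by
      by_cases h3m : 3 ≤ m
      · exact hprim G ht hc h3m
      · exact prim_of_cycle G g hg h3.isCycle (by rw [h3.card_support]; norm_num)
          (by rw [h3.card_support, Fintype.card_fin]; omega)
    exact top_of_alt G (alternatingGroup_le_of_isPreprimitive_of_isThreeCycle_mem hP h3 hg) ho
  · rw [Bool.and_eq_true] at h
    have hm4 := Nat.eq_of_beq_eq_true h.1
    refine gal_full2 (m + 3) _ (by omega) (m + 1) hirr (frobChk_sound _ _ _ _ hp h.2 hirr) ?_ hD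
    rintro G ht hc ho ⟨g, hg, hgs⟩
    exact subgroup_eq_top_of_isPreprimitive_of_isSwap_mem (hprim G ht hc (by omega)) g
      (card_support_eq_two.1 (by omega)) hg

lemma gal_all (n : ℕ) (u : ℤ) (hn : 1 ≤ n) (hu1 : -18 ≤ u) (hu2 : u ≤ -2)
    (hE : ((n : ℤ), u) ∉ exceptionalSet) : Nonempty ((QQ n u).Gal ≃* Equiv.Perm (Fin n)) := by
  have hirr := QQ_irreducible n u hn hu1 hu2
  by_cases h8 : 8 ≤ n
  · exact gal_full n u hn hirr (fun G ht hc ho => top_of_alt G (alt_le n u h8 hu1 hu2 hE G ht hc) ho)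
      (nonsq_all n u (by omega) hu1 hu2 hE)
  by_cases h3 : 3 ≤ n
  · obtain ⟨m, rfl⟩ : ∃ m, n = m + 3 := ⟨n - 3, by omega⟩
    exact gal_small m (by omega) u hu1 hu2 hE
  by_cases h2 : n = 2
  · subst h2
    refine gal_full 2 u hn hirr (fun G ht hc ho => top_of_alt G ?_ ho) (nonsq_all 2 u le_rfl hu1 hu2 hE)
    intro x hx
    have : x = 1 := perm2_even x (Equiv.Perm.mem_alternatingGroup.1 hx)
    rw [this]; exact one_mem G
  · obtain rfl : n = 1 := by omega
    have hs : (QQ 1 u).Splits := Splits.of_natDegree_le_one (QQ_natDegree 1 u).le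
    haveI : Unique (QQ 1 u).Gal := Gal.uniqueGalOfSplits _ hs
    exact ⟨MulEquiv.ofUnique⟩
end Frob3

/-- For `n ≥ 1` and `-18 ≤ u ≤ -2` with `(n, u)` not exceptional, the generalised Laguerre
polynomial `L_n^{(u+1/2)}(x)` is irreducible over `ℚ` and its Galois group is the full
symmetric group on `n` letters. -/
theorem laguerre_irreducible_and_gal_symmetric (n : ℕ) (u : ℤ) (hn : 1 ≤ n)
    (hu1 : -18 ≤ u) (hu2 : u ≤ -2) (hE : ((n : ℤ), u) ∉ exceptionalSet) :
    Irreducible (laguerre n u) ∧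
      Nonempty ((laguerre n u).Gal ≃* Equiv.Perm (Fin n)) := by
  refine ⟨laguerre_irr n u (QQ_irreducible n u hn hu1 hu2), ?_⟩
  obtain ⟨e⟩ := laguerre_gal n u
  obtain ⟨f⟩ := gal_all n u hn hu1 hu2 hE
  exact ⟨e.trans f⟩
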